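/- arXiv:1312.1330 — 2 statements merged into one kernel-verified Lean document; each statement's English description precedes it below -/
import Mathlib

section
/- Let (R, 𝔪) be a local Noetherian ring, 𝔞 an ideal, M a nonzero finitely generated R-module of dimension d with H^d_𝔞(M) ≠ 0, and x ∈ R. Then H^d_𝔞(xM) = 0 if and only if x·H^d_𝔞(M) = 0. -/
open CategoryTheory

universe u

/-- `H^i_I(M) ≠ 0`: the `i`-th local cohomology of `M` with respect to `I` is nonzero. -/
abbrev LCNonzero {R : Type u} [CommRing R] (I : Ideal R) (i : ℕ)
    (M : Type u) [AddCommGroup M] [Module R M] : Prop :=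
  Nontrivial ((localCohomology I i).obj (ModuleCat.of R M))

/-- Cohomological dimension `cd(I, M) = sup {i : H^i_I(M) ≠ 0}`, as an element of
`WithBot ℕ∞` (it is `⊥` if all local cohomology of `M` vanishes). -/
noncomputable def cohDim {R : Type u} [CommRing R] (I : Ideal R)
    (M : Type u) [AddCommGroup M] [Module R M] : WithBot ℕ∞ :=
  sSup {n : WithBot ℕ∞ | ∃ i : ℕ, n = (i : ℕ∞) ∧ LCNonzero I i M}

/-- Krull dimension of a module, i.e. the Krull dimension of `R ⧸ Ann_R M`. -/
noncomputable def modDim (R : Type u) [CommRing R]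
    (M : Type u) [AddCommGroup M] [Module R M] : WithBot ℕ∞ :=
  ringKrullDim (R ⧸ Module.annihilator R M)

section part_L1
open CategoryTheory


namespace LCx

open Abelian

section Ext
variable {R : Type u} [CommRing R]

/-- quotient map -/
noncomputable def qmap {I J : Ideal R} (h : I ≤ J) :
    ModuleCat.of R (R ⧸ I) ⟶ ModuleCat.of R (R ⧸ J) :=
  ModuleCat.ofHom (Submodule.factor h)

lemma qmap_comp {I J K : Ideal R} (h : I ≤ J) (h' : J ≤ K) :
    qmap h ≫ qmap h' = qmap (h.trans h') := by
  ext
  simp [qmap]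

lemma qmap_refl {I : Ideal R} (h : I ≤ I) : qmap h = 𝟙 _ := by
  ext
  simp [qmap]

variable (N N' N'' : Type u) [AddCommGroup N] [Module R N] [AddCommGroup N'] [Module R N']
  [AddCommGroup N''] [Module R N'']

/-- Ext of quotient -/
abbrev XX (I : Ideal R) (i : ℕ) : Type u :=
  Abelian.Ext (ModuleCat.of R (R ⧸ I)) (ModuleCat.of R N) i

/-- precomposition with quotient map -/
noncomputable def pre {I J : Ideal R} (h : I ≤ J) (i : ℕ) : XX N J i →ₗ[R] XX N I i where
  toFun α := (Ext.mk₀ (qmap h)).comp α (zero_add i)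
  map_add' _ _ := Ext.comp_add _ _ _ _
  map_smul' _ _ := Ext.comp_smul _ _ _ _

lemma pre_apply {I J : Ideal R} (h : I ≤ J) (i : ℕ) (α : XX N J i) :
    pre N h i α = (Ext.mk₀ (qmap h)).comp α (zero_add i) := rfl

lemma pre_pre {I J K : Ideal R} (h : I ≤ J) (h' : J ≤ K) (i : ℕ) (α : XX N K i) :
    pre N h i (pre N h' i α) = pre N (h.trans h') i α := by
  simp only [pre_apply, Ext.mk₀_comp_mk₀_assoc, qmap_comp]

lemma pre_refl {I : Ideal R} (h : I ≤ I) (i : ℕ) (α : XX N I i) :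
    pre N h i α = α := by
  simp only [pre_apply, qmap_refl, Ext.mk₀_id_comp]

variable {N N' N''} in
/-- postcomposition -/
noncomputable def post (I : Ideal R) (i : ℕ) (f : N →ₗ[R] N') : XX N I i →ₗ[R] XX N' I i where
  toFun α := α.comp (Ext.mk₀ (ModuleCat.ofHom f)) (add_zero i)
  map_add' _ _ := Ext.add_comp _ _ _ _
  map_smul' _ _ := Ext.smul_comp _ _ _ _

variable {N N' N''} in
lemma post_apply (I : Ideal R) (i : ℕ) (f : N →ₗ[R] N') (α : XX N I i) :
    post I i f α = α.comp (Ext.mk₀ (ModuleCat.ofHom f)) (add_zero i) := rfl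

variable {N N' N''} in
lemma post_pre {I J : Ideal R} (h : I ≤ J) (i : ℕ) (f : N →ₗ[R] N') (α : XX N J i) :
    post I i f (pre N h i α) = pre N' h i (post J i f α) := by
  simp only [pre_apply, post_apply, Ext.comp_assoc_of_third_deg_zero]

lemma smul_XX_eq_zero {I : Ideal R} {r : R} (hr : r ∈ I) (i : ℕ) (α : XX N I i) : r • α = 0 := by
  have h0 : r • 𝟙 (ModuleCat.of R (R ⧸ I)) = 0 := by
    ext
    change r • (Submodule.mkQ I (1 : R)) = 0
    rw [← map_smul, smul_eq_mul, mul_one]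
    exact Ideal.Quotient.eq_zero_iff_mem.mpr hr
  calc r • α = (Ext.mk₀ (r • 𝟙 (ModuleCat.of R (R ⧸ I)))).comp α (zero_add i) := by
        rw [Ext.mk₀_smul, Ext.smul_comp, Ext.mk₀_id_comp]
    _ = 0 := by rw [h0, Ext.mk₀_zero, Ext.zero_comp]

/-- transition maps -/
noncomputable def tr (b : Ideal R) (i : ℕ) : ∀ s t : ℕ, s ≤ t → XX N (b ^ s) i →ₗ[R] XX N (b ^ t) i :=
  fun _ _ h => pre N (Ideal.pow_le_pow_right h) i

instance (b : Ideal R) (i : ℕ) :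
    DirectedSystem (fun t : ℕ => XX N (b ^ t) i) (fun s t h => tr N b i s t h) where
  map_self _ _ := pre_refl N _ _ _
  map_map _ _ _ _ _ _ := pre_pre N _ _ _ _

/-- local cohomology, direct limit of Ext -/
def HH (b : Ideal R) (i : ℕ) : Type u :=
  Module.DirectLimit (fun t : ℕ => XX N (b ^ t) i) (tr N b i)

noncomputable instance (b : Ideal R) (i : ℕ) : AddCommGroup (HH N b i) :=
  inferInstanceAs (AddCommGroup (Module.DirectLimit (fun t : ℕ => XX N (b ^ t) i) (tr N b i)))

noncomputable instance (b : Ideal R) (i : ℕ) : Module R (HH N b i) :=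
  inferInstanceAs (Module R (Module.DirectLimit (fun t : ℕ => XX N (b ^ t) i) (tr N b i)))

/-- inclusion in the limit -/
noncomputable def ofX (b : Ideal R) (i t : ℕ) : XX N (b ^ t) i →ₗ[R] HH N b i :=
  Module.DirectLimit.of R ℕ (fun t : ℕ => XX N (b ^ t) i) (tr N b i) t

lemma ofX_pre (b : Ideal R) (i : ℕ) {s t : ℕ} (h : s ≤ t) (α : XX N (b ^ s) i) :
    ofX N b i t (pre N (Ideal.pow_le_pow_right h) i α) = ofX N b i s α :=
  Module.DirectLimit.of_f (R := R) (f := tr N b i) (hij := h)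

lemma exists_ofX (b : Ideal R) (i : ℕ) (h : HH N b i) : ∃ t, ∃ α : XX N (b ^ t) i,
    ofX N b i t α = h :=
  Module.DirectLimit.exists_of h

lemma ofX_eq_zero {b : Ideal R} {i t : ℕ} {α : XX N (b ^ t) i} (h : ofX N b i t α = 0) :
    ∃ t', ∃ h : t ≤ t', pre N (Ideal.pow_le_pow_right h) i α = 0 :=
  Module.DirectLimit.of.zero_exact (R := R) (f := tr N b i) h

/-- lift from the limit -/
noncomputable def liftX (b : Ideal R) (i : ℕ) {P : Type u} [AddCommGroup P] [Module R P]
    (g : ∀ t, XX N (b ^ t) i →ₗ[R] P)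
    (hg : ∀ s t (h : s ≤ t) x, g t (pre N (Ideal.pow_le_pow_right h) i x) = g s x) :
    HH N b i →ₗ[R] P :=
  Module.DirectLimit.lift R ℕ (fun t : ℕ => XX N (b ^ t) i) (tr N b i) g hg

@[simp]
lemma liftX_of (b : Ideal R) (i : ℕ) {P : Type u} [AddCommGroup P] [Module R P]
    (g : ∀ t, XX N (b ^ t) i →ₗ[R] P)
    (hg : ∀ s t (h : s ≤ t) x, g t (pre N (Ideal.pow_le_pow_right h) i x) = g s x) (t : ℕ) (x) :
    liftX N b i g hg (ofX N b i t x) = g t x :=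
  Module.DirectLimit.lift_of (R := R) _ _ _

variable {N N' N''} in
/-- functoriality -/
noncomputable def hmap (b : Ideal R) (i : ℕ) (f : N →ₗ[R] N') : HH N b i →ₗ[R] HH N' b i :=
  liftX N b i (fun t => ofX N' b i t ∘ₗ post (b ^ t) i f) (by
    intro s t h x
    simp only [LinearMap.comp_apply, post_pre]
    rw [ofX_pre N' b i h])

variable {N N' N''} in
@[simp]
lemma hmap_of (b : Ideal R) (i : ℕ) (f : N →ₗ[R] N') (t : ℕ) (x) :
    hmap b i f (ofX N b i t x) = ofX N' b i t (post (b ^ t) i f x) := by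
  simp [hmap]

variable {N N' N''} in
lemma hmap_hmap (b : Ideal R) (i : ℕ) (f : N →ₗ[R] N') (g : N' →ₗ[R] N'') (x) :
    hmap b i g (hmap b i f x) = hmap b i (g ∘ₗ f) x := by
  obtain ⟨t, x, rfl⟩ := exists_ofX N b i x
  simp only [hmap_of, post_apply, Ext.comp_assoc_of_third_deg_zero, Ext.mk₀_comp_mk₀,
    ← ModuleCat.ofHom_comp]

lemma hmap_smul_id (b : Ideal R) (i : ℕ) (r : R) (x) :
    hmap b i (r • (LinearMap.id : N →ₗ[R] N)) x = r • x := by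
  obtain ⟨t, x, rfl⟩ := exists_ofX N b i x
  rw [hmap_of, ← map_smul, post_apply, Ext.smul_eq_comp_mk₀]
  rfl

lemma hmap_id (b : Ideal R) (i : ℕ) (x) :
    hmap b i (LinearMap.id : N →ₗ[R] N) x = x := by
  have := hmap_smul_id N b i (1 : R) x
  simpa using this

/-- comparison -/
noncomputable def hcmp {b c : Ideal R} (h : b ≤ c) (i : ℕ) : HH N c i →ₗ[R] HH N b i :=
  liftX N c i (fun t => ofX N b i t ∘ₗ pre N (Ideal.pow_right_mono h t) i) (by
    intro s t h x
    simp only [LinearMap.comp_apply]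
    rw [pre_pre, ← ofX_pre N b i h, pre_pre])

@[simp]
lemma hcmp_of {b c : Ideal R} (h : b ≤ c) (i : ℕ) (t : ℕ) (x) :
    hcmp N h i (ofX N c i t x) = ofX N b i t (pre N (Ideal.pow_right_mono h t) i x) := by
  simp [hcmp]

variable {N N' N''} in
lemma hcmp_hmap {b c : Ideal R} (h : b ≤ c) (i : ℕ) (f : N →ₗ[R] N') (x) :
    hcmp N' h i (hmap c i f x) = hmap b i f (hcmp N h i x) := by
  obtain ⟨t, x, rfl⟩ := exists_ofX N c i x
  simp [post_pre]

lemma hcmp_hcmp {b c e : Ideal R} (h : b ≤ c) (h' : c ≤ e) (i : ℕ) (x) :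
    hcmp N h i (hcmp N h' i x) = hcmp N (h.trans h') i x := by
  obtain ⟨t, x, rfl⟩ := exists_ofX N e i x
  simp [pre_pre]

lemma hcmp_refl {b : Ideal R} (h : b ≤ b) (i : ℕ) (x) :
    hcmp N h i x = x := by
  obtain ⟨t, x, rfl⟩ := exists_ofX N b i x
  simp [pre_refl]

lemma HH_torsion (b : Ideal R) (i : ℕ) (h : HH N b i) : ∃ t, ∀ r ∈ b ^ t, r • h = 0 := by
  obtain ⟨t, x, rfl⟩ := exists_ofX N b i h
  exact ⟨t, fun r hr => by rw [← map_smul, smul_XX_eq_zero N hr, map_zero]⟩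

variable {N N' N''} in
/-- the short complex -/
abbrev sc (f : N →ₗ[R] N') (g : N' →ₗ[R] N'') (h : Function.Exact f g) :
    ShortComplex (ModuleCat.{u} R) :=
  ShortComplex.mk (ModuleCat.ofHom f) (ModuleCat.ofHom g) (by
    ext x; simp [h.apply_apply_eq_zero])

variable {N N' N''} in
lemma sc_exact {f : N →ₗ[R] N'} {g : N' →ₗ[R] N''} (hf : Function.Injective f)
    (hg : Function.Surjective g) (h : Function.Exact f g) : (sc f g h).ShortExact :=
  { exact := by
      rw [ShortComplex.ShortExact.moduleCat_exact_iff_function_exact]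
      exact h
    mono_f := by rw [ModuleCat.mono_iff_injective]; exact hf
    epi_g := by rw [ModuleCat.epi_iff_surjective]; exact hg }

variable {N N' N''} in
lemma hmap_exact {f : N →ₗ[R] N'} {g : N' →ₗ[R] N''} (hf : Function.Injective f)
    (hg : Function.Surjective g) (h : Function.Exact f g) (b : Ideal R) (i : ℕ) :
    Function.Exact (hmap b i f) (hmap b i g) := by
  have hS := sc_exact hf hg h
  intro y
  constructor
  · intro hy
    obtain ⟨t, y, rfl⟩ := exists_ofX N' b i y
    rw [hmap_of] at hy
    obtain ⟨t', ht, h0⟩ := ofX_eq_zero _ hy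
    rw [← post_pre] at h0
    obtain ⟨x, hx⟩ := Ext.covariant_sequence_exact₂ (ModuleCat.of R (R ⧸ b ^ t')) hS
      (pre N' (Ideal.pow_le_pow_right ht) i y) h0
    refine ⟨ofX N b i t' x, ?_⟩
    rw [hmap_of, ← ofX_pre N' b i ht]
    congr 1
  · rintro ⟨x, rfl⟩
    rw [hmap_hmap, h.linearMap_comp_eq_zero]
    have := hmap_smul_id N'' b i (0 : R)
    obtain ⟨t, x, rfl⟩ := exists_ofX N b i x
    rw [hmap_of, post_apply]
    simp

variable {N N' N''} in
lemma exists_delta {f : N →ₗ[R] N'} {g : N' →ₗ[R] N''} (hf : Function.Injective f)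
    (hg : Function.Surjective g) (h : Function.Exact f g) (b : Ideal R) (i : ℕ) :
    ∃ δ : HH N'' b i →ₗ[R] HH N b (i + 1), Function.Exact (hmap b i g) δ ∧
      Function.Exact δ (hmap b (i + 1) f) := by
  have hS := sc_exact hf hg h
  let dl : ∀ t, XX N'' (b ^ t) i →ₗ[R] XX N (b ^ t) (i + 1) := fun t =>
    { toFun := fun α => α.comp hS.extClass rfl
      map_add' := fun _ _ => Ext.add_comp _ _ _ _
      map_smul' := fun _ _ => Ext.smul_comp _ _ _ _ }
  have hdl : ∀ s t (h : s ≤ t) x, dl t (pre N'' (Ideal.pow_le_pow_right h) i x) =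
      pre N (Ideal.pow_le_pow_right h) (i + 1) (dl s x) := by
    intro s t h x
    change ((Ext.mk₀ _).comp x (zero_add _)).comp hS.extClass rfl =
      (Ext.mk₀ _).comp (x.comp hS.extClass rfl) (zero_add _)
    rw [Ext.comp_assoc]
    omega
  let δ : HH N'' b i →ₗ[R] HH N b (i + 1) :=
    liftX N'' b i (fun t => ofX N b (i + 1) t ∘ₗ dl t) (by
      intro s t h x
      simp only [LinearMap.comp_apply]
      rw [hdl s t h, ofX_pre N b _ h])
  have hδ : ∀ t x, δ (ofX N'' b i t x) = ofX N b (i + 1) t (dl t x) := by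
    intro t x; simp [δ]
  refine ⟨δ, ?_, ?_⟩
  · intro y
    constructor
    · intro hy
      obtain ⟨t, y, rfl⟩ := exists_ofX N'' b i y
      rw [hδ] at hy
      obtain ⟨t', ht, h0⟩ := ofX_eq_zero _ hy
      rw [← hdl t t' ht] at h0
      obtain ⟨x, hx⟩ := Ext.covariant_sequence_exact₃ (ModuleCat.of R (R ⧸ b ^ t')) hS
        (pre N'' (Ideal.pow_le_pow_right ht) i y) rfl h0
      refine ⟨ofX N' b i t' x, ?_⟩
      rw [hmap_of, ← ofX_pre N'' b i ht]
      congr 1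
    · rintro ⟨x, rfl⟩
      obtain ⟨t, x, rfl⟩ := exists_ofX N' b i x
      rw [hmap_of, hδ]
      convert map_zero (ofX N b (i + 1) t)
      change (x.comp (Ext.mk₀ (sc f g h).g) (add_zero _)).comp hS.extClass rfl = 0
      rw [Ext.comp_assoc_of_second_deg_zero, hS.comp_extClass, Ext.comp_zero]
  · intro y
    constructor
    · intro hy
      obtain ⟨t, y, rfl⟩ := exists_ofX N b (i + 1) y
      rw [hmap_of] at hy
      obtain ⟨t', ht, h0⟩ := ofX_eq_zero _ hy
      rw [← post_pre] at h0
      obtain ⟨x, hx⟩ := Ext.covariant_sequence_exact₁ (ModuleCat.of R (R ⧸ b ^ t')) hS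
        (pre N (Ideal.pow_le_pow_right ht) (i + 1) y) h0 rfl
      refine ⟨ofX N'' b i t' x, ?_⟩
      rw [hδ, ← ofX_pre N b (i + 1) ht]
      congr 1
    · rintro ⟨x, rfl⟩
      obtain ⟨t, x, rfl⟩ := exists_ofX N'' b i x
      rw [hδ, hmap_of]
      convert map_zero (ofX N' b (i + 1) t)
      change (x.comp hS.extClass rfl).comp (Ext.mk₀ (sc f g h).f) (add_zero _) = 0
      rw [Ext.comp_assoc_of_third_deg_zero, hS.extClass_comp, Ext.comp_zero]

instance [IsNoetherianRing R] [Module.Finite R N] (I : Ideal R) (i : ℕ) :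
    Module.Finite R (XX N I i) := by
  unfold XX; infer_instance

end Ext
end LCx
end part_L1

section part_L1b
open CategoryTheory


namespace LCx

open Abelian CochainComplex HomComplex

section zero
variable {C : Type*} [Category C] [Abelian C] [HasExt.{u} C]

lemma proj_extMk_zero {X Y : C} (P : ProjectiveResolution X) (f : P.complex.X 0 ⟶ Y)
    (hf : P.complex.d 1 0 ≫ f = 0) (h : P.extMk f 1 rfl hf = 0) : f = 0 := by
  simp only [← P.extEquivCohomologyClass.apply_eq_iff_eq,
    ProjectiveResolution.extEquivCohomologyClass_extMk,
    ProjectiveResolution.extEquivCohomologyClass_zero,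
    CohomologyClass.mk_eq_zero_iff] at h
  rw [Cocycle.toSingleMk_mem_coboundaries_iff _ _ _ _ _ 1 (by simp)] at h
  obtain ⟨g, hg⟩ := h
  have hz : g = 0 := (CochainComplex.isZero_of_isStrictlyLE P.cochainComplex 0 1).eq_of_src _ _
  rw [hz, Limits.comp_zero] at hg
  rw [← cancel_epi (P.cochainComplexXIso (-(0 : ℕ)) 0 rfl).hom, ← hg, Limits.comp_zero]

lemma inj_extMk_zero {X Y : C} (P : InjectiveResolution Y) (f : X ⟶ P.cocomplex.X 0)
    (hf : f ≫ P.cocomplex.d 0 1 = 0) (h : P.extMk f 1 rfl hf = 0) : f = 0 := by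
  simp only [← P.extEquivCohomologyClass.apply_eq_iff_eq,
    InjectiveResolution.extEquivCohomologyClass_extMk,
    InjectiveResolution.extEquivCohomologyClass_zero,
    CohomologyClass.mk_eq_zero_iff] at h
  rw [Cocycle.fromSingleMk_mem_coboundaries_iff _ _ _ _ _ (-1) (by simp)] at h
  obtain ⟨g, hg⟩ := h
  have hz : g = 0 := (CochainComplex.isZero_of_isStrictlyGE P.cochainComplex 0 (-1)).eq_of_tgt _ _
  rw [hz, Limits.zero_comp] at hg
  rw [← cancel_mono (P.cochainComplexXIso ((0 : ℕ) : ℤ) 0 rfl).inv, ← hg, Limits.zero_comp]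
end zero

section homology
variable {R : Type u} [CommRing R] (K : CochainComplex (ModuleCat.{u} R) ℕ) (n : ℕ)

lemma homologyπ_surj : Function.Surjective (K.homologyπ n) :=
  (ModuleCat.epi_iff_surjective _).mp inferInstance

lemma iCycles_inj : Function.Injective (K.iCycles n) :=
  (ModuleCat.mono_iff_injective _).mp inferInstance

lemma iCycles_surj (z : K.X n) (hz : K.d n (n + 1) z = 0) : ∃ y, K.iCycles n y = z := by
  have h := ShortComplex.exact_of_f_is_kernel
    (ShortComplex.mk (K.iCycles n) (K.d n (n + 1)) (K.iCycles_d n (n + 1)))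
    (K.cyclesIsKernel n (n + 1) (by simp))
  rw [ShortComplex.moduleCat_exact_iff] at h
  exact h z hz

lemma homologyπ_eq_zero {p : ℕ} (hp : (ComplexShape.up ℕ).prev n = p) (z : K.cycles n) :
    K.homologyπ n z = 0 ↔ ∃ w, K.d p n w = K.iCycles n z := by
  have h := ShortComplex.exact_of_g_is_cokernel
    (ShortComplex.mk (K.toCycles p n) (K.homologyπ n) (by simp))
    (K.homologyIsCokernel p n hp)
  rw [ShortComplex.moduleCat_exact_iff] at h
  have e : ∀ w, K.iCycles n (K.toCycles p n w) = K.d p n w := fun w => by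
    rw [← ConcreteCategory.comp_apply, K.toCycles_i]
  constructor
  · intro hz
    obtain ⟨w, hw⟩ := h z hz
    exact ⟨w, by rw [← e]; exact congrArg _ hw⟩
  · rintro ⟨w, hw⟩
    rw [← e] at hw
    rw [← iCycles_inj K n hw, ← ConcreteCategory.comp_apply, K.toCycles_comp_homologyπ]
    rfl
end homology

section bridge
variable {R : Type u} [CommRing R]

variable {X X' Y : ModuleCat.{u} R}

/-- the hom complex -/
noncomputable abbrev KK (P : ProjectiveResolution X) (Y : ModuleCat.{u} R) :
    CochainComplex (ModuleCat.{u} R) ℕ := P.complex.linearYonedaObj R Y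

/-- underlying morphism of a cycle -/
noncomputable def cyc (P : ProjectiveResolution X) (n : ℕ) (z : (KK P Y).cycles n) :
    P.complex.X n ⟶ Y :=
  (KK P Y).iCycles n z

lemma KK_d (P : ProjectiveResolution X) (i j : ℕ) (z : P.complex.X i ⟶ Y) :
    ((KK P Y).d i j) z = P.complex.d j i ≫ z := rfl

lemma cyc_d (P : ProjectiveResolution X) (n : ℕ) (z : (KK P Y).cycles n) :
    P.complex.d (n + 1) n ≫ cyc P n z = 0 := by
  have := KK_d P n (n + 1) (cyc P n z)
  rw [← this, cyc, ← ConcreteCategory.comp_apply, HomologicalComplex.iCycles_d]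
  rfl

/-- cycles to Ext -/
noncomputable def thetaB (P : ProjectiveResolution X) (n : ℕ) :
    (KK P Y).cycles n →ₗ[R] Abelian.Ext X Y n where
  toFun z := P.extMk (cyc P n z) (n + 1) rfl (cyc_d P n z)
  map_add' z w := by
    rw [ProjectiveResolution.add_extMk]
    congr 1
    exact map_add ((KK P Y).iCycles n).hom z w
  map_smul' r z := by
    rw [RingHom.id_apply, Ext.smul_eq_comp_mk₀, ProjectiveResolution.extMk_comp_mk₀]
    congr 1
    rw [Linear.comp_smul, Category.comp_id]
    exact map_smul ((KK P Y).iCycles n).hom r z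

lemma thetaB_surj (P : ProjectiveResolution X) (n : ℕ) :
    Function.Surjective (thetaB (Y := Y) P n) := by
  intro α
  obtain ⟨f, hf, rfl⟩ := P.extMk_surjective α (n + 1) rfl
  obtain ⟨z, hz⟩ := iCycles_surj (KK P Y) n f hf
  refine ⟨z, ?_⟩
  change P.extMk (cyc P n z) (n + 1) rfl (cyc_d P n z) = _
  congr 1

lemma thetaB_ker (P : ProjectiveResolution X) (n : ℕ) (z : (KK P Y).cycles n) :
    (KK P Y).homologyπ n z = 0 ↔ thetaB P n z = 0 := by
  change _ ↔ P.extMk (cyc P n z) (n + 1) rfl (cyc_d P n z) = 0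
  cases n with
  | zero =>
    rw [homologyπ_eq_zero (KK P Y) 0 (p := 0) (by simp)]
    constructor
    · rintro ⟨w, hw⟩
      have : cyc P 0 z = 0 := by
        rw [cyc, ← hw, HomologicalComplex.shape _ _ _ (by simp)]; rfl
      simp [this]
    · intro h
      have := proj_extMk_zero P _ (cyc_d P 0 z) h
      refine ⟨0, ?_⟩
      rw [map_zero]
      exact this.symm
  | succ n =>
    rw [homologyπ_eq_zero (KK P Y) (n + 1) (p := n) (by simp),
      P.extMk_eq_zero_iff _ _ _ _ n rfl]
    rfl

/-- homology is Ext -/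
noncomputable def eB (P : ProjectiveResolution X) (n : ℕ) :
    (KK P Y).homology n ≃ₗ[R] Abelian.Ext X Y n :=
  (LinearMap.quotKerEquivOfSurjective ((KK P Y).homologyπ n).hom
    (homologyπ_surj (KK P Y) n)).symm ≪≫ₗ
  Submodule.quotEquivOfEq _ (LinearMap.ker (thetaB (Y := Y) P n)) (by
    ext z; exact thetaB_ker P n z) ≪≫ₗ
  LinearMap.quotKerEquivOfSurjective (thetaB (Y := Y) P n) (thetaB_surj P n)

lemma eB_pi (P : ProjectiveResolution X) (n : ℕ) (z : (KK P Y).cycles n) :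
    eB P n ((KK P Y).homologyπ n z) = thetaB P n z := by
  have : (LinearMap.quotKerEquivOfSurjective ((KK P Y).homologyπ n).hom
    (homologyπ_surj (KK P Y) n)).symm ((KK P Y).homologyπ n z) = Submodule.Quotient.mk z := by
    rw [LinearEquiv.symm_apply_eq]
    rfl
  simp only [eB, LinearEquiv.trans_apply]
  erw [this]
  rfl

/-- induced map on hom complexes -/
noncomputable def KKmap {P' : ProjectiveResolution X'} {P : ProjectiveResolution X}
    (φ : P'.complex ⟶ P.complex) (Y : ModuleCat.{u} R) : KK P Y ⟶ KK P' Y :=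
  (HomologicalComplex.unopFunctor _ _).map
    ((((((linearYoneda R (ModuleCat.{u} R)).obj Y).rightOp.mapHomologicalComplex _).map φ)).op)

lemma eB_nat {P' : ProjectiveResolution X'} {P : ProjectiveResolution X} {g : X' ⟶ X}
    (φ : ProjectiveResolution.Hom P' P g) (n : ℕ) (x : (KK P Y).homology n) :
    eB P' n (HomologicalComplex.homologyMap (KKmap φ.hom Y) n x) =
      (Ext.mk₀ g).comp (eB P n x) (zero_add n) := by
  obtain ⟨z, rfl⟩ := homologyπ_surj (KK P Y) n x
  rw [← ConcreteCategory.comp_apply, HomologicalComplex.homologyπ_naturality,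
    ConcreteCategory.comp_apply, eB_pi, eB_pi]
  change P'.extMk (cyc P' n _) (n + 1) rfl (cyc_d P' n _) =
    (Ext.mk₀ g).comp (P.extMk (cyc P n z) (n + 1) rfl (cyc_d P n z)) (zero_add n)
  rw [ProjectiveResolution.mk₀_comp_extMk _ _ _ _ φ]
  congr 1
  rw [cyc, ← ConcreteCategory.comp_apply, HomologicalComplex.cyclesMap_i]
  rfl

lemma absl {C : Type*} [Category C] {D' D H' H : Cᵒᵖ} {K' K : C} (i' : H' ⟶ D') (i : H ⟶ D)
    (m : D' ⟶ D) (k : H' ⟶ H) (o' : H' ≅ Opposite.op K') (o : H ≅ Opposite.op K) (c : K ⟶ K')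
    (h1 : i' ≫ m = k ≫ i) (h2 : k ≫ o.hom = o'.hom ≫ c.op) :
    m.unop ≫ (i'.unop ≫ o'.inv.unop) = (i.unop ≫ o.inv.unop) ≫ c := by
  apply Quiver.Hom.op_inj
  simp only [op_comp, Quiver.Hom.op_unop, Category.assoc]
  rw [h1, ← Category.assoc, ← Category.assoc]
  congr 1
  rw [Iso.inv_comp_eq, ← Category.assoc, ← h2, Category.assoc, Iso.hom_inv_id, Category.comp_id]

lemma isoExt_nat {P' : ProjectiveResolution X'} {P : ProjectiveResolution X} {g : X' ⟶ X}
    (φ : ProjectiveResolution.Hom P' P g) (n : ℕ) :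
    ((_root_.Ext R (ModuleCat.{u} R) n).map g.op).app Y ≫ (P'.isoExt n Y).hom =
      (P.isoExt n Y).hom ≫ HomologicalComplex.homologyMap (KKmap φ.hom Y) n := by
  have h1 := ProjectiveResolution.isoLeftDerivedObj_inv_naturality g P' P φ.hom
    (by simpa using φ.hom_f_zero_comp_π_f_zero)
    ((linearYoneda R (ModuleCat.{u} R)).obj Y).rightOp n
  have h2 : HomologicalComplex.homologyMap
      ((((linearYoneda R (ModuleCat.{u} R)).obj Y).rightOp.mapHomologicalComplex _).map φ.hom) n ≫
        ((KK P Y).homologyOp n).hom = ((KK P' Y).homologyOp n).hom ≫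
          (HomologicalComplex.homologyMap (KKmap φ.hom Y) n).op :=
    HomologicalComplex.homologyOp_hom_naturality (KKmap φ.hom Y) n
  exact absl _ _ _ _ _ _ _ h1 h2

/-- old Ext is new Ext -/
noncomputable def extBridge (X Y : ModuleCat.{u} R) (n : ℕ) :
    ((_root_.Ext R (ModuleCat.{u} R) n).obj (Opposite.op X)).obj Y ≃ₗ[R] Abelian.Ext X Y n :=
  ((projectiveResolution X).isoExt n Y).toLinearEquiv ≪≫ₗ eB (projectiveResolution X) n

lemma extBridge_nat {X X' : ModuleCat.{u} R} (g : X' ⟶ X) (Y : ModuleCat.{u} R) (n : ℕ) (x) :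
    extBridge X' Y n (((_root_.Ext R (ModuleCat.{u} R) n).map g.op).app Y x) =
      (Ext.mk₀ g).comp (extBridge X Y n x) (zero_add n) := by
  let φ : ProjectiveResolution.Hom (projectiveResolution X') (projectiveResolution X) g :=
    { hom := ProjectiveResolution.lift g _ _
      hom_f_zero_comp_π_f_zero := by
        rw [← HomologicalComplex.comp_f, ProjectiveResolution.lift_commutes]
        rfl }
  have h := isoExt_nat (Y := Y) φ n
  have h' := congrArg (fun f => f.hom x) h
  simp only [ModuleCat.hom_comp, LinearMap.comp_apply] at h'
  change eB _ n (((projectiveResolution X').isoExt n Y).hom _) =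
    (Ext.mk₀ g).comp (eB _ n (((projectiveResolution X).isoExt n Y).hom x)) (zero_add n)
  rw [← eB_nat φ]
  exact congrArg _ h'

open Opposite Limits

theorem exists_lc_equiv (b : Ideal R) (i : ℕ) (N : Type u) [AddCommGroup N] [Module R N] :
    Nonempty ((localCohomology b i).obj (ModuleCat.of R N) ≃ₗ[R] HH N b i) := by
  let D := localCohomology.diagram (localCohomology.idealPowersDiagram b) i
  have hc : HasColimit D := localCohomology.hasColimitDiagram.{u, 0} _ i
  let Y := ModuleCat.of R N
  let c : Cocone (D ⋙ (evaluation _ _).obj Y) :=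
    ((evaluation _ _).obj Y).mapCocone (colimit.cocone D)
  have hcol : IsColimit c := isColimitOfPreserves _ (colimit.isColimit D)
  -- transition
  have hnat : ∀ (j j' : ℕᵒᵖᵒᵖ) (f : j ⟶ j') (x : (D.obj j).obj Y),
      extBridge _ Y i ((D.map f).app Y x) =
        pre N (Ideal.pow_le_pow_right (leOfHom f.unop.unop)) i (extBridge _ Y i x) := by
    intro j j' f x
    exact extBridge_nat ((localCohomology.ringModIdeals
      (localCohomology.idealPowersDiagram b)).map f.unop) Y i x
  let gj : ∀ j : ℕᵒᵖᵒᵖ, (D.obj j).obj Y →ₗ[R] HH N b i := fun j =>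
    ofX N b i j.unop.unop ∘ₗ (extBridge _ Y i).toLinearMap
  let s : Cocone (D ⋙ (evaluation _ _).obj Y) :=
    { pt := ModuleCat.of R (HH N b i)
      ι := { app := fun j => ModuleCat.ofHom (gj j)
             naturality := by
               intro j j' f
               ext x
               change ofX N b i _ (extBridge _ Y i ((D.map f).app Y x)) =
                 ofX N b i _ (extBridge _ Y i x)
               exact (congrArg (ofX N b i _) (hnat j j' f x)).trans (ofX_pre N b i (leOfHom f.unop.unop) _) } }
  let F : c.pt →ₗ[R] HH N b i := (hcol.desc s).hom
  have hF : ∀ j x, F (c.ι.app j x) = gj j x := by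
    intro j x
    have := hcol.fac s j
    exact congrArg (fun f => f.hom x) this
  let hj : ∀ t, XX N (b ^ t) i →ₗ[R] c.pt := fun t =>
    (c.ι.app (op (op t))).hom ∘ₗ (extBridge _ Y i).symm.toLinearMap
  let G : HH N b i →ₗ[R] c.pt := liftX N b i hj (by
    intro s t h x
    have h1 := c.w ((homOfLE h).op.op : op (op s) ⟶ op (op t))
    have h2 := congrArg (fun f => f.hom ((extBridge _ Y i).symm x)) h1
    change c.ι.app (op (op t)) _ = c.ι.app (op (op s)) _
    refine Eq.trans ?_ h2
    change _ = c.ι.app (op (op t)) _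
    refine congrArg (c.ι.app (op (op t))) ?_
    refine (LinearEquiv.symm_apply_eq (extBridge _ Y i)).mpr ?_
    refine Eq.trans ?_ (hnat _ _ ((homOfLE h).op.op : op (op s) ⟶ op (op t)) _).symm
    exact congrArg _ (LinearEquiv.apply_symm_apply (extBridge _ Y i) x).symm)
  have hGF : ∀ x, F (G x) = x := by
    intro x
    obtain ⟨t, x, rfl⟩ := exists_ofX N b i x
    simp only [G, liftX_of, hj]
    change F (c.ι.app (op (op t)) _) = _
    rw [hF]
    exact congrArg (ofX N b i t) (LinearEquiv.apply_symm_apply (extBridge _ Y i) x)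
  have hFG : ∀ y, G (F y) = y := by
    have : hcol.desc s ≫ ModuleCat.ofHom G = 𝟙 _ := by
      apply hcol.hom_ext
      intro j
      rw [← Category.assoc, hcol.fac]
      ext x
      change G (gj j x) = c.ι.app j x
      refine (liftX_of N b i hj _ j.unop.unop (extBridge _ Y i x)).trans ?_
      exact congrArg (c.ι.app j) (LinearEquiv.symm_apply_apply (extBridge _ Y i) x)
    intro y
    exact congrArg (fun f => f.hom y) this
  exact ⟨(LinearEquiv.ofLinearMap F G (LinearMap.ext hGF) (LinearMap.ext hFG) :
    c.pt ≃ₗ[R] HH N b i)⟩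

end bridge
end LCx
end part_L1b

section part_L2
open CategoryTheory


namespace LCx

open Abelian

section tors
variable {R : Type u} [CommRing R]

/-- torsion submodule -/
def tors (b : Ideal R) (N : Type*) [AddCommGroup N] [Module R N] : Submodule R N where
  carrier := {n | ∃ t, ∀ r ∈ b ^ t, r • n = 0}
  add_mem' := by
    rintro x y ⟨s, hs⟩ ⟨t, ht⟩
    refine ⟨max s t, fun r hr => ?_⟩
    rw [smul_add, hs r (Ideal.pow_le_pow_right (le_max_left _ _) hr),
      ht r (Ideal.pow_le_pow_right (le_max_right _ _) hr), add_zero]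
  zero_mem' := ⟨0, fun r _ => smul_zero r⟩
  smul_mem' := by
    rintro c x ⟨s, hs⟩
    exact ⟨s, fun r hr => by rw [smul_comm, hs r hr, smul_zero]⟩

lemma mem_tors {b : Ideal R} {N : Type*} [AddCommGroup N] [Module R N] {n : N} :
    n ∈ tors b N ↔ ∃ t, ∀ r ∈ b ^ t, r • n = 0 := Iff.rfl

lemma tors_mono {b c : Ideal R} (h : b ≤ c) {N : Type*} [AddCommGroup N] [Module R N] {n : N}
    (hn : n ∈ tors c N) : n ∈ tors b N := by
  obtain ⟨t, ht⟩ := hn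
  exact ⟨t, fun r hr => ht r (Ideal.pow_right_mono h t hr)⟩

lemma tors_map {b : Ideal R} {N N' : Type*} [AddCommGroup N] [Module R N] [AddCommGroup N']
    [Module R N'] (f : N →ₗ[R] N') {n : N} (hn : n ∈ tors b N) : f n ∈ tors b N' := by
  obtain ⟨t, ht⟩ := hn
  exact ⟨t, fun r hr => by rw [← map_smul, ht r hr, map_zero]⟩

/-- torsion of a Baer module is Baer -/
lemma baer_tors [IsNoetherianRing R] (b : Ideal R) {N : Type*} [AddCommGroup N] [Module R N]
    (hN : Module.Baer R N) : Module.Baer R (tors b N) := by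
  intro I g
  -- b^t g = 0
  obtain ⟨t, ht⟩ : ∃ t, ∀ r ∈ b ^ t, ∀ x : I, r • g x = 0 := by
    obtain ⟨s, hs⟩ := (inferInstance : Module.Finite R I).1
    have hx : ∀ x : I, ∃ t, ∀ r ∈ b ^ t, r • g x = 0 := by
      intro x
      obtain ⟨t, ht⟩ := (g x).2
      exact ⟨t, fun r hr => Subtype.ext (ht r hr)⟩
    choose T hT using hx
    refine ⟨s.sup T, fun r hr x => ?_⟩
    have hx : x ∈ Submodule.span R (s : Set I) := by rw [hs]; trivial
    induction hx using Submodule.span_induction with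
    | mem x hx => exact hT x r (Ideal.pow_le_pow_right (Finset.le_sup hx) hr)
    | zero => simp
    | add x y _ _ hx hy => rw [map_add, smul_add, hx, hy, add_zero]
    | smul c x _ hx => rw [map_smul, smul_comm, hx, smul_zero]
  obtain ⟨k, hk⟩ := Ideal.exists_pow_inf_eq_pow_smul b I
  have hI : ∀ z ∈ b ^ (t + k) ⊓ I, ∀ hz : z ∈ I, g ⟨z, hz⟩ = 0 := by
    intro z hz hzI
    have h1 := hk (t + k) (Nat.le_add_left _ _)
    simp only [smul_eq_mul, Ideal.mul_top, Nat.add_sub_cancel] at h1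
    have hz' : z ∈ b ^ t * I := by
      have : z ∈ b ^ t * (b ^ k ⊓ I) := h1 ▸ hz
      exact Ideal.mul_mono_right inf_le_right this
    suffices ∀ z ∈ b ^ t * I, ∃ hz : z ∈ I, g ⟨z, hz⟩ = 0 by
      obtain ⟨_, h⟩ := this z hz'; exact h
    intro z hz
    induction hz using Submodule.mul_induction_on' with
    | mem_mul_mem m hm n hn =>
      refine ⟨I.mul_mem_left m hn, ?_⟩
      have := ht m hm ⟨n, hn⟩
      rw [← map_smul] at this
      exact this
    | add x _ y _ hx hy =>
      obtain ⟨hx, hx'⟩ := hx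
      obtain ⟨hy, hy'⟩ := hy
      refine ⟨I.add_mem hx hy, ?_⟩
      have := map_add g ⟨x, hx⟩ ⟨y, hy⟩
      rw [hx', hy', add_zero] at this
      exact this
  -- the map I → R/b^(t+k)
  let q : I →ₗ[R] R ⧸ b ^ (t + k) := (Submodule.mkQ (b ^ (t + k))) ∘ₗ I.subtype
  have hker : LinearMap.ker q ≤ LinearMap.ker ((tors b N).subtype ∘ₗ g) := by
    rintro ⟨z, hz⟩ hq
    have h1 : z ∈ b ^ (t + k) := Ideal.Quotient.eq_zero_iff_mem.mp hq
    have := hI z ⟨h1, hz⟩ hz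
    rw [LinearMap.mem_ker, LinearMap.comp_apply, this, map_zero]
  obtain ⟨φ, hφ⟩ := hN.extension_property (Submodule.liftQ (LinearMap.ker q) q le_rfl)
    (LinearMap.ker_eq_bot.mp (Submodule.ker_liftQ_eq_bot _ _ _ le_rfl))
    (Submodule.liftQ (LinearMap.ker q) ((tors b N).subtype ∘ₗ g) hker)
  have hmem : ∀ r : R, φ (Submodule.mkQ (b ^ (t + k)) r) ∈ tors b N := by
    intro r
    refine ⟨t + k, fun s hs => ?_⟩
    rw [← map_smul, ← map_smul]
    have : Submodule.mkQ (b ^ (t + k)) (s • r) = 0 :=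
      Ideal.Quotient.eq_zero_iff_mem.mpr (Ideal.mul_mem_right _ _ hs)
    rw [this, map_zero]
  refine ⟨LinearMap.codRestrict _ (φ ∘ₗ Submodule.mkQ (b ^ (t + k))) hmem, fun x hx => ?_⟩
  apply Subtype.ext
  have := DFunLike.congr_fun hφ (Submodule.Quotient.mk ⟨x, hx⟩)
  exact this

end tors

section coc
variable {R : Type u} [CommRing R]
variable (N : Type u) [AddCommGroup N] [Module R N]

/-- injective resolution -/
noncomputable def IR : InjectiveResolution (ModuleCat.of R N) := injectiveResolution _

/-- terms -/
noncomputable abbrev JJ (i : ℕ) : ModuleCat.{u} R := (IR (R := R) N).cocomplex.X i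

/-- differential -/
noncomputable def dJ (i : ℕ) : JJ (R := R) N i →ₗ[R] JJ (R := R) N (i + 1) :=
  ((IR (R := R) N).cocomplex.d i (i + 1)).hom

lemma baer_JJ (i : ℕ) : Module.Baer R (JJ (R := R) N i) := by
  have : CategoryTheory.Injective (ModuleCat.of R (JJ (R := R) N i)) := (IR (R := R) N).injective i
  exact Module.Baer.of_injective (Module.injective_module_of_injective_object R (JJ (R := R) N i))

lemma dJ_dJ (i : ℕ) (c) : dJ (R := R) N (i + 1) (dJ N i c) = 0 := by
  have := (IR (R := R) N).complex_d_comp i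
  exact congrArg (fun f => f.hom c) this

lemma dJ_exact (i : ℕ) (c : JJ (R := R) N (i + 1)) (hc : dJ (R := R) N (i + 1) c = 0) :
    ∃ e, dJ N i e = c := by
  have := (IR (R := R) N).exact_succ i
  rw [ShortComplex.moduleCat_exact_iff] at this
  exact this c hc

/-- the morphism attached to a torsion element -/
noncomputable def mor {I : Ideal R} {i : ℕ} (c : JJ (R := R) N i) (h : ∀ r ∈ I, r • c = 0) :
    ModuleCat.of R (R ⧸ I) ⟶ JJ (R := R) N i :=
  ModuleCat.ofHom (Submodule.liftQ I (LinearMap.toSpanSingleton R _ c) (fun r hr => by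
    rw [LinearMap.mem_ker, LinearMap.toSpanSingleton_apply]; exact h r hr))

lemma mor_mk {I : Ideal R} {i : ℕ} (c : JJ (R := R) N i) (h : ∀ r ∈ I, r • c = 0) (r : R) :
    (mor N c h).hom (Submodule.Quotient.mk r) = r • c := rfl

lemma hom_ext_one {I : Ideal R} {Y : ModuleCat.{u} R} (f g : ModuleCat.of R (R ⧸ I) ⟶ Y)
    (h : f.hom (Submodule.Quotient.mk (1 : R)) = g.hom (Submodule.Quotient.mk (1 : R))) :
    f = g := by
  apply ModuleCat.hom_ext
  apply Submodule.linearMap_qext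
  apply LinearMap.ext_ring
  exact h

lemma eq_mor {I : Ideal R} {i : ℕ} (f : ModuleCat.of R (R ⧸ I) ⟶ JJ (R := R) N i) :
    ∃ h, f = mor N (f.hom (Submodule.Quotient.mk (1 : R))) h := by
  refine ⟨?_, ?_⟩
  · intro r hr
    rw [← map_smul, ← Submodule.Quotient.mk_smul]
    have : (Submodule.Quotient.mk (r • (1 : R)) : R ⧸ I) = 0 := by
      rw [Submodule.Quotient.mk_eq_zero, smul_eq_mul, mul_one]; exact hr
    rw [this, map_zero]
  · apply hom_ext_one
    rw [mor_mk, one_smul]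

lemma mor_d {I : Ideal R} {i : ℕ} (c : JJ (R := R) N i) (h : ∀ r ∈ I, r • c = 0)
    (hd : dJ N i c = 0) : mor N c h ≫ (IR (R := R) N).cocomplex.d i (i + 1) = 0 := by
  apply hom_ext_one
  change dJ N i ((1 : R) • c) = 0
  rw [one_smul, hd]

/-- class at level I -/
noncomputable def clX {I : Ideal R} {i : ℕ} (c : JJ (R := R) N i) (h : ∀ r ∈ I, r • c = 0)
    (hd : dJ N i c = 0) : XX N I i :=
  (IR (R := R) N).extMk (mor N c h) (i + 1) rfl (mor_d N c h hd)

lemma clX_add {I : Ideal R} {i : ℕ} (c : JJ (R := R) N i) (h hd) (c' : JJ (R := R) N i) (h' hd')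
    (h'' hd'') :
    clX N (I := I) (c + c') h'' hd'' = clX N c h hd + clX N c' h' hd' := by
  simp only [clX]
  rw [InjectiveResolution.add_extMk]
  congr 1
  apply hom_ext_one
  change (1 : R) • (c + c') = (1 : R) • c + (1 : R) • c'
  rw [smul_add]

lemma clX_smul {I : Ideal R} {i : ℕ} (c : JJ (R := R) N i) (h hd) (r : R) (h'' hd'') :
    clX N (I := I) (r • c) h'' hd'' = r • clX N c h hd := by
  have : r • clX N c h hd = (Ext.mk₀ (r • 𝟙 (ModuleCat.of R (R ⧸ I)))).comp (clX N c h hd)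
      (zero_add i) := by
    rw [Ext.mk₀_smul, Ext.smul_comp, Ext.mk₀_id_comp]
  rw [this]
  simp only [clX]
  rw [InjectiveResolution.mk₀_comp_extMk]
  congr 1
  apply hom_ext_one
  change (1 : R) • (r • c) = (r • (1 : R)) • c
  simp

lemma clX_pre {I I' : Ideal R} (hI : I ≤ I') {i : ℕ} (c : JJ (R := R) N i) (h hd) :
    pre N hI i (clX N c h hd) = clX N c (fun r hr => h r (hI hr)) hd := by
  rw [pre_apply]
  simp only [clX]
  rw [InjectiveResolution.mk₀_comp_extMk]
  congr 1
  apply hom_ext_one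
  rfl

lemma clX_surj {I : Ideal R} {i : ℕ} (α : XX N I i) :
    ∃ c h hd, clX N (I := I) c h hd = α := by
  obtain ⟨f, hf, rfl⟩ := (IR (R := R) N).extMk_surjective α (i + 1) rfl
  obtain ⟨h, he⟩ := eq_mor N f
  refine ⟨_, h, ?_, ?_⟩
  · have := congrArg (fun f => f.hom (Submodule.Quotient.mk (1 : R))) hf
    exact this
  · simp only [clX]
    congr 1
    exact he.symm

lemma clX_eq_zero_succ {I : Ideal R} {i : ℕ} (c : JJ (R := R) N (i + 1)) (h hd) :
    clX N (I := I) c h hd = 0 ↔ ∃ e : JJ (R := R) N i, (∀ r ∈ I, r • e = 0) ∧ dJ N i e = c := by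
  simp only [clX]
  rw [(IR (R := R) N).extMk_eq_zero_iff _ _ _ _ i rfl]
  constructor
  · rintro ⟨g, hg⟩
    obtain ⟨h', he⟩ := eq_mor N g
    refine ⟨_, h', ?_⟩
    have := congrArg (fun f => f.hom (Submodule.Quotient.mk (1 : R))) hg
    refine Eq.trans this ?_
    exact one_smul R c
  · rintro ⟨e, he, rfl⟩
    refine ⟨mor N e he, ?_⟩
    apply hom_ext_one
    change dJ N i ((1 : R) • e) = (1 : R) • dJ N i e
    simp

lemma clX_eq_zero_zero {I : Ideal R} (c : JJ (R := R) N 0) (h hd)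
    (h0 : clX N (I := I) c h hd = 0) : c = 0 := by
  have := inj_extMk_zero (IR (R := R) N) _ (mor_d N c h hd) h0
  have := congrArg (fun f => f.hom (Submodule.Quotient.mk (1 : R))) this
  refine Eq.trans ?_ this
  exact (one_smul R c).symm

open Classical in
/-- the class in local cohomology -/
noncomputable def cl (b : Ideal R) (i : ℕ) (c : JJ (R := R) N i) : HH N b i :=
  if h : dJ N i c = 0 ∧ c ∈ tors b (JJ (R := R) N i) then
    ofX N b i h.2.choose (clX N c h.2.choose_spec h.1) else 0

lemma cl_eq {b : Ideal R} {i : ℕ} {c : JJ (R := R) N i} (hd : dJ N i c = 0) {t : ℕ}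
    (h : ∀ r ∈ b ^ t, r • c = 0) : cl N b i c = ofX N b i t (clX N c h hd) := by
  have h' : dJ N i c = 0 ∧ c ∈ tors b (JJ (R := R) N i) := ⟨hd, t, h⟩
  rw [cl, dif_pos h']
  rw [← ofX_pre N b i (le_max_left h'.2.choose t), ← ofX_pre N b i (le_max_right h'.2.choose t),
    clX_pre, clX_pre]

lemma cl_add {b : Ideal R} {i : ℕ} {c c' : JJ (R := R) N i} (hd : dJ N i c = 0)
    (hd' : dJ N i c' = 0) (h : c ∈ tors b (JJ (R := R) N i)) (h' : c' ∈ tors b (JJ (R := R) N i)) :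
    cl N b i (c + c') = cl N b i c + cl N b i c' := by
  obtain ⟨s, hs⟩ := h
  obtain ⟨t, ht⟩ := h'
  have hs' : ∀ r ∈ b ^ (max s t), r • c = 0 :=
    fun r hr => hs r (Ideal.pow_le_pow_right (le_max_left _ _) hr)
  have ht' : ∀ r ∈ b ^ (max s t), r • c' = 0 :=
    fun r hr => ht r (Ideal.pow_le_pow_right (le_max_right _ _) hr)
  rw [cl_eq N hd hs', cl_eq N hd' ht', cl_eq N (t := max s t) (by rw [map_add, hd, hd', add_zero])
    (fun r hr => by rw [smul_add, hs' r hr, ht' r hr, add_zero]), clX_add N c hs' hd c' ht' hd',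
    map_add]

lemma cl_smul {b : Ideal R} {i : ℕ} {c : JJ (R := R) N i} (hd : dJ N i c = 0)
    (h : c ∈ tors b (JJ (R := R) N i)) (r : R) :
    cl N b i (r • c) = r • cl N b i c := by
  obtain ⟨s, hs⟩ := h
  rw [cl_eq N hd hs, cl_eq N (t := s) (by rw [map_smul, hd, smul_zero])
    (fun r' hr => by rw [smul_comm, hs r' hr, smul_zero]), clX_smul N c hs hd, map_smul]

lemma cl_sub {b : Ideal R} {i : ℕ} {c c' : JJ (R := R) N i} (hd : dJ N i c = 0)
    (hd' : dJ N i c' = 0) (h : c ∈ tors b (JJ (R := R) N i)) (h' : c' ∈ tors b (JJ (R := R) N i)) :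
    cl N b i (c - c') = cl N b i c - cl N b i c' := by
  have : c - c' = c + (-1 : R) • c' := by simp [sub_eq_add_neg]
  rw [this, cl_add N hd (by rw [map_smul, hd', smul_zero]) h (Submodule.smul_mem _ _ h'),
    cl_smul N hd' h']
  simp [sub_eq_add_neg]

lemma cl_surj (b : Ideal R) (i : ℕ) (h : HH N b i) : ∃ c : JJ (R := R) N i,
    dJ N i c = 0 ∧ c ∈ tors b (JJ (R := R) N i) ∧ cl N b i c = h := by
  obtain ⟨t, α, rfl⟩ := exists_ofX N b i h
  obtain ⟨c, h, hd, rfl⟩ := clX_surj N α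
  exact ⟨c, hd, ⟨t, h⟩, cl_eq N hd h⟩

lemma cl_eq_zero_succ {b : Ideal R} {i : ℕ} {c : JJ (R := R) N (i + 1)}
    (hd : dJ N (i + 1) c = 0) (h : c ∈ tors b (JJ (R := R) N (i + 1))) :
    cl N b (i + 1) c = 0 ↔ ∃ e ∈ tors b (JJ (R := R) N i), dJ N i e = c := by
  obtain ⟨t, ht⟩ := h
  rw [cl_eq N hd ht]
  constructor
  · intro h0
    obtain ⟨t', h', h0⟩ := ofX_eq_zero N h0
    rw [clX_pre, clX_eq_zero_succ] at h0
    obtain ⟨e, he, hde⟩ := h0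
    exact ⟨e, ⟨t', he⟩, hde⟩
  · rintro ⟨e, ⟨s, hs⟩, rfl⟩
    rw [← ofX_pre N b _ (le_max_left t s), clX_pre]
    have : clX N (dJ N i e) (fun r hr => ht r (Ideal.pow_le_pow_right (le_max_left t s) hr))
      hd = 0 := by
      rw [clX_eq_zero_succ]
      exact ⟨e, fun r hr => hs r (Ideal.pow_le_pow_right (le_max_right t s) hr), rfl⟩
    rw [this, map_zero]

lemma cl_eq_zero_zero {b : Ideal R} {c : JJ (R := R) N 0}
    (hd : dJ N 0 c = 0) (h : c ∈ tors b (JJ (R := R) N 0)) (h0 : cl N b 0 c = 0) : c = 0 := by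
  obtain ⟨t, ht⟩ := h
  rw [cl_eq N hd ht] at h0
  obtain ⟨t', h', h0⟩ := ofX_eq_zero N h0
  rw [clX_pre] at h0
  exact clX_eq_zero_zero N _ _ _ h0

lemma cl_zero (b : Ideal R) (i : ℕ) : cl N b i 0 = 0 := by
  have := cl_smul N (b := b) (i := i) (c := 0) (map_zero _) (Submodule.zero_mem _) 0
  rwa [zero_smul, zero_smul] at this

lemma cl_cmp {b b' : Ideal R} (hb : b ≤ b') {i : ℕ} {c : JJ (R := R) N i} (hd : dJ N i c = 0)
    (h : c ∈ tors b' (JJ (R := R) N i)) : hcmp N hb i (cl N b' i c) = cl N b i c := by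
  obtain ⟨t, ht⟩ := h
  rw [cl_eq N hd ht, hcmp_of, clX_pre, cl_eq]

end coc

section vanish
variable {R : Type u} [CommRing R]
variable {N N' N'' : Type u} [AddCommGroup N] [Module R N] [AddCommGroup N'] [Module R N']
  [AddCommGroup N''] [Module R N'']

lemma XX0_surj (I : Ideal R) (α : XX N I 0) :
    ∃ f : ModuleCat.of R (R ⧸ I) ⟶ ModuleCat.of R N, Ext.mk₀ f = α := by
  obtain ⟨f, hf⟩ := (Ext.homEquiv₀ (X := ModuleCat.of R (R ⧸ I)) (Y := ModuleCat.of R N)).symm.surjective α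
  exact ⟨f, hf⟩

lemma mk0_inj {X Y : ModuleCat.{u} R} {f : X ⟶ Y} (h : Ext.mk₀ f = 0) : f = 0 := by
  have := (Ext.homEquiv₀ (X := X) (Y := Y)).symm.injective
  apply this
  exact h.trans (Ext.mk₀_zero _ _).symm

lemma hmap_zero_inj {f : N →ₗ[R] N'} (hf : Function.Injective f) (b : Ideal R) :
    Function.Injective (hmap b 0 f) := by
  rw [injective_iff_map_eq_zero]
  intro h h0
  obtain ⟨t, α, rfl⟩ := exists_ofX N b 0 h
  rw [hmap_of] at h0
  obtain ⟨t', ht, h0⟩ := ofX_eq_zero N' h0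
  rw [← post_pre] at h0
  rw [← ofX_pre N b 0 ht]
  obtain ⟨g, hg⟩ := XX0_surj _ (pre N (Ideal.pow_le_pow_right ht) 0 α)
  rw [← hg] at h0 ⊢
  rw [post_apply, Ext.mk₀_comp_mk₀] at h0
  have h1 := mk0_inj h0
  have : Mono (ModuleCat.ofHom f) := (ModuleCat.mono_iff_injective _).mpr hf
  have h2 : g = 0 := by
    rw [← cancel_mono (ModuleCat.ofHom f), h1, Limits.zero_comp]
  rw [h2, Ext.mk₀_zero, map_zero]

lemma hmap_zero_surj {f : N →ₗ[R] N'} (hf : Function.Surjective f) (b : Ideal R)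
    (hN : ∀ n : N, n ∈ tors b N) : Function.Surjective (hmap b 0 f) := by
  intro h
  obtain ⟨t, α, rfl⟩ := exists_ofX N' b 0 h
  obtain ⟨g, rfl⟩ := XX0_surj _ α
  obtain ⟨n, hn⟩ := hf (g.hom (Submodule.Quotient.mk (1 : R)))
  obtain ⟨s, hs⟩ := hN n
  have hs' : ∀ r ∈ b ^ (max t s), r • n = 0 :=
    fun r hr => hs r (Ideal.pow_le_pow_right (le_max_right _ _) hr)
  let k : ModuleCat.of R (R ⧸ b ^ (max t s)) ⟶ ModuleCat.of R N :=
    ModuleCat.ofHom (Submodule.liftQ _ (LinearMap.toSpanSingleton R _ n) (fun r hr => by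
    rw [LinearMap.mem_ker, LinearMap.toSpanSingleton_apply]; exact hs' r hr))
  refine ⟨ofX N b 0 (max t s) (Ext.mk₀ k), ?_⟩
  rw [hmap_of, ← ofX_pre N' b 0 (le_max_left t s), post_apply, pre_apply, Ext.mk₀_comp_mk₀,
    Ext.mk₀_comp_mk₀]
  congr 2
  apply hom_ext_one
  change f ((1 : R) • n) = g.hom (Submodule.Quotient.mk (1 : R))
  rw [one_smul, hn]

lemma HH_baer (hN : Module.Baer R N) (b : Ideal R) (i : ℕ) (h : HH N b (i + 1)) : h = 0 := by
  obtain ⟨t, α, rfl⟩ := exists_ofX N b _ h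
  have : Module.Injective R N := hN.injective
  have : CategoryTheory.Injective (ModuleCat.of R N) := Module.injective_object_of_injective_module R N
  rw [Ext.eq_zero_of_injective α, map_zero]

lemma HH_tors [IsNoetherianRing R] (b : Ideal R) (i : ℕ) : ∀ (N : Type u) [AddCommGroup N]
    [Module R N], (∀ n : N, n ∈ tors b N) → ∀ h : HH N b (i + 1), h = 0 := by
  have key : ∀ (N : Type u) [AddCommGroup N] [Module R N], (∀ n : N, n ∈ tors b N) →
      ∃ (E : Type u) (_ : AddCommGroup E) (_ : Module R E) (f : N →ₗ[R] E),
        Function.Injective f ∧ Module.Baer R E ∧ ∀ n : E, n ∈ tors b E := by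
    intro N _ _ hN
    let Q : ModuleCat.{u} R := CategoryTheory.Injective.under (ModuleCat.of R N)
    let f : N →ₗ[R] Q := (CategoryTheory.Injective.ι (ModuleCat.of R N)).hom
    have hf : Function.Injective f := (ModuleCat.mono_iff_injective (CategoryTheory.Injective.ι (ModuleCat.of R N))).mp inferInstance
    have hB : Module.Baer R Q := by
      have : CategoryTheory.Injective (ModuleCat.of R Q) :=
        inferInstanceAs (CategoryTheory.Injective (CategoryTheory.Injective.under (ModuleCat.of R N)))
      exact Module.Baer.of_injective (Module.injective_module_of_injective_object R _)
    refine ⟨tors b Q, inferInstance, inferInstance,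
      LinearMap.codRestrict _ f (fun n => tors_map f (hN n)), ?_, baer_tors b hB, ?_⟩
    · intro x y hxy
      exact hf (congrArg Subtype.val hxy)
    · rintro ⟨n, t, ht⟩
      exact ⟨t, fun r hr => Subtype.ext (ht r hr)⟩
  induction i with
  | zero =>
    intro N _ _ hN h
    obtain ⟨E, _, _, f, hf, hE, hE'⟩ := key N hN
    obtain ⟨δ, h1, h2⟩ := exists_delta hf (Submodule.mkQ_surjective (LinearMap.range f))
      (LinearMap.exact_map_mkQ_range f) b 0
    obtain ⟨y, rfl⟩ := (h2 h).mp (HH_baer hE b 0 _)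
    obtain ⟨z, rfl⟩ := hmap_zero_surj (Submodule.mkQ_surjective (LinearMap.range f)) b hE' y
    exact h1.apply_apply_eq_zero z
  | succ i ih =>
    intro N _ _ hN h
    obtain ⟨E, _, _, f, hf, hE, hE'⟩ := key N hN
    obtain ⟨δ, h1, h2⟩ := exists_delta hf (Submodule.mkQ_surjective (LinearMap.range f))
      (LinearMap.exact_map_mkQ_range f) b (i + 1)
    obtain ⟨y, rfl⟩ := (h2 h).mp (HH_baer hE b _ _)
    rw [ih _ (fun n => by
      obtain ⟨e, rfl⟩ := Submodule.mkQ_surjective _ n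
      exact tors_map _ (hE' e)) y, map_zero]

end vanish
end LCx
end part_L2

section part_L3
open CategoryTheory Pointwise


namespace LCx

section gro
variable {R : Type u} [CommRing R]
variable {N N' N'' : Type u} [AddCommGroup N] [Module R N] [AddCommGroup N'] [Module R N']
  [AddCommGroup N''] [Module R N'']

lemma hmap_zero' (b : Ideal R) (i : ℕ) (h : HH N b i) :
    hmap b i (0 : N →ₗ[R] N') h = 0 := by
  have : (0 : N →ₗ[R] N') = 0 ∘ₗ ((0 : R) • LinearMap.id : N →ₗ[R] N) := by simp
  rw [this, ← hmap_hmap, hmap_smul_id, zero_smul, map_zero]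

lemma HH_subsingleton [Subsingleton N] (b : Ideal R) (i : ℕ) (h : HH N b i) : h = 0 := by
  rw [← hmap_id N b i h, Subsingleton.elim (LinearMap.id : N →ₗ[R] N) 0, hmap_zero']

lemma HH_smul_zero {r : R} (hr : ∀ n : N, r • n = 0) (b : Ideal R) (i : ℕ) (h : HH N b i) :
    r • h = 0 := by
  rw [← hmap_smul_id N b i r h]
  have : (r • LinearMap.id : N →ₗ[R] N) = 0 := by ext n; simp [hr]
  rw [this, hmap_zero']

lemma HH_pow_torsion (b : Ideal R) (i : ℕ) {y : R} (hy : y ∈ b) (h : HH N b i) :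
    ∃ t, y ^ t • h = 0 := by
  obtain ⟨t, ht⟩ := HH_torsion N b i h
  exact ⟨t, ht _ (Ideal.pow_mem_pow hy t)⟩

lemma eq_zero_of_pow_torsion {A : Type*} [AddCommGroup A] [Module R A] {y : R}
    (hinj : ∀ a : A, y • a = 0 → a = 0) (t : ℕ) (a : A) (h : y ^ t • a = 0) : a = 0 := by
  induction t with
  | zero => simpa using h
  | succ t ih =>
    apply ih
    apply hinj
    rw [← mul_smul, ← pow_succ']
    exact h

/-- finitely generated ideal: torsion of torsion -/
lemma tors_of_smul [IsNoetherianRing R] {A : Type*} [AddCommGroup A] [Module R A] (m : Ideal R)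
    (I : Ideal R) (t : ℕ) (hI : m ^ t ≤ I) (a : A) (h : ∀ r ∈ I, r • a ∈ tors m A) :
    a ∈ tors m A := by
  obtain ⟨s, hs⟩ := (IsNoetherian.noetherian I : I.FG)
  have : ∀ r : R, ∃ k, r ∈ I → ∀ r' ∈ m ^ k, r' • r • a = 0 := by
    intro r
    by_cases hr : r ∈ I
    · obtain ⟨k, hk⟩ := h r hr
      exact ⟨k, fun _ => hk⟩
    · exact ⟨0, fun h => absurd h hr⟩
  choose K hK using this
  have key : ∀ r' ∈ m ^ (s.sup K), ∀ r ∈ I, r' • r • a = 0 := by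
    intro r' hr' r hr
    rw [← hs] at hr
    induction hr using Submodule.span_induction with
    | mem x hx =>
      exact hK x (hs ▸ Ideal.subset_span hx) r' (Ideal.pow_le_pow_right (Finset.le_sup hx) hr')
    | zero => simp
    | add x y _ _ hx hy => rw [add_smul, smul_add, hx, hy, add_zero]
    | smul c x _ hx => rw [smul_eq_mul, mul_smul, smul_comm, hx, smul_zero]
  refine ⟨s.sup K + t, fun r hr => ?_⟩
  rw [pow_add] at hr
  induction hr using Submodule.mul_induction_on' with
  | mem_mul_mem x hx y hy => rw [mul_smul]; exact key x hx y (hI hy)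
  | add x _ y _ hx hy => rw [add_smul, hx, hy, add_zero]

/-- the long exact sequence of multiplication by y -/
lemma exists_delta_y {y : R} (hy : IsSMulRegular N y) (b : Ideal R) (i : ℕ) :
    ∃ δ : HH (QuotSMulTop y N) b i →ₗ[R] HH N b (i + 1),
      (∀ h, y • h = 0 → ∃ z, δ z = h) ∧ (∀ z, y • δ z = 0) ∧
      Function.Exact (hmap b i (Submodule.mkQ (y • (⊤ : Submodule R N)))) δ := by
  have hf : Function.Injective (y • LinearMap.id : N →ₗ[R] N) := by
    intro a c h; exact hy h
  have hex : Function.Exact (y • LinearMap.id : N →ₗ[R] N)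
      (Submodule.mkQ (y • (⊤ : Submodule R N))) := by
    intro n
    rw [Submodule.mkQ_apply, Submodule.Quotient.mk_eq_zero, Submodule.mem_smul_pointwise_iff_exists]
    simp
  obtain ⟨δ, h1, h2⟩ := exists_delta hf (Submodule.mkQ_surjective _) hex b i
  refine ⟨δ, ?_, ?_, h1⟩
  · intro h hh
    rw [← hmap_smul_id N b (i + 1)] at hh
    exact (h2 h).mp hh
  · intro z
    rw [← hmap_smul_id N b (i + 1)]
    exact (h2 _).mpr ⟨z, rfl⟩

lemma smul_regular_of_equiv {p : Ideal R} [p.IsPrime] (e : N ≃ₗ[R] R ⧸ p) {y : R} (hy : y ∉ p) :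
    IsSMulRegular N y := by
  have h : IsSMulRegular (R ⧸ p) y := by
    rw [isSMulRegular_iff_right_eq_zero_of_smul]
    intro a ha
    obtain ⟨a, rfl⟩ := Ideal.Quotient.mk_surjective a
    have : Ideal.Quotient.mk p (y * a) = 0 := ha
    rw [Ideal.Quotient.eq_zero_iff_mem] at this ⊢
    exact ((‹p.IsPrime›).mem_or_mem this).resolve_left hy
  intro a c hac
  apply e.injective
  apply h
  change y • e a = y • e c
  rw [← map_smul, ← map_smul]
  exact congrArg e hac

lemma smul_zero_of_equiv {p : Ideal R} (e : N ≃ₗ[R] R ⧸ p) {y : R} (hy : y ∈ p) (n : N) :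
    y • n = 0 := by
  apply e.injective
  rw [map_smul, map_zero]
  obtain ⟨a, ha⟩ := Ideal.Quotient.mk_surjective (e n)
  rw [← ha]
  change Ideal.Quotient.mk p (y * a) = 0
  rw [Ideal.Quotient.eq_zero_iff_mem]
  exact Ideal.mul_mem_right _ _ hy

lemma dim_quot_lt [Module.Finite R N] {y : R} (hy : IsSMulRegular N y) {d : ℕ}
    (h : Module.supportDim R N ≤ ((d + 1 : ℕ) : WithBot ℕ∞)) :
    Module.supportDim R (QuotSMulTop y N) ≤ (d : WithBot ℕ∞) := by
  have h1 := Module.supportDim_quotSMulTop_succ_le_of_notMem_minimalPrimes (M := N) (x := y)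
    (fun _ => hy.notMem_of_mem_minimalPrimes)
  have h2 := h1.trans h
  generalize Module.supportDim R (QuotSMulTop y N) = a at h2
  induction a using WithBot.recBotCoe with
  | bot => simp
  | coe a =>
    have h2' : ((a + 1 : ℕ∞) : WithBot ℕ∞) ≤ ((d + 1 : ℕ∞) : WithBot ℕ∞) := by exact_mod_cast h2
    rw [WithBot.coe_le_coe] at h2'
    have : a ≤ (d : ℕ∞) := (ENat.add_le_add_iff_right (by simp)).mp h2'
    exact_mod_cast WithBot.coe_le_coe.mpr this

lemma subsingleton_quot_zero [Module.Finite R N] {y : R} (hy : IsSMulRegular N y)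
    (h : Module.supportDim R N ≤ ((0 : ℕ) : WithBot ℕ∞)) :
    Subsingleton (QuotSMulTop y N) := by
  have h1 := Module.supportDim_quotSMulTop_succ_le_of_notMem_minimalPrimes (M := N) (x := y)
    (fun _ => hy.notMem_of_mem_minimalPrimes)
  have h2 := h1.trans h
  rw [← Module.supportDim_eq_bot_iff_subsingleton R]
  generalize Module.supportDim R (QuotSMulTop y N) = a at h2
  induction a using WithBot.recBotCoe with
  | bot => rfl
  | coe a =>
    have h2' : ((a + 1 : ℕ∞) : WithBot ℕ∞) ≤ ((0 : ℕ∞) : WithBot ℕ∞) := by exact_mod_cast h2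
    rw [WithBot.coe_le_coe] at h2'
    simp at h2'

open IsLocalRing in
theorem groth [IsNoetherianRing R] [IsLocalRing R] (b : Ideal R) (d : ℕ) :
    ∀ (N : Type u) [AddCommGroup N] [Module R N] [Module.Finite R N],
      Module.supportDim R N ≤ (d : WithBot ℕ∞) →
      (∀ i, d < i → ∀ h : HH N b i, h = 0) ∧
      ∀ h : HH N b d, h ∈ tors (maximalIdeal R) (HH N b d) := by
  induction d with
  | zero =>
    intro N _ _ hN
    induction ‹Module.Finite R N› using IsNoetherianRing.induction_on_isQuotientEquivQuotientPrime
      with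
    | subsingleton N =>
      intro _
      refine ⟨fun i _ h => HH_subsingleton b i h, fun h => ?_⟩
      rw [HH_subsingleton b _ h]
      exact Submodule.zero_mem _
    | exact N₁ N₂ N₃ f g hf hg hfg h₁ h₃ =>
      intro hd
      have h1 := h₁ ((Module.supportDim_le_of_injective f hf).trans hd)
      have h3 := h₃ ((Module.supportDim_le_of_surjective g hg).trans hd)
      refine ⟨fun i hi h => ?_, fun h => ?_⟩
      · obtain ⟨z, rfl⟩ := (hmap_exact hf hg hfg b i h).mp (h3.1 i hi _)
        rw [h1.1 i hi z, map_zero]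
      · obtain ⟨t, ht⟩ := h3.2 (hmap b _ g h)
        refine tors_of_smul _ (maximalIdeal R ^ t) t le_rfl h (fun r hr => ?_)
        obtain ⟨z, hz⟩ := (hmap_exact hf hg hfg b _ (r • h)).mp (by rw [map_smul, ht r hr])
        rw [← hz]
        exact tors_map _ (h1.2 z)
    | quotient N p e =>
      intro hd
      have := p.2
      by_cases hp : maximalIdeal R ≤ p.1
      · refine ⟨fun i hi h => ?_, fun h => ?_⟩
        · obtain ⟨i, rfl⟩ := Nat.exists_eq_succ_of_ne_zero (Nat.pos_iff_ne_zero.mp hi)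
          by_cases hb : b ≤ p.1
          · exact HH_tors b i N (fun n => ⟨1, fun r hr =>
              smul_zero_of_equiv e (hb (by simpa using hr)) n⟩) h
          · have hbt : b = ⊤ := by
              by_contra hne
              exact hb ((IsLocalRing.le_maximalIdeal hne).trans hp)
            obtain ⟨t, ht⟩ := HH_torsion N b _ h
            have := ht 1 (by rw [hbt, Ideal.top_pow]; trivial)
            simpa using this
        · refine ⟨1, fun r hr => HH_smul_zero (fun n => smul_zero_of_equiv e (hp ?_) n) b _ h⟩
          simpa using hr
      · obtain ⟨y, hym, hyp⟩ := Set.not_subset.mp hp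
        have hreg := smul_regular_of_equiv e hyp
        have hsub := subsingleton_quot_zero hreg hd
        have hNs : Subsingleton N := by
          rw [Submodule.Quotient.subsingleton_iff] at hsub
          have := Submodule.eq_bot_of_le_smul_of_le_jacobson_bot (maximalIdeal R)
            (⊤ : Submodule R N) (Module.Finite.fg_top) ?_
            (IsLocalRing.maximalIdeal_le_jacobson _)
          · exact (Submodule.subsingleton_iff R).mp (subsingleton_of_bot_eq_top this.symm)
          · intro n _
            have hn : n ∈ y • (⊤ : Submodule R N) := by rw [hsub]; trivial
            obtain ⟨k, hk, rfl⟩ := (Submodule.mem_smul_pointwise_iff_exists _ _ _).mp hn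
            exact Submodule.smul_mem_smul hym hk
        refine ⟨fun i _ h => HH_subsingleton b i h, fun h => ?_⟩
        rw [HH_subsingleton b _ h]
        exact Submodule.zero_mem _
  | succ d ih =>
    intro N _ _ hN
    induction ‹Module.Finite R N› using IsNoetherianRing.induction_on_isQuotientEquivQuotientPrime
      with
    | subsingleton N =>
      intro _
      refine ⟨fun i _ h => HH_subsingleton b i h, fun h => ?_⟩
      rw [HH_subsingleton b _ h]
      exact Submodule.zero_mem _
    | exact N₁ N₂ N₃ f g hf hg hfg h₁ h₃ =>
      intro hd
      have h1 := h₁ ((Module.supportDim_le_of_injective f hf).trans hd)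
      have h3 := h₃ ((Module.supportDim_le_of_surjective g hg).trans hd)
      refine ⟨fun i hi h => ?_, fun h => ?_⟩
      · obtain ⟨z, rfl⟩ := (hmap_exact hf hg hfg b i h).mp (h3.1 i hi _)
        rw [h1.1 i hi z, map_zero]
      · obtain ⟨t, ht⟩ := h3.2 (hmap b _ g h)
        refine tors_of_smul _ (maximalIdeal R ^ t) t le_rfl h (fun r hr => ?_)
        obtain ⟨z, hz⟩ := (hmap_exact hf hg hfg b _ (r • h)).mp (by rw [map_smul, ht r hr])
        rw [← hz]
        exact tors_map _ (h1.2 z)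
    | quotient N p e =>
      intro hd
      have := p.2
      by_cases hb : b ≤ p.1
      · have hz : ∀ i, ∀ h : HH N b (i + 1), h = 0 := fun i h =>
          HH_tors b i N (fun n => ⟨1, fun r hr =>
              smul_zero_of_equiv e (hb (by simpa using hr)) n⟩) h
        refine ⟨fun i hi h => ?_, fun h => ?_⟩
        · obtain ⟨i, rfl⟩ := Nat.exists_eq_succ_of_ne_zero (Nat.ne_zero_of_lt hi)
          exact hz i h
        · rw [hz d h]; exact Submodule.zero_mem _
      · obtain ⟨y, hyb, hyp⟩ := Set.not_subset.mp hb
        have hreg := smul_regular_of_equiv e hyp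
        have hdq := ih _ (dim_quot_lt hreg hd)
        refine ⟨fun i hi h => ?_, fun h => ?_⟩
        · obtain ⟨i, rfl⟩ := Nat.exists_eq_succ_of_ne_zero (Nat.ne_zero_of_lt hi)
          obtain ⟨δ, h1, _, _⟩ := exists_delta_y hreg b i
          obtain ⟨t, ht⟩ := HH_pow_torsion b _ hyb h
          refine eq_zero_of_pow_torsion (fun a ha => ?_) t h ht
          obtain ⟨z, rfl⟩ := h1 a ha
          rw [hdq.1 i (Nat.succ_lt_succ_iff.mp hi) z, map_zero]
        · obtain ⟨δ, h1, _, _⟩ := exists_delta_y hreg b d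
          obtain ⟨t, ht⟩ := HH_pow_torsion b _ hyb h
          induction t generalizing h with
          | zero =>
            have : h = 0 := by simpa using ht
            rw [this]; exact Submodule.zero_mem _
          | succ t iht =>
            obtain ⟨s, hs⟩ := iht (y • h) (by rw [← mul_smul, ← pow_succ]; exact ht)
            refine tors_of_smul _ (maximalIdeal R ^ s) s le_rfl h (fun r hr => ?_)
            obtain ⟨z, hz⟩ := h1 (r • h) (by rw [smul_comm, hs r hr])
            rw [← hz]
            exact tors_map _ (hdq.2 z)

end gro
end LCx
end part_L3

section part_L4
open CategoryTheory Pointwise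


namespace LCx

section zorn
variable {R : Type u} [CommRing R] {X : Type u} [AddCommGroup X] [Module R X]

/-- complements by Zorn -/
lemma exists_max_disj (A L0 : Submodule R X) (h : L0 ⊓ A = ⊥) :
    ∃ L, L0 ≤ L ∧ L ⊓ A = ⊥ ∧ ∀ L', L ≤ L' → L' ⊓ A = ⊥ → L' = L := by
  have key : ∀ c ⊆ {L : Submodule R X | L ⊓ A = ⊥}, IsChain (· ≤ ·) c → ∀ y ∈ c,
      ∃ ub ∈ {L : Submodule R X | L ⊓ A = ⊥}, ∀ z ∈ c, z ≤ ub := by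
    intro c hc hchain y hy
    refine ⟨sSup c, ?_, fun z hz => le_sSup hz⟩
    rw [Set.mem_ofPred_eq, eq_bot_iff]
    rintro v ⟨hv1, hv2⟩
    obtain ⟨z, hz, hvz⟩ := (Submodule.mem_sSup_of_directed ⟨y, hy⟩ hchain.directedOn).mp hv1
    have := hc hz
    rw [Set.mem_ofPred_eq] at this
    rw [← this]
    exact ⟨hvz, hv2⟩
  obtain ⟨m, hm, hmax⟩ := zorn_le_nonempty₀ {L : Submodule R X | L ⊓ A = ⊥} key L0 h
  exact ⟨m, hm, hmax.prop, fun L' h1 h2 => le_antisymm (hmax.2 h2 h1) h1⟩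

/-- a maximal complement in an injective module is a retract -/
lemma exists_retract (hX : Module.Baer R X) (A K : Submodule R X) (hKA : K ⊓ A = ⊥)
    (hK : ∀ L', K ≤ L' → L' ⊓ A = ⊥ → L' = K) : ∃ p : X →ₗ[R] X,
      (∀ v, p v ∈ K) ∧ ∀ v ∈ K, p v = v := by
  obtain ⟨L, -, hLK, hL⟩ := exists_max_disj K ⊥ (by simp)
  -- the map K → X / L is injective
  let f : K →ₗ[R] X ⧸ L := L.mkQ ∘ₗ K.subtype
  have hf : Function.Injective f := by
    rw [← LinearMap.ker_eq_bot, LinearMap.ker_eq_bot']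
    intro v hv
    have : (v : X) ∈ L := by simpa [f] using hv
    have h2 : (v : X) ∈ L ⊓ K := ⟨this, v.2⟩
    rw [hLK] at h2
    exact Subtype.ext (by simpa using h2)
  obtain ⟨g, hg⟩ := Module.Baer.extension_property hX f hf K.subtype
  have hgK : ∀ v ∈ K, g (L.mkQ v) = v := fun v hv => LinearMap.congr_fun hg ⟨v, hv⟩
  have hker : ∀ v, g (L.mkQ v) = 0 → v ∈ L := by
    intro v hv
    by_contra hvL
    have : (L ⊔ Submodule.span R {v}) ⊓ K = ⊥ := by
      rw [eq_bot_iff]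
      rintro w ⟨hw1, hw2⟩
      obtain ⟨l, hl, z, hz, rfl⟩ := Submodule.mem_sup.mp hw1
      obtain ⟨r, rfl⟩ := Submodule.mem_span_singleton.mp hz
      have h1 := hgK _ hw2
      have hl0 : L.mkQ l = 0 := (Submodule.Quotient.mk_eq_zero L).mpr hl
      rw [map_add, map_smul, map_add, map_smul, hv, hl0, map_zero, smul_zero, add_zero] at h1
      rw [← h1]
      exact Submodule.zero_mem _
    have h3 := hL _ le_sup_left this
    exact hvL (h3 ▸ Submodule.mem_sup_right (Submodule.mem_span_singleton_self v))
  refine ⟨g ∘ₗ L.mkQ, ?_, hgK⟩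
  have : LinearMap.range (g ∘ₗ L.mkQ) = K := by
    apply hK
    · intro v hv
      exact ⟨v, hgK v hv⟩
    · rw [eq_bot_iff]
      rintro _ ⟨⟨v, rfl⟩, hv⟩
      by_contra hne
      have hvL : v ∉ L := fun h => hne (by
        rw [LinearMap.comp_apply, Submodule.mkQ_apply, (Submodule.Quotient.mk_eq_zero L).mpr h]
        simp)
      have h2 : (L ⊔ Submodule.span R {v}) ⊓ K ≠ ⊥ := by
        intro h
        have h3 := hL _ le_sup_left h
        exact hvL (h3 ▸ Submodule.mem_sup_right (Submodule.mem_span_singleton_self v))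
      apply h2
      rw [eq_bot_iff]
      rintro w ⟨hw1, hw2⟩
      obtain ⟨l, hl, z, hz, rfl⟩ := Submodule.mem_sup.mp hw1
      obtain ⟨r, rfl⟩ := Submodule.mem_span_singleton.mp hz
      have h1 := hgK _ hw2
      rw [map_add, Submodule.mkQ_apply, (Submodule.Quotient.mk_eq_zero L).mpr hl, zero_add,
        map_smul, map_smul] at h1
      have h4 : l + r • v ∈ K ⊓ A := ⟨hw2, h1 ▸ A.smul_mem r hv⟩
      rw [hKA] at h4
      exact h4
  intro v
  rw [← this]
  exact ⟨v, rfl⟩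
end zorn

open IsLocalRing in
theorem exists_E (R : Type u) [CommRing R] [IsNoetherianRing R] [IsLocalRing R] :
    ∃ (E : Type u) (_ : AddCommGroup E) (_ : Module R E), Module.Baer R E ∧
      (∀ e : E, e ∈ tors (maximalIdeal R) E) ∧
      ∃ v : E, v ≠ 0 ∧ (∀ r ∈ maximalIdeal R, r • v = 0) ∧
        ∀ e : E, (∀ r ∈ maximalIdeal R, r • e = 0) → ∃ r : R, e = r • v := by
  classical
  let I0 := Injective.under (ModuleCat.of R (R ⧸ maximalIdeal R))
  have hI0 : Module.Baer R I0 := by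
    have : CategoryTheory.Injective (ModuleCat.of R I0) :=
      (inferInstance : CategoryTheory.Injective I0)
    exact Module.Baer.of_injective (Module.injective_module_of_injective_object R I0)
  let ι : (R ⧸ maximalIdeal R) →ₗ[R] I0 :=
    (Injective.ι (ModuleCat.of R (R ⧸ maximalIdeal R))).hom
  have hι : Function.Injective ι := (ModuleCat.mono_iff_injective _).mp inferInstance
  let X := tors (maximalIdeal R) I0
  have hX : Module.Baer R X := baer_tors _ hI0
  have hmu : ∀ r ∈ maximalIdeal R, r • ι 1 = 0 := by
    intro r hr
    rw [← map_smul]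
    have : r • (1 : R ⧸ maximalIdeal R) = 0 := by
      change Ideal.Quotient.mk _ (r * 1) = 0
      rw [mul_one, Ideal.Quotient.eq_zero_iff_mem]
      exact hr
    rw [this, map_zero]
  let w : X := ⟨ι 1, 1, fun r hr => hmu r (by simpa using hr)⟩
  have hw0 : w ≠ 0 := by
    intro h
    have h1 : ι 1 = ι 0 := by rw [map_zero]; exact congrArg Subtype.val h
    exact one_ne_zero (hι h1)
  have hmw : ∀ r ∈ maximalIdeal R, r • w = 0 := fun r hr => Subtype.ext (hmu r hr)
  obtain ⟨K, -, hKA, hK⟩ := exists_max_disj (Submodule.span R {w}) (⊥ : Submodule R X) (by simp)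
  obtain ⟨p, hpK, hp⟩ := exists_retract hX (Submodule.span R {w}) K hKA hK
  have hq : ∀ v, v - p v ∈ LinearMap.ker p := by
    intro v
    rw [LinearMap.mem_ker, map_sub, hp _ (hpK v), sub_self]
  let q : X →ₗ[R] LinearMap.ker p := LinearMap.codRestrict _ (LinearMap.id - p) hq
  refine ⟨LinearMap.ker p, inferInstance, inferInstance, ?_, ?_, ?_⟩
  · intro I g
    obtain ⟨g', hg'⟩ := hX I ((LinearMap.ker p).subtype ∘ₗ g)
    refine ⟨q ∘ₗ g', fun x hx => ?_⟩
    apply Subtype.ext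
    have h2 := (g ⟨x, hx⟩).2
    rw [LinearMap.mem_ker] at h2
    simp [q, hg' x hx, h2]
  · intro e
    obtain ⟨t, ht⟩ := e.1.2
    exact ⟨t, fun r hr => Subtype.ext (Subtype.ext (ht r hr))⟩
  · refine ⟨q w, ?_, ?_, ?_⟩
    · intro h
      have h1 : w - p w = 0 := congrArg Subtype.val h
      have h2 : w ∈ K ⊓ Submodule.span R {w} :=
        ⟨by rw [sub_eq_zero.mp h1]; exact hpK w, Submodule.mem_span_singleton_self w⟩
      rw [hKA] at h2
      exact hw0 (by simpa using h2)
    · intro r hr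
      rw [← map_smul, hmw r hr, map_zero]
    · intro e he
      by_cases he0 : e = 0
      · exact ⟨0, by rw [he0, zero_smul]⟩
      have h1 : (K ⊔ Submodule.span R {e.1}) ⊓ Submodule.span R {w} ≠ ⊥ := by
        intro h
        have h3 := hK _ le_sup_left h
        have h4 : e.1 ∈ K := h3 ▸ Submodule.mem_sup_right (Submodule.mem_span_singleton_self _)
        apply he0
        have h5 := hp _ h4
        rw [LinearMap.mem_ker.mp e.2] at h5
        exact Subtype.ext h5.symm
      obtain ⟨x, ⟨hx1, hx2⟩, hx0⟩ := Submodule.exists_mem_ne_zero_of_ne_bot h1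
      obtain ⟨l, hl, z, hz, rfl⟩ := Submodule.mem_sup.mp hx1
      obtain ⟨r, rfl⟩ := Submodule.mem_span_singleton.mp hz
      obtain ⟨s, hs⟩ := Submodule.mem_span_singleton.mp hx2
      have hre : IsUnit r := by
        by_contra hr
        have h6 : r • e.1 = 0 := congrArg Subtype.val (he r hr)
        apply hx0
        have h7 : l + r • e.1 ∈ K ⊓ Submodule.span R {w} :=
          ⟨by rw [h6, add_zero]; exact hl, hx2⟩
        rw [hKA] at h7
        exact h7
      have h8 : q (s • w) = r • e := by
        rw [hs]
        apply Subtype.ext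
        simp [q, hp l hl, LinearMap.mem_ker.mp e.2]
      obtain ⟨r', hr'⟩ := hre.exists_left_inv
      refine ⟨r' * s, ?_⟩
      rw [mul_smul, ← map_smul, h8, ← mul_smul, hr', one_smul]
end LCx
end part_L4

section part_L5
open CategoryTheory Pointwise IsLocalRing


namespace LCx

/-- the standing package: a ring `C` (a power series ring) acting on the injective hull `E` -/
structure Setup (R C E : Type u) [CommRing R] [IsLocalRing R] [CommRing C] [IsLocalRing C]
    [Algebra R C] [AddCommGroup E] [Module R E] [Module C E] : Prop where
  baer : Module.Baer R E
  tor : ∀ e : E, e ∈ tors (maximalIdeal R) E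
  soc : ∃ v : E, v ≠ 0 ∧ (∀ r ∈ maximalIdeal R, r • v = 0) ∧
        ∀ e : E, (∀ r ∈ maximalIdeal R, r • e = 0) → ∃ r : R, e = r • v
  rep : ∀ c : C, ∃ ρ : ℕ → R, (∀ t, ρ (t + 1) - ρ t ∈ maximalIdeal R ^ t) ∧
    ∀ t (e : E), (∀ r ∈ maximalIdeal R ^ t, r • e = 0) → c • e = ρ t • e
  maxi : ∀ c ∈ maximalIdeal C, ∃ c' ∈ Ideal.map (algebraMap R C) (maximalIdeal R),
    ∀ e : E, c • e = c' • e
  loc : ∀ r ∈ maximalIdeal R, algebraMap R C r ∈ maximalIdeal C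
  fin : ∃ I : Ideal C, IsPrecomplete I C ∧ I ≤ maximalIdeal C ∧
    ∀ y ∈ maximalIdeal R, ∃ Y ∈ I, ∀ e : E, y • e = Y • e

set_option linter.unusedSectionVars false
section ex
variable {R : Type u} [CommRing R] [IsNoetherianRing R] [IsLocalRing R]

/-- truncated evaluation of a power series -/
noncomputable def ev {n : ℕ} (x : Fin n → R) (f : MvPowerSeries (Fin n) R) (t : ℕ) : R :=
  MvPolynomial.aeval x (MvPowerSeries.truncTotal t f)

variable {n : ℕ} {x : Fin n → R} 

lemma aeval_mem (hx : ∀ i, x i ∈ maximalIdeal R) (t : ℕ) (p : MvPolynomial (Fin n) R)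
    (hp : p ∈ MvPolynomial.idealOfVars (Fin n) R ^ t) :
    MvPolynomial.aeval x p ∈ maximalIdeal R ^ t := by
  have h1 : (MvPolynomial.idealOfVars (Fin n) R) ≤
      Ideal.comap (MvPolynomial.aeval x : MvPolynomial (Fin n) R →ₐ[R] R).toRingHom
        (maximalIdeal R) := by
    rw [MvPolynomial.idealOfVars, Ideal.span_le]
    rintro _ ⟨i, rfl⟩
    simpa using hx i
  have h2 := (Ideal.pow_right_mono h1 t).trans (Ideal.le_comap_pow _ t)
  exact h2 hp

lemma ev_add (f g : MvPowerSeries (Fin n) R) (t : ℕ) : ev x (f + g) t = ev x f t + ev x g t := by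
  simp [ev]

lemma ev_mul (hx : ∀ i, x i ∈ maximalIdeal R) (f g : MvPowerSeries (Fin n) R) (t : ℕ) :
    ev x (f * g) t - ev x f t * ev x g t ∈ maximalIdeal R ^ t := by
  have := aeval_mem hx t _
    (MvPowerSeries.truncTotal_mul_sub_mul_truncTotal_mem_pow_idealOfVars (n := t) f g)
  simpa [ev] using this

lemma ev_sub (hx : ∀ i, x i ∈ maximalIdeal R) (f : MvPowerSeries (Fin n) R) {l s t : ℕ}
    (hs : l ≤ s) (ht : l ≤ t) :
    ev x f s - ev x f t ∈ maximalIdeal R ^ l := by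
  have := aeval_mem hx l _
    (MvPowerSeries.truncTotal_sub_truncTotal_mem_pow_idealOfVars hs ht f)
  simpa [ev] using this

lemma ev_coe (hx : ∀ i, x i ∈ maximalIdeal R) (p : MvPolynomial (Fin n) R) (t : ℕ) :
    ev x (p : MvPowerSeries (Fin n) R) t - MvPolynomial.aeval x p ∈ maximalIdeal R ^ t := by
  rw [ev, ← map_sub]
  apply aeval_mem hx
  rw [MvPolynomial.mem_pow_idealOfVars_iff']
  intro d hd
  rw [MvPolynomial.coeff_sub, sub_eq_zero, MvPowerSeries.coeff_truncTotal _ hd,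
    MvPolynomial.coeff_coe]

lemma smul_congr {E : Type*} [AddCommGroup E] [Module R E] {I : Ideal R} {e : E}
    (h : ∀ r ∈ I, r • e = 0) {a b : R} (hab : a - b ∈ I) : a • e = b • e := by
  rw [← sub_eq_zero, ← sub_smul]; exact h _ hab

variable {E : Type u} [AddCommGroup E] [Module R E]

open Classical in
/-- The action of the power series ring. -/
noncomputable def evAct (x : Fin n → R) (hE : ∀ e : E, e ∈ tors (maximalIdeal R) E)
    (f : MvPowerSeries (Fin n) R) (e : E) : E :=
  ev x f (hE e).choose • e

lemma evAct_eq (hx : ∀ i, x i ∈ maximalIdeal R) (hE : ∀ e : E, e ∈ tors (maximalIdeal R) E)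
    (f : MvPowerSeries (Fin n) R) {e : E} {t : ℕ} (h : ∀ r ∈ maximalIdeal R ^ t, r • e = 0) :
    evAct x hE f e = ev x f t • e := by
  have h1 := (hE e).choose_spec
  rw [evAct]
  set s := (hE e).choose
  rcases le_total s t with hst | hst
  · exact smul_congr h1 (ev_sub hx f le_rfl hst)
  · exact smul_congr h (ev_sub hx f hst le_rfl)

lemma smul_kill {I : Ideal R} {e : E} (h : ∀ r ∈ I, r • e = 0) (a : R) :
    ∀ r ∈ I, r • a • e = 0 := by
  intro r hr
  rw [smul_comm, h r hr, smul_zero]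

/-- The module structure. -/
@[reducible]
noncomputable def evModule (hx : ∀ i, x i ∈ maximalIdeal R)
    (hE : ∀ e : E, e ∈ tors (maximalIdeal R) E) : Module (MvPowerSeries (Fin n) R) E where
  smul f e := evAct x hE f e
  one_smul e := by
    obtain ⟨t, ht⟩ := hE e
    change evAct x hE 1 e = e
    rw [evAct_eq hx hE 1 ht]
    have := ev_coe hx (1 : MvPolynomial (Fin n) R) t
    rw [MvPolynomial.coe_one, map_one] at this
    rw [smul_congr ht this, one_smul]
  mul_smul f g e := by
    obtain ⟨t, ht⟩ := hE e
    change evAct x hE (f * g) e = evAct x hE f (evAct x hE g e)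
    rw [evAct_eq hx hE g ht, evAct_eq hx hE f (smul_kill ht _), evAct_eq hx hE _ ht, ← mul_smul]
    exact smul_congr ht (ev_mul hx f g t)
  smul_zero f := by
    change evAct x hE f 0 = 0
    rw [evAct, smul_zero]
  smul_add f a b := by
    obtain ⟨t, ht⟩ := hE a
    obtain ⟨s, hs⟩ := hE b
    change evAct x hE f (a + b) = evAct x hE f a + evAct x hE f b
    have h1 : ∀ r ∈ maximalIdeal R ^ (s + t), r • a = 0 := fun r hr =>
      ht r (Ideal.pow_le_pow_right (by omega) hr)
    have h2 : ∀ r ∈ maximalIdeal R ^ (s + t), r • b = 0 := fun r hr =>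
      hs r (Ideal.pow_le_pow_right (by omega) hr)
    rw [evAct_eq hx hE f h1, evAct_eq hx hE f h2, evAct_eq hx hE f (t := s + t), smul_add]
    intro r hr
    rw [smul_add, h1 r hr, h2 r hr, add_zero]
  add_smul f g e := by
    obtain ⟨t, ht⟩ := hE e
    change evAct x hE (f + g) e = evAct x hE f e + evAct x hE g e
    rw [evAct_eq hx hE _ ht, evAct_eq hx hE _ ht, evAct_eq hx hE _ ht, ev_add, add_smul]
  zero_smul e := by
    change evAct x hE 0 e = 0
    rw [evAct, ev, map_zero, map_zero, zero_smul]

open Classical in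
lemma mem_span_X (f : MvPowerSeries (Fin n) R) (hf : MvPowerSeries.coeff 0 f = 0) :
    f ∈ Ideal.span (Set.range (MvPowerSeries.X : Fin n → MvPowerSeries (Fin n) R)) := by
  let ch : (Fin n →₀ ℕ) → Option (Fin n) := fun d =>
    if h : ∃ i, d i ≠ 0 then some h.choose else none
  let g : Fin n → MvPowerSeries (Fin n) R := fun i d =>
    if ch d = some i then MvPowerSeries.coeff d f else 0
  have hg : ∀ i d, MvPowerSeries.coeff d (g i) =
    if ch d = some i then MvPowerSeries.coeff d f else 0 := fun i d => rfl
  have h1 : f = ∑ i, g i := by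
    ext d
    rw [map_sum]
    simp only [hg]
    by_cases h : ∃ i, d i ≠ 0
    · have : ch d = some h.choose := by simp only [ch, dif_pos h]
      simp [this]
    · have h0 : d = 0 := by
        ext i
        by_contra hi
        exact h ⟨i, hi⟩
      rw [h0, hf]
      simp
  rw [h1]
  refine Ideal.sum_mem _ (fun i _ => ?_)
  have : MvPowerSeries.X i ∣ g i := by
    rw [MvPowerSeries.X_dvd_iff]
    intro d hd
    rw [hg, if_neg]
    intro hc
    by_cases h : ∃ i, d i ≠ 0
    · have h2 : ch d = some h.choose := by simp only [ch, dif_pos h]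
      rw [h2] at hc
      have h3 := h.choose_spec
      rw [Option.some.inj hc] at h3
      exact h3 hd
    · have h2 : ch d = none := by simp only [ch, dif_neg h]
      rw [h2] at hc
      simp at hc
  obtain ⟨k, hk⟩ := this
  rw [hk]
  exact Ideal.mul_mem_right _ _ (Ideal.subset_span ⟨i, rfl⟩)

theorem exists_setup (R : Type u) [CommRing R] [IsNoetherianRing R] [IsLocalRing R] :
    ∃ (C E : Type u) (_ : CommRing C) (_ : IsLocalRing C) (_ : Algebra R C) (_ : AddCommGroup E)
      (_ : Module R E) (_ : Module C E), IsNoetherianRing C ∧ IsScalarTower R C E ∧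
      Setup R C E := by
  obtain ⟨E, _, _, hb, ht, hs⟩ := exists_E R
  obtain ⟨n, x, hx⟩ := Submodule.fg_iff_exists_fin_generating_family.mp
    (IsNoetherian.noetherian (maximalIdeal R))
  have hxm : ∀ i, x i ∈ maximalIdeal R := fun i => hx ▸ Submodule.subset_span ⟨i, rfl⟩
  let _ := evModule (E := E) hxm ht
  have hsm : ∀ (f : MvPowerSeries (Fin n) R) {e : E} {t : ℕ}
    (_ : ∀ r ∈ maximalIdeal R ^ t, r • e = 0), f • e = ev x f t • e := fun f e t h =>
      evAct_eq hxm ht f h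
  have hpoly : ∀ (p : MvPolynomial (Fin n) R) (e : E),
      (p : MvPowerSeries (Fin n) R) • e = MvPolynomial.aeval x p • e := by
    intro p e
    obtain ⟨t, h⟩ := ht e
    rw [hsm _ h]
    exact smul_congr h (ev_coe hxm p t)
  have hC : ∀ (r : R) (e : E), algebraMap R (MvPowerSeries (Fin n) R) r • e = r • e := by
    intro r e
    have := hpoly (MvPolynomial.C r) e
    rw [MvPolynomial.coe_C] at this
    rw [MvPowerSeries.algebraMap_apply]
    simpa using this
  have hX : ∀ i (e : E), (MvPowerSeries.X i : MvPowerSeries (Fin n) R) • e = x i • e := by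
    intro i e
    have := hpoly (MvPolynomial.X i) e
    rw [MvPolynomial.coe_X] at this
    simpa using this
  have hst : IsScalarTower R (MvPowerSeries (Fin n) R) E := ⟨fun r f e => by
    rw [Algebra.smul_def, mul_smul, hC]⟩
  have hXm : ∀ i, (MvPowerSeries.X i : MvPowerSeries (Fin n) R) ∈
      maximalIdeal (MvPowerSeries (Fin n) R) := by
    intro i
    rw [mem_maximalIdeal, mem_nonunits_iff, MvPowerSeries.isUnit_iff_constantCoeff]
    simp
  have hloc : ∀ r ∈ maximalIdeal R, algebraMap R (MvPowerSeries (Fin n) R) r ∈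
      maximalIdeal (MvPowerSeries (Fin n) R) := by
    intro r hr
    rw [mem_maximalIdeal, mem_nonunits_iff, MvPowerSeries.isUnit_iff_constantCoeff,
      MvPowerSeries.algebraMap_apply]
    simpa using hr
  refine ⟨MvPowerSeries (Fin n) R, E, inferInstance, inferInstance, inferInstance, inferInstance,
    inferInstance, inferInstance, inferInstance, hst, hb, ht, hs, ?_, ?_, hloc, ?_⟩
  · intro f
    exact ⟨ev x f, fun t => ev_sub hxm f (Nat.le_succ t) le_rfl, fun t e h => hsm f h⟩
  · intro f hf
    have hr : MvPowerSeries.constantCoeff f ∈ maximalIdeal R := by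
      rw [mem_maximalIdeal, mem_nonunits_iff, MvPowerSeries.isUnit_iff_constantCoeff] at hf
      exact hf
    have h1 := mem_span_X (f - algebraMap R _ (MvPowerSeries.constantCoeff f)) (by
      rw [MvPowerSeries.algebraMap_apply]
      simp)
    have h2 : ∀ g ∈ Ideal.span (Set.range (MvPowerSeries.X : Fin n → MvPowerSeries (Fin n) R)),
        ∃ c' ∈ Ideal.map (algebraMap R (MvPowerSeries (Fin n) R)) (maximalIdeal R),
          ∀ e : E, g • e = c' • e := by
      intro g hg
      induction hg using Submodule.span_induction with
      | mem y hy =>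
        obtain ⟨i, rfl⟩ := hy
        exact ⟨algebraMap R _ (x i), Ideal.mem_map_of_mem _ (hxm i), fun e => by rw [hX, hC]⟩
      | zero => exact ⟨0, Ideal.zero_mem _, fun e => by simp⟩
      | add a b _ _ ha hb =>
        obtain ⟨A, hA, hA'⟩ := ha
        obtain ⟨B, hB, hB'⟩ := hb
        exact ⟨A + B, Ideal.add_mem _ hA hB, fun e => by rw [add_smul, add_smul, hA', hB']⟩
      | smul r a _ ha =>
        obtain ⟨A, hA, hA'⟩ := ha
        exact ⟨r * A, Ideal.mul_mem_left _ _ hA, fun e => by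
          rw [mul_smul, ← hA', smul_eq_mul, mul_smul]⟩
    obtain ⟨c, hc, hc'⟩ := h2 _ h1
    refine ⟨algebraMap R _ (MvPowerSeries.constantCoeff f) + c,
      Ideal.add_mem _ (Ideal.mem_map_of_mem _ hr) hc, fun e => ?_⟩
    rw [add_smul, ← hc', ← add_smul, add_sub_cancel]
  · refine ⟨Ideal.span (Set.range MvPowerSeries.X), inferInstance, ?_, ?_⟩
    · rw [Ideal.span_le]
      rintro _ ⟨i, rfl⟩
      exact hXm i
    · intro y hy
      rw [← hx] at hy
      induction hy using Submodule.span_induction with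
      | mem y hy =>
        obtain ⟨i, rfl⟩ := hy
        exact ⟨MvPowerSeries.X i, Ideal.subset_span ⟨i, rfl⟩, fun e => (hX i e).symm⟩
      | zero => exact ⟨0, Ideal.zero_mem _, fun e => by simp⟩
      | add a b _ _ ha hb =>
        obtain ⟨A, hA, hA'⟩ := ha
        obtain ⟨B, hB, hB'⟩ := hb
        exact ⟨A + B, Ideal.add_mem _ hA hB, fun e => by rw [add_smul, add_smul, hA', hB']⟩
      | smul r a _ ha =>
        obtain ⟨A, hA, hA'⟩ := ha
        exact ⟨algebraMap R _ r * A, Ideal.mul_mem_left _ _ hA, fun e => by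
          rw [mul_smul, hC, ← hA', smul_eq_mul, mul_smul]⟩

end ex
end LCx
end part_L5

section part_L6
open CategoryTheory Pointwise IsLocalRing


namespace LCx
set_option linter.unusedSectionVars false

section basics
variable {R C E : Type u} [CommRing R] [IsLocalRing R] [CommRing C] [IsLocalRing C]
    [Algebra R C] [AddCommGroup E] [Module R E] [Module C E] [IsScalarTower R C E]
variable {H H' H'' : Type u} [AddCommGroup H] [Module R H] [AddCommGroup H'] [Module R H']
  [AddCommGroup H''] [Module R H'']

/-- Pull back of functionals. -/
def pb (C E : Type u) [CommRing C] [Algebra R C] [AddCommGroup E] [Module R E] [Module C E]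
    [IsScalarTower R C E] (f : H →ₗ[R] H') : (H' →ₗ[R] E) →ₗ[C] (H →ₗ[R] E) where
  toFun κ := κ ∘ₗ f
  map_add' _ _ := rfl
  map_smul' _ _ := rfl

@[simp] lemma pb_apply (f : H →ₗ[R] H') (κ : H' →ₗ[R] E) (h : H) : pb C E f κ h = κ (f h) := rfl

lemma Setup.ext_of_ker (S : Setup R C E) (f : H →ₗ[R] H') (κ : H →ₗ[R] E)
    (h : ∀ a, f a = 0 → κ a = 0) : ∃ κ' : H' →ₗ[R] E, ∀ a, κ' (f a) = κ a := by
  let g := (LinearMap.ker f).liftQ f le_rfl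
  have hg : Function.Injective g := by
    rw [← LinearMap.ker_eq_bot]
    exact Submodule.ker_liftQ_eq_bot _ _ _ le_rfl
  obtain ⟨κ', hκ⟩ := Module.Baer.extension_property S.baer g hg
    ((LinearMap.ker f).liftQ κ (fun a ha => h a ha))
  refine ⟨κ', fun a => ?_⟩
  exact LinearMap.congr_fun hκ (Submodule.Quotient.mk a)

lemma Setup.pb_exact (S : Setup R C E) (f : H →ₗ[R] H') (g : H' →ₗ[R] H'')
    (h : Function.Exact f g) : Function.Exact (pb C E g) (pb C E f) := by
  intro κ
  constructor
  · intro hk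
    obtain ⟨κ', hκ⟩ := S.ext_of_ker g κ (fun a ha => by
      obtain ⟨b, rfl⟩ := (h a).mp ha
      exact LinearMap.congr_fun hk b)
    exact ⟨κ', LinearMap.ext hκ⟩
  · rintro ⟨κ', rfl⟩
    ext a
    have : g (f a) = 0 := (h _).mpr ⟨a, rfl⟩
    simp [this]

lemma Setup.cogen (S : Setup R C E) (h : H) (hh : ∀ κ : H →ₗ[R] E, κ h = 0) : h = 0 := by
  by_contra h0
  obtain ⟨v, hv0, hv, -⟩ := S.soc
  obtain ⟨κ', hκ⟩ := S.ext_of_ker (LinearMap.toSpanSingleton R H h) (LinearMap.toSpanSingleton R E v)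
    (fun a ha => by
      apply hv
      intro hu
      apply h0
      rw [LinearMap.toSpanSingleton_apply] at ha
      exact hu.smul_eq_zero.mp ha)
  have := hκ 1
  simp only [LinearMap.toSpanSingleton_apply, one_smul] at this
  exact hv0 (by rw [← this, hh])

lemma Setup.smul_kill_pow (S : Setup R C E) (n : ℕ) (c : C) (hc : c ∈ maximalIdeal C ^ n) (e : E)
    (he : ∀ r ∈ maximalIdeal R ^ n, r • e = 0) : c • e = 0 := by
  induction n generalizing c e with
  | zero =>
    have : e = 0 := by simpa using he 1 (by simp)
    rw [this, smul_zero]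
  | succ n ih =>
    have key : ∀ b ∈ maximalIdeal C, ∀ r ∈ maximalIdeal R ^ n, r • b • e = 0 := by
      intro b hb r hr
      obtain ⟨b', hb', hbb⟩ := S.maxi b hb
      rw [hbb]
      clear hbb
      rw [Ideal.map] at hb'
      induction hb' using Submodule.span_induction with
      | mem y hy =>
        obtain ⟨y, hy, rfl⟩ := hy
        rw [algebraMap_smul, ← mul_smul]
        exact he _ (by rw [pow_succ]; exact Ideal.mul_mem_mul hr hy)
      | zero => simp
      | add x y _ _ hx hy => rw [add_smul, smul_add, hx, hy, add_zero]
      | smul a x _ hx => rw [smul_eq_mul, mul_smul, smul_comm, hx, smul_zero]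
    rw [pow_succ] at hc
    induction hc using Submodule.mul_induction_on' with
    | mem_mul_mem x hx y hy => rw [mul_smul]; exact ih x hx _ (key y hy)
    | add x _ y _ hx hy => rw [add_smul, hx, hy, add_zero]

lemma Setup.smul_kill_pow' (S : Setup R C E) (n : ℕ) (κ : H →ₗ[R] E)
    (hc : κ ∈ maximalIdeal C ^ n • (⊤ : Submodule C (H →ₗ[R] E))) (h : H)
    (hh : ∀ r ∈ maximalIdeal R ^ n, r • h = 0) : κ h = 0 := by
  induction hc using Submodule.smul_induction_on' with
  | smul c hc κ _ =>
    rw [LinearMap.smul_apply]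
    exact S.smul_kill_pow n c hc _ (fun r hr => by rw [← map_smul, hh r hr, map_zero])
  | add x _ y _ hx hy => rw [LinearMap.add_apply, hx, hy, add_zero]

lemma Setup.hausdorff (S : Setup R C E) (hH : ∀ h : H, h ∈ tors (maximalIdeal R) H)
    (I : Ideal C) (hI : I ≤ maximalIdeal C) : IsHausdorff I (H →ₗ[R] E) := by
  constructor
  intro κ hκ
  ext h
  obtain ⟨n, hn⟩ := hH h
  have := hκ n
  rw [SModEq.zero] at this
  exact S.smul_kill_pow' n κ (Submodule.smul_mono_left (Ideal.pow_right_mono hI n) this) h hn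

/-- `κ` kills `H[J]` implies `κ ∈ J W`. -/
lemma Setup.mem_smul_of_kill (S : Setup R C E) (J : Ideal R) (hJ : J.FG) (κ : H →ₗ[R] E)
    (h : ∀ a : H, (∀ r ∈ J, r • a = 0) → κ a = 0) :
    κ ∈ Ideal.map (algebraMap R C) J • (⊤ : Submodule C (H →ₗ[R] E)) := by
  obtain ⟨n, x, hx⟩ := Submodule.fg_iff_exists_fin_generating_family.mp hJ
  obtain ⟨κ', hκ⟩ := S.ext_of_ker (LinearMap.pi (fun i => LinearMap.lsmul R H (x i))) κ
    (fun a ha => h a (fun r hr => by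
      rw [← hx] at hr
      induction hr using Submodule.span_induction with
      | mem y hy =>
        obtain ⟨i, rfl⟩ := hy
        exact congrFun ha i
      | zero => simp
      | add x y _ _ hx hy => rw [add_smul, hx, hy, add_zero]
      | smul a x _ hx => rw [smul_eq_mul, mul_smul, hx, smul_zero]))
  have : κ = ∑ i, algebraMap R C (x i) • (κ' ∘ₗ LinearMap.single R (fun _ => H) i) := by
    ext a
    rw [← hκ, LinearMap.sum_apply]
    simp only [LinearMap.smul_apply, LinearMap.comp_apply, algebraMap_smul, ← map_smul]
    rw [← map_sum]
    congr 1
    ext j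
    simp [Finset.sum_apply, Pi.single_apply]
  rw [this]
  exact Submodule.sum_mem _ (fun i _ => Submodule.smul_mem_smul
    (Ideal.mem_map_of_mem _ (hx ▸ Submodule.subset_span ⟨i, rfl⟩)) trivial)

lemma Setup.mem_smul_of_kill_one (S : Setup R C E) (y : R) (κ : H →ₗ[R] E)
    (h : ∀ a : H, y • a = 0 → κ a = 0) : ∃ κ' : H →ₗ[R] E, κ = y • κ' := by
  obtain ⟨κ', hκ⟩ := S.ext_of_ker (LinearMap.lsmul R H y) κ h
  exact ⟨κ', by ext a; rw [← hκ]; simp⟩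

lemma precomplete_pi (I : Ideal C) [IsPrecomplete I C] (k : ℕ) : IsPrecomplete I (Fin k → C) := by
  constructor
  intro f hf
  have key : ∀ n (v : Fin k → C), v ∈ (I ^ n • ⊤ : Submodule C (Fin k → C)) ↔
      ∀ i, v i ∈ (I ^ n • ⊤ : Submodule C C) := by
    intro n v
    constructor
    · intro hv i
      have := Submodule.mem_map_of_mem (f := LinearMap.proj (R := C) (φ := fun _ : Fin k => C) i) hv
      rw [Submodule.map_smul''] at this
      exact Submodule.smul_mono le_rfl le_top this
    · intro hv
      rw [pi_eq_sum_univ' v]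
      refine Submodule.sum_mem _ (fun i _ => Submodule.smul_mem_smul ?_ trivial)
      simpa using hv i
  have h1 : ∀ i, ∃ L : C, ∀ n, f n i ≡ L [SMOD (I ^ n • ⊤ : Submodule C C)] := fun i =>
    IsPrecomplete.prec' (fun n => f n i) (fun {a b} hab => by
      have := hf hab
      rw [SModEq.sub_mem] at this ⊢
      exact (key _ _).mp this i)
  choose L hL using h1
  refine ⟨L, fun n => ?_⟩
  rw [SModEq.sub_mem, key]
  intro i
  have := hL i n
  rw [SModEq.sub_mem] at this
  exact this

lemma Setup.fg_of_quot [IsNoetherianRing C] (S : Setup R C E)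
    (hH : ∀ h : H, h ∈ tors (maximalIdeal R) H)
    {V : Type u} [AddCommGroup V] [Module C V] [Module.Finite C V] (g : (H →ₗ[R] E) →ₗ[C] V)
    (y : R) (hy : y ∈ maximalIdeal R)
    (hg : ∀ κ, g κ = 0 → ∃ κ' : H →ₗ[R] E, κ = y • κ') : Module.Finite C (H →ₗ[R] E) := by
  obtain ⟨I, hI, hIm, hY⟩ := S.fin
  obtain ⟨Y, hYI, hY⟩ := hY y hy
  have := S.hausdorff hH I hIm
  obtain ⟨k, v, hv⟩ := Submodule.fg_iff_exists_fin_generating_family.mp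
    (IsNoetherian.noetherian (LinearMap.range g))
  have hvr : ∀ i, v i ∈ LinearMap.range g := fun i => hv ▸ Submodule.subset_span ⟨i, rfl⟩
  choose w hw using hvr
  have := precomplete_pi I k
  let F : (Fin k → C) →ₗ[C] (H →ₗ[R] E) := Fintype.linearCombination C w
  refine Module.Finite.of_surjective F (surjective_of_mkQ_comp_surjective (I := I) ?_)
  intro z
  obtain ⟨κ, rfl⟩ := Submodule.mkQ_surjective _ z
  have h1 : g κ ∈ Submodule.span C (Set.range v) := by rw [hv]; exact ⟨κ, rfl⟩
  obtain ⟨a, ha⟩ := (Submodule.mem_span_range_iff_exists_fun C).mp h1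
  refine ⟨a, ?_⟩
  obtain ⟨κ', hκ⟩ := hg (κ - F a) (by
    rw [map_sub, ← ha, sub_eq_zero]
    simp [F, Fintype.linearCombination_apply, hw])
  rw [LinearMap.comp_apply, eq_comm, ← sub_eq_zero, ← map_sub, hκ, Submodule.mkQ_apply,
    Submodule.Quotient.mk_eq_zero]
  have : y • κ' = Y • κ' := by ext h; exact hY _
  rw [this]
  exact Submodule.smul_mem_smul hYI trivial

end basics
end LCx
end part_L6

section part_L7
open CategoryTheory Pointwise IsLocalRing


namespace LCx
set_option linter.unusedSectionVars false

section coh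
variable {C : Type u} [CommRing C] [IsLocalRing C]

/-- coheight at least `q` -/
def coh : ℕ → PrimeSpectrum C → Prop
  | 0, _ => True
  | q + 1, P => ∃ Q, P < Q ∧ coh q Q

lemma coh_anti (q : ℕ) {P Q : PrimeSpectrum C} (h : P ≤ Q) (hQ : coh q Q) : coh q P := by
  cases q with
  | zero => trivial
  | succ q =>
    obtain ⟨Q', h1, h2⟩ := hQ
    exact ⟨Q', lt_of_le_of_lt h h1, h2⟩

lemma coh_pred (q : ℕ) {P : PrimeSpectrum C} (hP : coh (q + 1) P) : coh q P := by
  obtain ⟨Q, h1, h2⟩ := hP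
  exact coh_anti q h1.le h2

lemma coh_mono {q q' : ℕ} (h : q ≤ q') {P : PrimeSpectrum C} (hP : coh q' P) : coh q P := by
  induction h with
  | refl => exact hP
  | step _ ih => exact ih (coh_pred _ hP)

lemma le_closed (P : PrimeSpectrum C) : P ≤ closedPoint C :=
  IsLocalRing.le_maximalIdeal P.2.ne_top

lemma coh_step [IsNoetherianRing C] (q : ℕ) (y : C) (hy : y ∈ maximalIdeal C) (P : PrimeSpectrum C)
    (hP : coh (q + 1) P) : ∃ P1, P ≤ P1 ∧ y ∈ P1.asIdeal ∧ coh q P1 := by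
  induction q generalizing P with
  | zero => exact ⟨closedPoint C, le_closed P, hy, trivial⟩
  | succ q ih =>
    obtain ⟨Q, h1, h2⟩ := hP
    obtain ⟨Q1, h3, h4, h5⟩ := ih Q h2
    rcases eq_or_lt_of_le h3 with h | h
    · subst h
      exact ⟨Q, h1.le, h4, h2⟩
    · obtain ⟨Q2, h6, h7, h8⟩ := PrimeSpectrum.exist_mem_one_of_mem_two h1 h h4
      exact ⟨Q2, h7.le, h6, Q1, h8, h5⟩

lemma exists_not_mem {P : PrimeSpectrum C} (hP : P ≠ closedPoint C) :
    ∃ s ∈ maximalIdeal C, s ∉ P.asIdeal := by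
  by_contra! h
  exact hP (le_antisymm (le_closed P) h)

lemma unif {W : Type u} [AddCommGroup W] [Module C W] [Module.Finite C W] (P : PrimeSpectrum C)
    (h : ∀ w : W, ∃ s ∉ P.asIdeal, s • w = 0) : ∃ s ∉ P.asIdeal, ∀ w : W, s • w = 0 := by
  classical
  obtain ⟨g, hg⟩ := (Module.Finite.fg_top : (⊤ : Submodule C W).FG)
  choose σ h1 h2 using h
  refine ⟨∏ w ∈ g, σ w, ?_, fun w => ?_⟩
  · intro hs
    obtain ⟨w, _, hw⟩ := (P.2.prod_mem_iff).mp hs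
    exact h1 w hw
  · have hw : w ∈ Submodule.span C (g : Set W) := by rw [hg]; trivial
    induction hw using Submodule.span_induction with
    | mem x hx =>
      rw [← Finset.prod_erase_mul _ _ hx, mul_smul, h2, smul_zero]
    | zero => simp
    | add x y _ _ hx hy => rw [smul_add, hx, hy, add_zero]
    | smul a x _ hx => rw [smul_comm, hx, smul_zero]

/-- determinant trick -/
lemma naka_loc {W : Type u} [AddCommGroup W] [Module C W] [Module.Finite C W] (P : PrimeSpectrum C)
    (y : C) (hy : y ∈ P.asIdeal) (s : C) (hs : s ∉ P.asIdeal)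
    (h : ∀ w : W, ∃ w' : W, s • w = y • w') : ∃ c ∉ P.asIdeal, ∀ w : W, c • w = 0 := by
  obtain ⟨p, hp, -, hc, hp0⟩ :=
    LinearMap.exists_monic_and_natDegree_eq_and_coeff_mem_pow_and_aeval_eq_zero C
    (s • (LinearMap.id : W →ₗ[C] W)) (Ideal.span {y}) (by
      rintro _ ⟨w, rfl⟩
      obtain ⟨w', hw⟩ := h w
      have : (s • (LinearMap.id : W →ₗ[C] W)) w = y • w' := hw
      rw [this]
      exact Submodule.smul_mem_smul (Ideal.mem_span_singleton_self y) trivial)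
  refine ⟨p.eval s, ?_, fun w => ?_⟩
  · intro hmem
    rw [Polynomial.eval_eq_sum_range, Finset.sum_range_succ, hp.coeff_natDegree, one_mul] at hmem
    have h1 : ∑ k ∈ Finset.range p.natDegree, p.coeff k * s ^ k ∈ P.asIdeal := by
      refine Ideal.sum_mem _ (fun k hk => Ideal.mul_mem_right _ _ ?_)
      have h2 := hc k
      have h3 : Ideal.span {y} ≤ P.asIdeal := by
        rw [Ideal.span_le]; simpa using hy
      refine h3 (Ideal.pow_le_self ?_ h2)
      have := Finset.mem_range.mp hk
      omega
    have h4 := (Ideal.add_mem_iff_right _ h1).mp hmem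
    exact hs (P.2.mem_of_pow_mem _ h4)
  · have : Polynomial.aeval (s • (LinearMap.id : W →ₗ[C] W)) p = p.eval s • LinearMap.id := by
      have h5 : s • (LinearMap.id : W →ₗ[C] W) = algebraMap C (Module.End C W) s := rfl
      rw [h5, Polynomial.aeval_algebraMap_apply]
      rfl
    rw [this] at hp0
    exact LinearMap.congr_fun hp0 w
end coh

section claim
variable {R C E : Type u} [CommRing R] [IsLocalRing R] [CommRing C] [IsLocalRing C]
    [Algebra R C] [AddCommGroup E] [Module R E] [Module C E] [IsScalarTower R C E]
    [IsNoetherianRing R] [IsNoetherianRing C]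

lemma HH_zero_finite (N : Type u) [AddCommGroup N] [Module R N] [Module.Finite R N] (b : Ideal R)
    (h : ∀ r ∈ b, ∀ n : N, r • n = 0) : Module.Finite R (HH N b 0) := by
  refine Module.Finite.of_surjective (ofX N b 0 1) ?_
  intro x
  obtain ⟨t, α, rfl⟩ := exists_ofX N b 0 x
  have h1 : 1 ≤ max t 1 := le_max_right _ _
  rw [← ofX_pre N b 0 (le_max_left t 1)]
  obtain ⟨g, hg⟩ := XX0_surj _ (pre N (Ideal.pow_le_pow_right (le_max_left t 1)) 0 α)
  rw [← hg]
  let g' : ModuleCat.of R (R ⧸ b ^ 1) ⟶ ModuleCat.of R N :=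
    ModuleCat.ofHom (Submodule.liftQ _ (LinearMap.toSpanSingleton R N (g.hom (Submodule.Quotient.mk 1)))
      (fun r hr => by
        rw [LinearMap.mem_ker, LinearMap.toSpanSingleton_apply]
        exact h r (by simpa using hr) _))
  refine ⟨Abelian.Ext.mk₀ g', ?_⟩
  rw [← ofX_pre N b 0 h1, pre_apply, Abelian.Ext.mk₀_comp_mk₀]
  congr 2
  apply hom_ext_one
  change (1 : R) • (g.hom (Submodule.Quotient.mk 1)) = _
  rw [one_smul]

variable {H : Type u} [AddCommGroup H] [Module R H]

lemma Setup.finite_of_kill (S : Setup R C E) [Module.Finite R H]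
    (hH : ∀ r ∈ maximalIdeal R, ∀ h : H, r • h = 0) : Module.Finite C (H →ₗ[R] E) := by
  obtain ⟨v, hv0, hv, hs⟩ := S.soc
  obtain ⟨k, x, hx⟩ := Submodule.fg_iff_exists_fin_generating_family.mp
    (Module.Finite.fg_top : (⊤ : Submodule R H).FG)
  let V : Submodule C E := Submodule.span C {v}
  let g : (H →ₗ[R] E) →ₗ[C] (Fin k → V) :=
    { toFun := fun κ i => ⟨κ (x i), by
        obtain ⟨r, hr⟩ := hs (κ (x i)) (fun r hr => by rw [← map_smul, hH r hr, map_zero])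
        rw [hr, ← algebraMap_smul C]
        exact V.smul_mem _ (Submodule.mem_span_singleton_self v)⟩
      map_add' := fun _ _ => rfl
      map_smul' := fun _ _ => rfl }
  refine Module.Finite.of_injective g ?_
  intro κ κ' h
  apply LinearMap.ext_on (s := Set.range x) hx
  rintro _ ⟨i, rfl⟩
  exact congrArg Subtype.val (congrFun h i)

lemma HH_tors' (N : Type u) [AddCommGroup N] [Module R N] (b : Ideal R) (i : ℕ) (h : HH N b i) :
    h ∈ tors b (HH N b i) := HH_torsion N b i h

theorem Setup.claim (S : Setup R C E) (q : ℕ) :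
    ∀ (N : Type u) [AddCommGroup N] [Module R N] [Module.Finite R N],
      Module.Finite C (HH N (maximalIdeal R) q →ₗ[R] E) ∧
      ∀ P : PrimeSpectrum C, coh (q + 1) P → ∀ w : HH N (maximalIdeal R) q →ₗ[R] E,
        ∃ s ∉ P.asIdeal, s • w = 0 := by
  have hsub : ∀ (N : Type u) [AddCommGroup N] [Module R N] (q : ℕ),
      (∀ h : HH N (maximalIdeal R) q, h = 0) →
      Module.Finite C (HH N (maximalIdeal R) q →ₗ[R] E) ∧
      ∀ P : PrimeSpectrum C, coh (q + 1) P → ∀ w : HH N (maximalIdeal R) q →ₗ[R] E,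
        ∃ s ∉ P.asIdeal, s • w = 0 := by
    intro N _ _ q h
    have h1 : Subsingleton (HH N (maximalIdeal R) q →ₗ[R] E) := ⟨fun f g => by
      ext x; rw [h x, map_zero, map_zero]⟩
    exact ⟨inferInstance, fun P _ w => ⟨1, P.1.one_notMem, Subsingleton.elim _ _⟩⟩
  have hexact : ∀ (q : ℕ) (N₁ N₂ N₃ : Type u) [AddCommGroup N₁] [Module R N₁] [AddCommGroup N₂]
      [Module R N₂] [AddCommGroup N₃] [Module R N₃] (f : N₁ →ₗ[R] N₂) (g : N₂ →ₗ[R] N₃)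
      (hf : Function.Injective f) (hg : Function.Surjective g) (hfg : Function.Exact f g),
      (Module.Finite C (HH N₁ (maximalIdeal R) q →ₗ[R] E) ∧
      ∀ P : PrimeSpectrum C, coh (q + 1) P → ∀ w : HH N₁ (maximalIdeal R) q →ₗ[R] E,
        ∃ s ∉ P.asIdeal, s • w = 0) → (Module.Finite C (HH N₃ (maximalIdeal R) q →ₗ[R] E) ∧
      ∀ P : PrimeSpectrum C, coh (q + 1) P → ∀ w : HH N₃ (maximalIdeal R) q →ₗ[R] E,
        ∃ s ∉ P.asIdeal, s • w = 0) → (Module.Finite C (HH N₂ (maximalIdeal R) q →ₗ[R] E) ∧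
      ∀ P : PrimeSpectrum C, coh (q + 1) P → ∀ w : HH N₂ (maximalIdeal R) q →ₗ[R] E,
        ∃ s ∉ P.asIdeal, s • w = 0) := by
    intro q N₁ N₂ N₃ _ _ _ _ _ _ f g hf hg hfg h1 h3
    have hex := S.pb_exact _ _ (hmap_exact hf hg hfg (maximalIdeal R) q)
    have := h1.1
    have := h3.1
    constructor
    · have : IsNoetherian C (HH N₂ (maximalIdeal R) q →ₗ[R] E) :=
        isNoetherian_of_range_eq_ker _ _ (LinearMap.exact_iff.mp hex).symm
      infer_instance
    · intro P hP w
      obtain ⟨s, hs, hsw⟩ := h1.2 P hP (pb C E (hmap (maximalIdeal R) q f) w)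
      rw [← map_smul] at hsw
      obtain ⟨w', hw'⟩ := (hex _).mp hsw
      obtain ⟨s', hs', hsw'⟩ := h3.2 P hP w'
      refine ⟨s' * s, fun h => (P.2.mem_or_mem h).elim hs' hs, ?_⟩
      rw [mul_smul, ← hw', ← map_smul, hsw', map_zero]
  induction q with
  | zero =>
    intro N _ _ hN
    induction ‹Module.Finite R N› using IsNoetherianRing.induction_on_isQuotientEquivQuotientPrime
      with
    | subsingleton N => exact hsub N 0 (HH_subsingleton _ _)
    | exact N₁ N₂ N₃ f g hf hg hfg h₁ h₃ => exact hexact 0 N₁ N₂ N₃ f g hf hg hfg h₁ h₃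
    | quotient N p e =>
      have := p.2
      by_cases hp : maximalIdeal R ≤ p.1
      · have hk : ∀ r ∈ maximalIdeal R, ∀ n : N, r • n = 0 := fun r hr =>
          smul_zero_of_equiv e (hp hr)
        have hfin : Module.Finite R N := Module.Finite.equiv e.symm
        have := HH_zero_finite N _ hk
        have hk' : ∀ r ∈ maximalIdeal R, ∀ h : HH N (maximalIdeal R) 0, r • h = 0 := fun r hr h =>
          HH_smul_zero (hk r hr) _ _ h
        refine ⟨S.finite_of_kill hk', fun P hP w => ?_⟩
        obtain ⟨Q, hPQ, -⟩ := hP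
        obtain ⟨s, hsm, hs⟩ := exists_not_mem (P := P) (fun h =>
          absurd (lt_of_lt_of_le hPQ (le_closed Q)) (by rw [h]; exact lt_irrefl _))
        refine ⟨s, hs, ?_⟩
        ext h
        rw [LinearMap.smul_apply]
        exact S.smul_kill_pow 1 s (by simpa using hsm) _ (fun r hr => by
          rw [← map_smul, hk' r (by simpa using hr), map_zero])
      · obtain ⟨y, hym, hyp⟩ := Set.not_subset.mp hp
        have hreg := smul_regular_of_equiv e hyp
        refine hsub N 0 (fun h => ?_)
        obtain ⟨t, ht⟩ := HH_pow_torsion _ _ hym h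
        refine eq_zero_of_pow_torsion (fun a ha => ?_) t h ht
        rw [← hmap_smul_id N] at ha
        have hf : Function.Injective (y • LinearMap.id : N →ₗ[R] N) := by
          intro a c h; exact hreg h
        exact (map_eq_zero_iff _ (hmap_zero_inj hf _)).mp ha
  | succ q ih =>
    intro N _ _ hN
    induction ‹Module.Finite R N› using IsNoetherianRing.induction_on_isQuotientEquivQuotientPrime
      with
    | subsingleton N => exact hsub N _ (HH_subsingleton _ _)
    | exact N₁ N₂ N₃ f g hf hg hfg h₁ h₃ => exact hexact _ N₁ N₂ N₃ f g hf hg hfg h₁ h₃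
    | quotient N p e =>
      have := p.2
      have hfin : Module.Finite R N := Module.Finite.equiv e.symm
      by_cases hp : maximalIdeal R ≤ p.1
      · exact hsub N _ (HH_tors _ q N (fun n => ⟨1, fun r hr =>
          smul_zero_of_equiv e (hp (by simpa using hr)) n⟩))
      · obtain ⟨y, hym, hyp⟩ := Set.not_subset.mp hp
        have hreg := smul_regular_of_equiv e hyp
        obtain ⟨δ, h1, h2, -⟩ := exists_delta_y hreg (maximalIdeal R) q
        obtain ⟨hV, hV'⟩ := ih (QuotSMulTop y N)
        have hker : ∀ κ, pb C E δ κ = 0 → ∃ κ', κ = y • κ' := by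
          intro κ hκ
          apply S.mem_smul_of_kill_one
          intro a ha
          obtain ⟨z, rfl⟩ := h1 a ha
          exact LinearMap.congr_fun hκ z
        have hF := S.fg_of_quot (HH_tors' N _ _) (pb C E δ) y hym hker
        refine ⟨hF, fun P hP w => ?_⟩
        obtain ⟨P1, hP1, hyP, hc⟩ := coh_step _ _ (S.loc y hym) P hP
        obtain ⟨s, hs, hsV⟩ := unif P1 (hV' P1 hc)
        obtain ⟨c, hc, hcw⟩ := naka_loc (W := HH N (maximalIdeal R) (q + 1) →ₗ[R] E) P1 _ hyP s hs
          (fun w => by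
            obtain ⟨κ', h⟩ := hker (s • w) (by rw [map_smul, hsV])
            exact ⟨κ', by rw [h, algebraMap_smul]⟩)
        exact ⟨c, fun h => hc (hP1 h), hcw w⟩
end claim
end LCx
end part_L7

section part_L8
open CategoryTheory Pointwise IsLocalRing


namespace LCx
set_option linter.unusedSectionVars false

section V
variable {R : Type u} [CommRing R]

lemma baer_ext {A B I : Type u} [AddCommGroup A] [Module R A] [AddCommGroup B] [Module R B]
    [AddCommGroup I] [Module R I] (hI : Module.Baer R I) (f : A →ₗ[R] B) (g : A →ₗ[R] I)
    (h : ∀ a, f a = 0 → g a = 0) : ∃ φ : B →ₗ[R] I, ∀ a, φ (f a) = g a := by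
  let f' := (LinearMap.ker f).liftQ f le_rfl
  have hf : Function.Injective f' := by
    rw [← LinearMap.ker_eq_bot]
    exact Submodule.ker_liftQ_eq_bot _ _ _ le_rfl
  obtain ⟨φ, hφ⟩ := Module.Baer.extension_property hI f' hf ((LinearMap.ker f).liftQ g h)
  exact ⟨φ, fun a => LinearMap.congr_fun hφ (Submodule.Quotient.mk a)⟩

lemma vlem [IsNoetherianRing R] {I : Type u} [AddCommGroup I] [Module R I] (hI : Module.Baer R I)
    (J : Ideal R) (b0 : I) (hb : ∀ r ∈ J, r • b0 = 0) (z : R) (j : ℕ) :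
    ∃ (k : ℕ) (b' : I), (∀ r ∈ J, r • b' = 0) ∧ z ^ (k + j) • b' = z ^ k • b0 := by
  let F : ℕ →o Ideal R := 
    { toFun := fun n => 
        { carrier := {r | r * z ^ n ∈ J}
          add_mem' := fun {a b} ha hb => by
            change (a + b) * z ^ n ∈ J
            rw [add_mul]; exact J.add_mem ha hb
          zero_mem' := by
            change 0 * z ^ n ∈ J
            rw [zero_mul]; exact J.zero_mem
          smul_mem' := fun c a ha => by
            change c * a * z ^ n ∈ J
            rw [mul_assoc]; exact J.mul_mem_left _ ha }
      monotone' := by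
        intro n n' h r hr
        change r * z ^ n' ∈ J
        obtain ⟨k, rfl⟩ := Nat.exists_eq_add_of_le h
        rw [pow_add, ← mul_assoc]
        exact J.mul_mem_right _ hr }
  obtain ⟨k, hk⟩ := monotone_stabilizes_iff_noetherian.mpr (inferInstance : IsNoetherian R R) F
  obtain ⟨φ, hφ⟩ := baer_ext hI ((Submodule.mkQ J) ∘ₗ LinearMap.toSpanSingleton R R (z ^ (k + j)))
    (LinearMap.toSpanSingleton R I (z ^ k • b0)) (by
      intro r hr
      have h1 : r * z ^ (k + j) ∈ J := (Submodule.Quotient.mk_eq_zero J).mp hr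
      have h2 : r ∈ F (k + j) := h1
      rw [← hk (k + j) (by omega)] at h2
      have h3 : r * z ^ k ∈ J := h2
      rw [LinearMap.toSpanSingleton_apply, ← mul_smul]
      exact hb _ h3)
  refine ⟨k, φ (Submodule.Quotient.mk 1), fun r hr => ?_, ?_⟩
  · rw [← map_smul, ← Submodule.Quotient.mk_smul, (Submodule.Quotient.mk_eq_zero J).mpr
      (by simpa using hr), map_zero]
  · have := hφ 1
    rw [LinearMap.toSpanSingleton_apply, one_smul] at this
    rw [← this, ← map_smul, ← Submodule.Quotient.mk_smul]
    simp

lemma tors_sup {A : Type u} [AddCommGroup A] [Module R A] {a : Ideal R} {z : R} {c : A} (l n : ℕ)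
    (h1 : ∀ r ∈ a ^ l, r • c = 0) (h2 : z ^ n • c = 0) : c ∈ tors (a ⊔ Ideal.span {z}) A := by
  refine ⟨l + n, fun r hr => ?_⟩
  have h3 := Ideal.sup_pow_add_le_pow_sup_pow hr
  rw [Ideal.span_singleton_pow] at h3
  obtain ⟨α, hα, β, hβ, rfl⟩ := Submodule.mem_sup.mp h3
  obtain ⟨γ, rfl⟩ := Ideal.mem_span_singleton'.mp hβ
  rw [add_smul, h1 α hα, mul_smul, h2, smul_zero, zero_add]

variable [IsNoetherianRing R] (N : Type u) [AddCommGroup N] [Module R N]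

lemma step_surj (a : Ideal R) (z : R) (d : ℕ) (h : ∀ v : HH N a d, ∃ n, z ^ n • v = 0) :
    Function.Surjective (hcmp N (le_sup_left : a ≤ a ⊔ Ideal.span {z}) d) := by
  intro v
  obtain ⟨c, hc, ⟨l, hl⟩, rfl⟩ := cl_surj N a d v
  obtain ⟨n, hn⟩ := h (cl N a d c)
  rw [← cl_smul N hc ⟨l, hl⟩] at hn
  have hd : dJ N d (z ^ n • c) = 0 := by rw [map_smul, hc, smul_zero]
  have ht : z ^ n • c ∈ tors a (JJ (R := R) N d) := Submodule.smul_mem _ _ ⟨l, hl⟩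
  cases d with
  | zero =>
    have h0 := cl_eq_zero_zero N hd ht hn
    exact ⟨cl N _ 0 c, cl_cmp N _ hc (tors_sup l n hl h0)⟩
  | succ d =>
    obtain ⟨e, ⟨l', hl'⟩, he⟩ := (cl_eq_zero_succ N hd ht).mp hn
    obtain ⟨k, e', he', hz⟩ := vlem (baer_JJ N d) (a ^ l') e hl' z n
    have hde : dJ N (d + 1) (dJ N d e') = 0 := dJ_dJ N d e'
    have hta : dJ N d e' ∈ tors a (JJ (R := R) N (d + 1)) := tors_map _ ⟨l', he'⟩
    have hc' : dJ N (d + 1) (c - dJ N d e') = 0 := by rw [map_sub, hc, hde, sub_zero]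
    obtain ⟨l2, hl2⟩ := Submodule.sub_mem _ (⟨l, hl⟩ : c ∈ tors a (JJ (R := R) N (d + 1))) hta
    have hz' : z ^ (k + n) • (c - dJ N d e') = 0 := by
      rw [smul_sub, ← map_smul, hz, map_smul, he, ← mul_smul, pow_add, sub_self]
    refine ⟨cl N _ (d + 1) (c - dJ N d e'), ?_⟩
    rw [cl_cmp N _ hc' (tors_sup l2 (k + n) hl2 hz'), cl_sub N hc hde ⟨l, hl⟩ hta,
      (cl_eq_zero_succ N hde hta).mpr ⟨e', ⟨l', he'⟩, rfl⟩, sub_zero]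

lemma step_ker (a : Ideal R) (z : R) (d : ℕ) (v : HH N (a ⊔ Ideal.span {z}) d)
    (hv : hcmp N (le_sup_left : a ≤ a ⊔ Ideal.span {z}) d v = 0) :
    ∃ l, ∀ j, ∃ w : HH N (a ⊔ Ideal.span {z}) d, z ^ j • w = v ∧ ∀ r ∈ a ^ l, r • w = 0 := by
  obtain ⟨c, hc, ht, rfl⟩ := cl_surj N _ d v
  have hta := tors_mono (le_sup_left : a ≤ a ⊔ Ideal.span {z}) ht
  rw [cl_cmp N _ hc ht] at hv
  cases d with
  | zero =>
    have h0 := cl_eq_zero_zero N hc hta hv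
    refine ⟨0, fun j => ⟨0, ?_, fun r _ => smul_zero _⟩⟩
    rw [h0, cl_zero, smul_zero]
  | succ d =>
    obtain ⟨b0, ⟨l, hl⟩, rfl⟩ := (cl_eq_zero_succ N hc hta).mp hv
    refine ⟨l, fun j => ?_⟩
    obtain ⟨k, b', hb', hz⟩ := vlem (baer_JJ N d) (a ^ l) b0 hl z j
    obtain ⟨n, hn⟩ := ht
    have hzn : z ^ n • dJ N d b0 = 0 :=
      hn _ (Ideal.pow_mem_pow (Ideal.mem_sup_right (Ideal.mem_span_singleton_self z)) n)
    have hd : dJ N (d + 1) (dJ N d b') = 0 := dJ_dJ N d b'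
    have ha' : ∀ r ∈ a ^ l, r • dJ N d b' = 0 := fun r hr => by
      rw [← map_smul, hb' r hr, map_zero]
    have hT : dJ N d b' ∈ tors (a ⊔ Ideal.span {z}) (JJ (R := R) N (d + 1)) := by
      refine tors_sup l (n + (k + j)) ha' ?_
      rw [pow_add, mul_smul, ← map_smul, hz, map_smul, smul_comm, hzn, smul_zero]
    refine ⟨cl N _ (d + 1) (dJ N d b'), ?_, fun r hr => ?_⟩
    · rw [← sub_eq_zero, ← cl_smul N hd hT, ← cl_sub N (by rw [map_smul, hd, smul_zero]) hc
        (Submodule.smul_mem _ _ hT) ⟨n, hn⟩]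
      rw [cl_eq_zero_succ N (by rw [map_sub, map_smul, hd, smul_zero, hc, sub_zero])
        (Submodule.sub_mem _ (Submodule.smul_mem _ _ hT) ⟨n, hn⟩)]
      refine ⟨z ^ j • b' - b0, tors_sup l k (fun r hr => ?_) ?_, ?_⟩
      · rw [smul_sub, smul_comm, hb' r hr, hl r hr, smul_zero, sub_zero]
      · rw [smul_sub, ← mul_smul, ← pow_add, hz, sub_self]
      · rw [map_sub, map_smul]
    · rw [← cl_smul N hd hT, ha' r hr, cl_zero]
end V

section desc
variable {R C E : Type u} [CommRing R] [IsLocalRing R] [CommRing C] [IsLocalRing C]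
    [Algebra R C] [AddCommGroup E] [Module R E] [Module C E] [IsScalarTower R C E]
    [IsNoetherianRing R] [IsNoetherianRing C]

lemma cmp_surj (N : Type u) [AddCommGroup N] [Module R N] [Module.Finite R N] (d : ℕ)
    (hN : Module.supportDim R N ≤ (d : WithBot ℕ∞)) (b : Ideal R) (hb : b ≤ maximalIdeal R) :
    Function.Surjective (hcmp N hb d) := by
  induction b using WellFoundedGT.induction with
  | ind b ih =>
    by_cases h : b = maximalIdeal R
    · subst h
      intro v
      exact ⟨v, hcmp_refl N _ _ _⟩
    · obtain ⟨z, hz, hzb⟩ := Set.not_subset.mp (fun h' => h (le_antisymm hb h'))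
      have hle : b ⊔ Ideal.span {z} ≤ maximalIdeal R := by
        rw [sup_le_iff, Ideal.span_singleton_le_iff_mem]
        exact ⟨hb, hz⟩
      have hlt : b < b ⊔ Ideal.span {z} := lt_of_le_of_ne le_sup_left (fun h => hzb (by
        rw [h]; exact Ideal.mem_sup_right (Ideal.mem_span_singleton_self z)))
      intro v
      obtain ⟨v1, rfl⟩ := step_surj N b z d (fun v => by
        obtain ⟨t, ht⟩ := (groth b d N hN).2 v
        exact ⟨t, ht _ (Ideal.pow_mem_pow hz t)⟩) v
      obtain ⟨v2, rfl⟩ := ih _ hlt hle v1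
      exact ⟨v2, (hcmp_hcmp ..).symm⟩

lemma map_kill (J : Ideal R) (e : E) (h : ∀ r ∈ J, r • e = 0) (α : C)
    (hα : α ∈ Ideal.map (algebraMap R C) J) : α • e = 0 := by
  induction hα using Submodule.span_induction with
  | mem x hx =>
    obtain ⟨r, hr, rfl⟩ := hx
    rw [algebraMap_smul]; exact h r hr
  | zero => simp
  | add x y _ _ hx hy => rw [add_smul, hx, hy, add_zero]
  | smul a x _ hx => rw [smul_assoc, hx, smul_zero]

lemma Setup.descend (S : Setup R C E) (N : Type u) [AddCommGroup N] [Module R N] [Module.Finite R N]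
    (d : ℕ) (hN : Module.supportDim R N ≤ (d : WithBot ℕ∞)) (a : Ideal R)
    (ha : a ≤ maximalIdeal R) (g : HH N (maximalIdeal R) d →ₗ[R] E)
    (hg : ∀ z ∈ maximalIdeal R, ∀ l : ℕ, ∃ j : ℕ, ∃ α ∈ Ideal.map (algebraMap R C) (a ^ l),
      ∃ p : C, p • g = 0 ∧ algebraMap R C (z ^ j) = α + p) :
    ∃ g' : HH N a d →ₗ[R] E, ∀ h, g' (hcmp N ha d h) = g h := by
  suffices H : ∀ b, a ≤ b → ∀ hb : b ≤ maximalIdeal R,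
      ∃ g' : HH N b d →ₗ[R] E, ∀ h, g' (hcmp N hb d h) = g h from H a le_rfl ha
  intro b hab hb
  induction b using WellFoundedGT.induction with
  | ind b ih =>
    by_cases h : b = maximalIdeal R
    · subst h
      exact ⟨g, fun h => by rw [hcmp_refl]⟩
    · obtain ⟨z, hz, hzb⟩ := Set.not_subset.mp (fun h' => h (le_antisymm hb h'))
      have hle : b ⊔ Ideal.span {z} ≤ maximalIdeal R := by
        rw [sup_le_iff, Ideal.span_singleton_le_iff_mem]
        exact ⟨hb, hz⟩
      have hlt : b < b ⊔ Ideal.span {z} := lt_of_le_of_ne le_sup_left (fun h => hzb (by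
        rw [h]; exact Ideal.mem_sup_right (Ideal.mem_span_singleton_self z)))
      obtain ⟨g1, hg1⟩ := ih _ hlt (hab.trans le_sup_left) hle
      obtain ⟨g', hg'⟩ := S.ext_of_ker (hcmp N (le_sup_left : b ≤ b ⊔ Ideal.span {z}) d) g1 (by
        intro v hv
        obtain ⟨l, hl⟩ := step_ker N b z d v hv
        obtain ⟨j, α, hα, p, hp, he⟩ := hg z hz l
        obtain ⟨w, hw1, hw2⟩ := hl j
        have h1 : p • g1 w = 0 := by
          obtain ⟨w', rfl⟩ := cmp_surj N d hN _ hle w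
          rw [hg1]
          exact LinearMap.congr_fun hp w'
        rw [← hw1, map_smul, ← algebraMap_smul C, he, add_smul, h1, add_zero]
        refine map_kill (a ^ l) _ (fun r hr => ?_) α hα
        rw [← map_smul, hw2 r (Ideal.pow_right_mono hab l hr), map_zero])
      refine ⟨g', fun h => ?_⟩
      rw [← hg1, ← hg', hcmp_hcmp]
end desc
end LCx
end part_L8

section part_L9
open CategoryTheory Pointwise IsLocalRing


namespace LCx
set_option linter.unusedSectionVars false

section U
variable {R C E : Type u} [CommRing R] [IsLocalRing R] [CommRing C] [IsLocalRing C]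
    [Algebra R C] [AddCommGroup E] [Module R E] [Module C E] [IsScalarTower R C E]
    [IsNoetherianRing R] [IsNoetherianRing C]

/-- elements vanishing locally at primes of coheight at least `d` -/
def small (d : ℕ) (W : Type u) [AddCommGroup W] [Module C W] : Submodule C W where
  carrier := {w | ∀ P : PrimeSpectrum C, coh d P → ∃ s ∉ P.asIdeal, s • w = 0}
  add_mem' := by
    intro w w' h h' P hP
    obtain ⟨s, hs, hw⟩ := h P hP
    obtain ⟨s', hs', hw'⟩ := h' P hP
    refine ⟨s * s', fun h => (P.2.mem_or_mem h).elim hs hs', ?_⟩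
    rw [smul_add, mul_comm, mul_smul, hw, mul_comm, mul_smul, hw', smul_zero, smul_zero, add_zero]
  zero_mem' := fun P _ => ⟨1, P.1.one_notMem, smul_zero _⟩
  smul_mem' := by
    intro c w h P hP
    obtain ⟨s, hs, hw⟩ := h P hP
    exact ⟨s, hs, by rw [smul_comm, hw, smul_zero]⟩

lemma mem_small {d : ℕ} {W : Type u} [AddCommGroup W] [Module C W] {w : W} :
    w ∈ small (C := C) d W ↔ ∀ P : PrimeSpectrum C, coh d P → ∃ s ∉ P.asIdeal, s • w = 0 := Iff.rfl

lemma small_map {d : ℕ} {W W' : Type u} [AddCommGroup W] [Module C W] [AddCommGroup W']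
    [Module C W'] (f : W →ₗ[C] W') {w : W} (h : w ∈ small (C := C) d W) :
    f w ∈ small (C := C) d W' := by
  intro P hP
  obtain ⟨s, hs, hw⟩ := h P hP
  exact ⟨s, hs, by rw [← map_smul, hw, map_zero]⟩

lemma small_of_inj {d : ℕ} {W W' : Type u} [AddCommGroup W] [Module C W] [AddCommGroup W']
    [Module C W'] (f : W →ₗ[C] W') (hf : ∀ w, f w = 0 → w = 0) {w : W}
    (h : f w ∈ small (C := C) d W') : w ∈ small (C := C) d W := by
  intro P hP
  obtain ⟨s, hs, hw⟩ := h P hP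
  exact ⟨s, hs, hf _ (by rw [map_smul, hw])⟩

lemma small_zero {W : Type u} [AddCommGroup W] [Module C W] {w : W}
    (h : w ∈ small (C := C) 0 W) : w = 0 := by
  obtain ⟨s, hs, hw⟩ := h (closedPoint C) trivial
  have hu : IsUnit s := by
    by_contra hn
    exact hs ((mem_maximalIdeal s).mpr hn)
  exact (hu.smul_eq_zero).mp hw

lemma Setup.closed_of_le (S : Setup R C E) {H : Type u} [AddCommGroup H] [Module R H]
    (U : Submodule C (H →ₗ[R] E)) (Q : Ideal C) (hQ : Q.IsPrime)
    (hU : Module.annihilator C U ≤ Q) (hm : maximalIdeal R ≤ Q.comap (algebraMap R C)) :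
    Q = maximalIdeal C := by
  refine le_antisymm (IsLocalRing.le_maximalIdeal hQ.ne_top) (fun c hc => ?_)
  obtain ⟨c', hc', he⟩ := S.maxi c hc
  have h1 : c' ∈ Q := Ideal.map_le_iff_le_comap.mpr hm hc'
  have h2 : c - c' ∈ Q := hU (by
    rw [Module.mem_annihilator]
    rintro ⟨κ, hκ⟩
    ext h
    change (c - c') • κ h = 0
    rw [sub_smul, he, sub_self])
  have := Q.add_mem h2 h1
  rwa [sub_add_cancel] at this

theorem Setup.lemU (S : Setup R C E) (d : ℕ) :
    ∀ (N : Type u) [AddCommGroup N] [Module R N] [Module.Finite R N],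
      Module.supportDim R N ≤ (d : WithBot ℕ∞) →
      ∀ κ ∈ small (C := C) d (HH N (maximalIdeal R) d →ₗ[R] E), κ = 0 := by
  classical
  induction d with
  | zero =>
    intro N _ _ _ _ κ hκ
    exact small_zero hκ
  | succ d ih =>
    intro N _ _ hN
    induction ‹Module.Finite R N› using IsNoetherianRing.induction_on_isQuotientEquivQuotientPrime
      with
    | subsingleton N =>
      intro _ κ _
      ext h
      rw [HH_subsingleton _ _ h, map_zero, map_zero]
    | exact N₁ N₂ N₃ f g hf hg hfg h₁ h₃ =>
      intro hd κ hκ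
      have hd1 := (Module.supportDim_le_of_injective f hf).trans hd
      have h1 := h₁ hd1 _ (small_map (pb C E (hmap (maximalIdeal R) (d + 1) f)) hκ)
      obtain ⟨κ', rfl⟩ := (S.pb_exact _ _ (hmap_exact hf hg hfg (maximalIdeal R) (d + 1)) κ).mp h1
      obtain ⟨δ, hδ, -⟩ := exists_delta hf hg hfg (maximalIdeal R) (d + 1)
      have hsurj : ∀ z, ∃ y, hmap (maximalIdeal R) (d + 1) g y = z := fun z =>
        (hδ z).mp ((groth (maximalIdeal R) (d + 1) N₁ hd1).1 _ (Nat.lt_succ_self _) _)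
      have h3 := h₃ ((Module.supportDim_le_of_surjective g hg).trans hd) κ'
        (small_of_inj (pb C E (hmap (maximalIdeal R) (d + 1) g)) (by
          intro w hw
          ext z
          obtain ⟨y, rfl⟩ := hsurj z
          exact LinearMap.congr_fun hw y) hκ)
      rw [h3, map_zero]
    | quotient N p e =>
      intro hd
      have := p.2
      have hfin : Module.Finite R N := Module.Finite.equiv e.symm
      by_cases hp : maximalIdeal R ≤ p.1
      · intro κ _
        ext h
        rw [HH_tors _ d N (fun n => ⟨1, fun r hr =>
          smul_zero_of_equiv e (hp (by simpa using hr)) n⟩) h, map_zero, map_zero]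
      · let U := small (C := C) (d + 1) (HH N (maximalIdeal R) (d + 1) →ₗ[R] E)
        have hDfin := (S.claim (d + 1) N).1
        have hUfg : U.FG := IsNoetherian.noetherian U
        have hUfin : Module.Finite C U := Module.Finite.iff_fg.mpr hUfg
        let A := Module.annihilator C U
        have hA : ∀ P : PrimeSpectrum C, coh (d + 1) P → ¬ A ≤ P.asIdeal := by
          intro P hP hle
          obtain ⟨s, hs, h⟩ := unif (W := U) P (fun w => by
            obtain ⟨s, hs, h⟩ := w.2 P hP
            exact ⟨s, hs, Subtype.ext h⟩)
          exact hs (hle (Module.mem_annihilator.mpr h))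
        obtain ⟨s, hsm, hsp, hsQ⟩ : ∃ s ∈ maximalIdeal R, s ∉ p.1 ∧
            ∀ Q ∈ A.minimalPrimes, Q ≠ maximalIdeal C → algebraMap R C s ∉ Q := by
          by_contra! hcon
          have hAf := A.finite_minimalPrimes_of_isNoetherianRing
          let F : Finset (Ideal R) := insert p.1
            (((hAf.toFinset).filter (fun Q => Q ≠ maximalIdeal C)).image
              (fun Q => Q.comap (algebraMap R C)))
          have hsub : (maximalIdeal R : Set R) ⊆ ⋃ K ∈ (F : Set (Ideal R)), ((id K : Ideal R) : Set R) := by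
            intro s hs
            by_cases hsp : s ∈ p.1
            · refine Set.mem_biUnion (x := p.1) ?_ hsp
              simp [F]
            · obtain ⟨Q, hQ, hQm, hsQ⟩ := hcon s hs hsp
              refine Set.mem_biUnion (x := Q.comap (algebraMap R C)) ?_ hsQ
              simp only [F, Finset.coe_insert, Finset.coe_image]
              refine Or.inr ⟨Q, ?_, rfl⟩
              exact Finset.mem_coe.mpr (Finset.mem_filter.mpr ⟨hAf.mem_toFinset.mpr hQ, hQm⟩)
          obtain ⟨K, hK, hmK⟩ := (Ideal.subset_union_prime ⊥ ⊥ (by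
            rintro K hK - -
            rcases Finset.mem_insert.mp hK with rfl | hK
            · exact p.2
            · obtain ⟨Q, hQ, rfl⟩ := Finset.mem_image.mp hK
              have hQ' := (Finset.mem_filter.mp hQ).1
              have : Q.IsPrime := (hAf.mem_toFinset.mp hQ').1.1
              exact Ideal.comap_isPrime _ _)).mp hsub
          rcases Finset.mem_insert.mp hK with rfl | hK
          · exact hp hmK
          · obtain ⟨Q, hQ, rfl⟩ := Finset.mem_image.mp hK
            obtain ⟨hQ', hQm⟩ := Finset.mem_filter.mp hQ
            have hQ'' := (hAf.mem_toFinset.mp hQ').1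
            exact hQm (S.closed_of_le U Q hQ''.1 hQ''.2 hmK)
        have hreg := smul_regular_of_equiv e hsp
        have hinj : ∀ κ : HH N (maximalIdeal R) (d + 1) →ₗ[R] E, algebraMap R C s • κ = 0 → κ = 0 := by
          intro κ hκ
          have hf : Function.Injective (s • LinearMap.id : N →ₗ[R] N) := by
            intro a c h; exact hreg h
          have hex : Function.Exact (s • LinearMap.id : N →ₗ[R] N)
              (Submodule.mkQ (s • (⊤ : Submodule R N))) := by
            intro n
            rw [Submodule.mkQ_apply, Submodule.Quotient.mk_eq_zero,
              Submodule.mem_smul_pointwise_iff_exists]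
            simp
          ext h
          obtain ⟨h', rfl⟩ := (hmap_exact hf (Submodule.mkQ_surjective _) hex (maximalIdeal R)
            (d + 1) h).mp ((groth (maximalIdeal R) d (QuotSMulTop s N) (dim_quot_lt hreg hd)).1
              (d + 1) (Nat.lt_succ_self d) _)
          rw [hmap_smul_id, map_smul, ← algebraMap_smul C]
          exact LinearMap.congr_fun hκ h'
        rcases Nat.eq_zero_or_pos d with hd0 | hd0
        · -- degree one
          intro κ hκ
          have hrad : algebraMap R C s ∈ A.radical := by
            rw [Ideal.radical_eq_sInf, Submodule.mem_sInf]
            rintro Q ⟨hQA, hQ⟩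
            by_cases hQm : (⟨Q, hQ⟩ : PrimeSpectrum C) = closedPoint C
            · have : Q = maximalIdeal C := congrArg PrimeSpectrum.asIdeal hQm
              rw [this]
              exact S.loc s hsm
            · refine absurd hQA (hA ⟨Q, hQ⟩ ⟨closedPoint C, lt_of_le_of_ne (le_closed _) hQm, ?_⟩)
              rw [hd0]; trivial
          obtain ⟨n, hn⟩ := hrad
          have h1 := Module.mem_annihilator.mp hn ⟨κ, hκ⟩
          exact eq_zero_of_pow_torsion hinj n κ (congrArg Subtype.val h1)
        · obtain ⟨δ, h1, h2, -⟩ := exists_delta_y hreg (maximalIdeal R) d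
          have hU : ∀ κ ∈ U, ∃ κ' ∈ U, κ = algebraMap R C s • κ' := by
            intro κ hκ
            have hz : pb C E δ κ = 0 := by
              apply ih (QuotSMulTop s N) (dim_quot_lt hreg hd)
              intro P hP
              by_contra! hcon
              have hle : A ≤ P.asIdeal := by
                intro c hc
                by_contra hcP
                refine hcon c hcP ?_
                rw [← map_smul]
                have := congrArg Subtype.val (Module.mem_annihilator.mp hc ⟨κ, hκ⟩)
                rw [show c • κ = 0 from this, map_zero]
              have hsP : algebraMap R C s ∈ P.asIdeal := by
                by_contra hsP
                refine hcon _ hsP ?_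
                ext z
                rw [LinearMap.smul_apply, pb_apply, algebraMap_smul, ← map_smul, h2, map_zero]
                rfl
              have hPp := P.2
              obtain ⟨Q, hQ, hQP⟩ := Ideal.exists_minimalPrimes_le hle
              by_cases hQm : Q = maximalIdeal C
              · have hPm : P = closedPoint C := le_antisymm (le_closed P) (by
                  rw [hQm] at hQP; exact hQP)
                obtain ⟨d', rfl⟩ := Nat.exists_eq_succ_of_ne_zero hd0.ne'
                obtain ⟨Q', hQ', -⟩ := hP
                exact absurd (lt_of_lt_of_le hQ' (le_closed Q')) (by rw [hPm]; exact lt_irrefl _)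
              · have hsQ' := hsQ Q hQ hQm
                let Q1 : PrimeSpectrum C := ⟨Q, hQ.1.1⟩
                have hlt : Q1 < P := lt_of_le_of_ne hQP (fun h => hsQ' (by
                  rw [← h] at hsP; exact hsP))
                exact hA Q1 ⟨P, hlt, hP⟩ hQ.1.2
            obtain ⟨κ', hκ'⟩ := S.mem_smul_of_kill_one s κ (by
              intro h hh
              obtain ⟨z, rfl⟩ := h1 h hh
              exact LinearMap.congr_fun hz z)
            have hκ2 : κ = algebraMap R C s • κ' := by rw [hκ', algebraMap_smul]
            refine ⟨κ', ?_, hκ2⟩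
            exact small_of_inj (algebraMap R C s • LinearMap.id) hinj (by
              change algebraMap R C s • κ' ∈ U
              rw [← hκ2]; exact hκ)
          have hbot : U = ⊥ := Submodule.eq_bot_of_le_smul_of_le_jacobson_bot (maximalIdeal C) U hUfg
            (by
              intro κ hκ
              obtain ⟨κ', hκ', rfl⟩ := hU κ hκ
              exact Submodule.smul_mem_smul (S.loc s hsm) hκ')
            (IsLocalRing.maximalIdeal_le_jacobson _)
          intro κ hκ
          have : κ ∈ U := hκ
          rw [hbot] at this
          exact this
end U
end LCx
end part_L9

section part_L10
open CategoryTheory Pointwise IsLocalRing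


namespace LCx
set_option linter.unusedSectionVars false

section act
variable {R : Type u} [CommRing R]

lemma cauchy_le {m : Ideal R} {ρ : ℕ → R} (hρ : ∀ t, ρ (t + 1) - ρ t ∈ m ^ t) {t t' : ℕ}
    (h : t ≤ t') : ρ t' - ρ t ∈ m ^ t := by
  induction h with
  | refl => simp
  | @step k hk ih =>
    have := Ideal.add_mem _ (Ideal.pow_le_pow_right hk (hρ k)) ih
    rwa [sub_add_sub_cancel] at this

lemma cauchy_smul {m : Ideal R} {ρ : ℕ → R} (hρ : ∀ t, ρ (t + 1) - ρ t ∈ m ^ t)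
    {A : Type u} [AddCommGroup A] [Module R A] {t t' : ℕ} {a : A} (h : ∀ r ∈ m ^ t, r • a = 0)
    (h' : ∀ r ∈ m ^ t', r • a = 0) : ρ t • a = ρ t' • a := by
  rcases le_total t t' with hl | hl
  · have := h _ (cauchy_le hρ hl)
    rw [sub_smul, sub_eq_zero] at this
    exact this.symm
  · have := h' _ (cauchy_le hρ hl)
    rw [sub_smul, sub_eq_zero] at this
    exact this

lemma exists_act {m : Ideal R} {ρ : ℕ → R} (hρ : ∀ t, ρ (t + 1) - ρ t ∈ m ^ t)
    {A : Type u} [AddCommGroup A] [Module R A] (hA : ∀ a : A, a ∈ tors m A) :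
    ∃ φ : A →ₗ[R] A, ∀ t a, (∀ r ∈ m ^ t, r • a = 0) → φ a = ρ t • a := by
  choose T hT using hA
  refine ⟨{ toFun := fun a => ρ (T a) • a
            map_add' := ?_
            map_smul' := ?_ }, fun t a h => cauchy_smul hρ (hT a) h⟩
  · intro a b
    have h1 : ∀ r ∈ m ^ (max (T a) (T b)), r • a = 0 := fun r hr =>
      hT a r (Ideal.pow_le_pow_right (le_max_left _ _) hr)
    have h2 : ∀ r ∈ m ^ (max (T a) (T b)), r • b = 0 := fun r hr =>
      hT b r (Ideal.pow_le_pow_right (le_max_right _ _) hr)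
    rw [cauchy_smul hρ (hT a) h1, cauchy_smul hρ (hT b) h2, ← smul_add]
    exact cauchy_smul hρ (hT _) (fun r hr => by rw [smul_add, h1 r hr, h2 r hr, add_zero])
  · intro c a
    change ρ (T (c • a)) • c • a = c • ρ (T a) • a
    rw [smul_comm c]
    exact cauchy_smul hρ (hT _) (fun r hr => by rw [smul_comm, hT a r hr, smul_zero])

lemma act_nat {m : Ideal R} {ρ : ℕ → R} 
    {A B : Type u} [AddCommGroup A] [Module R A] [AddCommGroup B] [Module R B]
    (hA : ∀ a : A, a ∈ tors m A) {φ : A →ₗ[R] A} {φ' : B →ₗ[R] B}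
    (hφ : ∀ t a, (∀ r ∈ m ^ t, r • a = 0) → φ a = ρ t • a)
    (hφ' : ∀ t a, (∀ r ∈ m ^ t, r • a = 0) → φ' a = ρ t • a) (f : A →ₗ[R] B) (a : A) :
    f (φ a) = φ' (f a) := by
  obtain ⟨t, ht⟩ := hA a
  rw [hφ t a ht, hφ' t (f a) (fun r hr => by rw [← map_smul, ht r hr, map_zero]), map_smul]

end act

section cx
variable {R : Type u} [CommRing R] [IsNoetherianRing R] 

/-- boundaries of a complex -/
def bd (G : ℕ → Type u) [∀ i, AddCommGroup (G i)] [∀ i, Module R (G i)]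
    (D : ∀ i, G i →ₗ[R] G (i + 1)) : ∀ i, G i → Prop
  | 0, x => x = 0
  | i + 1, x => ∃ e, D i e = x

lemma exists_theta (G : ℕ → Type u) [∀ i, AddCommGroup (G i)] [∀ i, Module R (G i)]
    (D : ∀ i, G i →ₗ[R] G (i + 1)) (hG : ∀ i, Module.Baer R (G i))
    (hD : ∀ i x, D (i + 1) (D i x) = 0)
    (φ : ∀ i, G i →ₗ[R] G i) (hφ : ∀ i x, D i (φ i x) = φ (i + 1) (D i x)) (d : ℕ)
    (hk : ∀ i < d, ∀ x, D i x = 0 → bd G D i (φ i x)) (i : ℕ) (hi : i ≤ d) :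
    ∃ θ : G i →ₗ[R] G i, (∀ x, bd G D i x → θ x = 0) ∧ ∀ x, bd G D i (θ x - (φ i ^ i) x) := by
  have hpow : ∀ n i x, D i ((φ i ^ n) x) = (φ (i + 1) ^ n) (D i x) := by
    intro n i x
    induction n with
    | zero => rfl
    | succ n ih => rw [pow_succ', pow_succ', Module.End.mul_apply, Module.End.mul_apply, hφ, ih]
  have hbd : ∀ i x, bd G D i x → D i x = 0 := by
    intro i x h
    cases i with
    | zero => rw [show x = 0 from h, map_zero]
    | succ i => obtain ⟨e, rfl⟩ := h; exact hD i e
  induction i with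
  | zero =>
    refine ⟨LinearMap.id, fun x hx => hx, fun x => ?_⟩
    change x - x = 0
    rw [sub_self]
  | succ i ih =>
    obtain ⟨θ, h1, h2⟩ := ih (by omega)
    obtain ⟨τ, hτ⟩ := baer_ext (hG i) (D i) (θ ∘ₗ φ i) (fun x hx => h1 _ (hk i (by omega) x hx))
    refine ⟨φ (i + 1) ^ (i + 1) - D i ∘ₗ τ, ?_, fun x => ⟨- τ x, ?_⟩⟩
    · rintro _ ⟨e, rfl⟩
      have h3 := hbd i _ (h2 (φ i e))
      rw [map_sub, sub_eq_zero, hpow, hφ] at h3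
      rw [LinearMap.sub_apply, LinearMap.comp_apply, hτ, LinearMap.comp_apply, h3, pow_succ,
        Module.End.mul_apply, sub_self]
    · rw [LinearMap.sub_apply, LinearMap.comp_apply, map_neg]
      abel
end cx

section krull
variable {C : Type u} [CommRing C] [IsNoetherianRing C]
lemma krull_loc (P : PrimeSpectrum C) {W : Type u} [AddCommGroup W] [Module C W]
    [Module.Finite C W] (w : W)
    (h : ∀ t : ℕ, ∃ v ∉ P.asIdeal, v • w ∈ P.asIdeal ^ t • (⊤ : Submodule C W)) :
    ∃ v ∉ P.asIdeal, v • w = 0 := by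
  have := P.2
  let L := Localization.AtPrime P.asIdeal
  let WL := LocalizedModule P.asIdeal.primeCompl W
  let f : W →ₗ[C] WL := LocalizedModule.mkLinearMap P.asIdeal.primeCompl W
  have hfin : Module.Finite L WL := Module.Finite.of_isLocalizedModule P.asIdeal.primeCompl f
  have hnl : IsNoetherianRing L := IsLocalization.isNoetherianRing P.asIdeal.primeCompl L inferInstance
  have h0 : f w = 0 := by
    have h1 : f w ∈ (⨅ t : ℕ, maximalIdeal L ^ t • (⊤ : Submodule L WL)) := by
      rw [Submodule.mem_iInf]
      intro t
      obtain ⟨v, hv, hvw⟩ := h t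
      have h2 : ∀ x ∈ P.asIdeal ^ t • (⊤ : Submodule C W),
          f x ∈ maximalIdeal L ^ t • (⊤ : Submodule L WL) := by
        intro x hx
        induction hx using Submodule.smul_induction_on' with
        | smul c hc y _ =>
          rw [map_smul, ← algebraMap_smul L c (f y)]
          refine Submodule.smul_mem_smul ?_ trivial
          have := Ideal.mem_map_of_mem (algebraMap C L) hc
          rw [Ideal.map_pow, Localization.AtPrime.map_eq_maximalIdeal] at this
          exact this
        | add x _ y _ hx hy => rw [map_add]; exact Submodule.add_mem _ hx hy
      have h3 := h2 _ hvw
      rw [map_smul, ← algebraMap_smul L v (f w)] at h3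
      have hu : IsUnit (algebraMap C L v) :=
        IsLocalization.map_units L (⟨v, hv⟩ : P.asIdeal.primeCompl)
      obtain ⟨u, hu⟩ := hu
      rw [← hu] at h3
      have := Submodule.smul_mem _ (↑u⁻¹ : L) h3
      rwa [← mul_smul, Units.inv_mul, one_smul] at this
    rw [Ideal.iInf_pow_smul_eq_bot_of_isLocalRing _ (IsLocalRing.maximalIdeal.isMaximal L).ne_top] at h1
    exact h1
  obtain ⟨⟨v, hv⟩, hvw⟩ := (IsLocalizedModule.eq_zero_iff P.asIdeal.primeCompl f).mp h0
  exact ⟨v, hv, hvw⟩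
end krull

section case1
variable {R C E : Type u} [CommRing R] [IsLocalRing R] [CommRing C] [IsLocalRing C]
    [Algebra R C] [AddCommGroup E] [Module R E] [Module C E] [IsScalarTower R C E]
    [IsNoetherianRing R] [IsNoetherianRing C]

lemma Setup.exists_unif (S : Setup R C E) (N : Type u) [AddCommGroup N] [Module R N]
    [Module.Finite R N] (d : ℕ) (P : PrimeSpectrum C) (hP : coh d P) :
    ∃ s ∉ P.asIdeal, ∀ q < d, ∀ w : HH N (maximalIdeal R) q →ₗ[R] E, s • w = 0 := by
  classical
  have h : ∀ q : ℕ, ∃ s ∉ P.asIdeal, q < d → ∀ w : HH N (maximalIdeal R) q →ₗ[R] E, s • w = 0 := by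
    intro q
    by_cases hq : q < d
    · have := (S.claim q N).1
      obtain ⟨s, hs, h⟩ := unif P ((S.claim q N).2 P (coh_mono hq hP))
      exact ⟨s, hs, fun _ => h⟩
    · exact ⟨1, P.1.one_notMem, fun h => absurd h hq⟩
  choose σ h1 h2 using h
  refine ⟨∏ q ∈ Finset.range d, σ q, fun hs => ?_, fun q hq w => ?_⟩
  · obtain ⟨w, _, hw⟩ := (P.2.prod_mem_iff).mp hs
    exact h1 w hw
  · rw [← Finset.prod_erase_mul _ _ (Finset.mem_range.mpr hq), mul_smul, h2 q hq, smul_zero]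

theorem Setup.hlvt (S : Setup R C E) (N : Type u) [AddCommGroup N] [Module R N]
    [Module.Finite R N] (d : ℕ) (hN : Module.supportDim R N ≤ (d : WithBot ℕ∞)) (a : Ideal R)
    (ha : a ≤ maximalIdeal R) (P P' : PrimeSpectrum C) (hPP : P ≤ P')
    (haP : Ideal.map (algebraMap R C) a ≤ P'.asIdeal) (hP' : P' ≠ closedPoint C) (hP : coh d P)
    (κ : HH N a d →ₗ[R] E) :
    ∃ s ∉ P.asIdeal, s • pb C E (hcmp N ha d) κ = 0 := by
  obtain ⟨s, hs, hsW⟩ := S.exists_unif N d P hP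
  obtain ⟨ρ, hρ, hρE⟩ := S.rep s
  set m := maximalIdeal R with hm
  let G : ℕ → Type u := fun i => tors m (JJ (R := R) N i)
  let D : ∀ i, G i →ₗ[R] G (i + 1) := fun i =>
    (dJ N i).restrict (p := tors m (JJ (R := R) N i)) (q := tors m (JJ (R := R) N (i + 1)))
      (fun x hx => tors_map _ hx)
  have hG : ∀ i, Module.Baer R (G i) := fun i => baer_tors m (baer_JJ N i)
  have hGt : ∀ i (x : G i), x ∈ tors m (G i) := by
    rintro i ⟨x, t, ht⟩
    exact ⟨t, fun r hr => Subtype.ext (ht r hr)⟩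
  have hDD : ∀ i x, D (i + 1) (D i x) = 0 := fun i x => Subtype.ext (dJ_dJ N i x.1)
  choose φ hφ using fun i => exists_act hρ (hGt i)
  have hker : ∀ i < d, ∀ x, D i x = 0 → bd G D i (φ i x) := by
    intro i hi x hx
    have hx' : dJ N i x.1 = 0 := congrArg Subtype.val hx
    obtain ⟨t, ht⟩ := x.2
    have hφx : φ i x = ρ t • x := hφ i t x (fun r hr => Subtype.ext (ht r hr))
    have hd0 : dJ N i (ρ t • x.1) = 0 := by rw [map_smul, hx', smul_zero]
    have ht0 : ρ t • x.1 ∈ tors m (JJ (R := R) N i) := Submodule.smul_mem _ _ x.2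
    have h0 : cl N m i (ρ t • x.1) = 0 := by
      rw [cl_smul N hx' x.2]
      apply S.cogen
      intro κ
      rw [map_smul, ← hρE t, ← LinearMap.smul_apply, hsW i hi, LinearMap.zero_apply]
      intro r hr
      rw [← map_smul, ← cl_smul N hx' x.2, ht r hr, cl_zero, map_zero]
    rw [hφx]
    cases i with
    | zero => exact Subtype.ext (cl_eq_zero_zero N hd0 ht0 h0)
    | succ i =>
      obtain ⟨e, he, he'⟩ := (cl_eq_zero_succ N hd0 ht0).mp h0
      exact ⟨⟨e, he⟩, Subtype.ext he'⟩
  obtain ⟨θ, hθ1, hθ2⟩ := exists_theta G D hG hDD φ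
    (fun i x => act_nat (hGt i) (hφ i) (hφ (i + 1)) (D i) x) d hker d le_rfl
  -- the class of a boundary is zero
  have hclbd : ∀ x : G d, dJ N d x.1 = 0 → (cl N m d x.1 = 0 ↔ bd G D d x) := by
    intro x hx
    generalize d = d at x hx
    cases d with
    | zero =>
      constructor
      · intro h; exact Subtype.ext (cl_eq_zero_zero N hx x.2 h)
      · intro h
        rw [show x = 0 from h]
        exact cl_zero N m 0
    | succ d =>
      rw [cl_eq_zero_succ N hx x.2]
      constructor
      · rintro ⟨e, he, he'⟩
        exact ⟨⟨e, he⟩, Subtype.ext he'⟩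
      · rintro ⟨e, rfl⟩
        exact ⟨e.1, e.2, rfl⟩
  have hbd0 : ∀ x : G d, bd G D d x → dJ N d x.1 = 0 := by
    intro x h
    generalize d = d at x h
    cases d with
    | zero => rw [show x = 0 from h]; exact map_zero _
    | succ i => obtain ⟨e, rfl⟩ := h; exact dJ_dJ N i e.1
  set K := pb C E (hcmp N ha d) κ with hK
  have hpow : ∀ n (x : G d), dJ N d x.1 = 0 → dJ N d ((φ d ^ n) x).1 = 0 ∧
      K (cl N m d ((φ d ^ n) x).1) = (s ^ n • K) (cl N m d x.1) := by
    intro n x hx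
    induction n with
    | zero => exact ⟨hx, by rw [pow_zero, pow_zero, one_smul]; rfl⟩
    | succ n ih =>
      obtain ⟨ih1, ih2⟩ := ih
      obtain ⟨t, ht⟩ := ((φ d ^ n) x).2
      have h1 : (φ d ^ (n + 1)) x = ρ t • (φ d ^ n) x := by
        rw [pow_succ', Module.End.mul_apply, hφ d t _ (fun r hr => Subtype.ext (ht r hr))]
      have h2 : ((φ d ^ (n + 1)) x).1 = ρ t • ((φ d ^ n) x).1 := congrArg Subtype.val h1
      rw [h2]
      refine ⟨by rw [map_smul, ih1, smul_zero], ?_⟩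
      rw [cl_smul N ih1 ((φ d ^ n) x).2, map_smul, ← hρE t, ih2, pow_succ', mul_smul]
      · rfl
      · intro r hr
        rw [← map_smul, ← cl_smul N ih1 ((φ d ^ n) x).2, ht r hr, cl_zero, map_zero]
  have key : ∀ t : ℕ, ∃ j : ℕ, ∀ h : HH N m d, (∀ r ∈ a ^ t, r • h = 0) →
      ∀ r ∈ m ^ j, r • (s ^ d • K) h = 0 := by
    intro t
    obtain ⟨j, hj⟩ : ∃ j, ∀ r ∈ m ^ j, ∀ α, r • ofX N a d t α = 0 := by
      obtain ⟨g, hg⟩ := (Module.Finite.fg_top : (⊤ : Submodule R (XX N (a ^ t) d)).FG)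
      choose T hT using fun α => (groth a d N hN).2 (ofX N a d t α)
      refine ⟨g.sup T, fun r hr α => ?_⟩
      have hα : α ∈ Submodule.span R (g : Set (XX N (a ^ t) d)) := by rw [hg]; trivial
      induction hα using Submodule.span_induction with
      | mem x hx => exact hT x r (Ideal.pow_le_pow_right (Finset.le_sup hx) hr)
      | zero => simp
      | add x y _ _ hx hy => rw [map_add, smul_add, hx, hy, add_zero]
      | smul c x _ hx => rw [map_smul, smul_comm, hx, smul_zero]
    refine ⟨j, fun h hh r hr => ?_⟩
    obtain ⟨c, hc, hct, rfl⟩ := cl_surj N m d h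
    let x : G d := ⟨c, hct⟩
    have h1 := hθ2 x
    have h2 := hbd0 _ h1
    obtain ⟨h3, h4⟩ := hpow d x hc
    have h5 : dJ N d (θ x).1 = 0 := by
      have : dJ N d ((θ x).1 - ((φ d ^ d) x).1) = 0 := h2
      rw [map_sub, h3, sub_zero] at this
      exact this
    have h6 : cl N m d (θ x).1 = cl N m d ((φ d ^ d) x).1 := by
      rw [← sub_eq_zero, ← cl_sub N h5 h3 (θ x).2 ((φ d ^ d) x).2]
      exact (hclbd _ h2).mpr h1
    have h7 : ∀ r ∈ a ^ t, r • (θ x).1 = 0 := by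
      intro r hr
      have h8 : dJ N d (r • x).1 = 0 := by
        change dJ N d (r • c) = 0
        rw [map_smul, hc, smul_zero]
      have h9 := hθ1 (r • x) ((hclbd _ h8).mp (by
        change cl N m d (r • c) = 0
        rw [cl_smul N hc hct, hh r hr]))
      rw [map_smul] at h9
      exact congrArg Subtype.val h9
    rw [← show _ = (s ^ d • K) (cl N m d c) from h4, ← h6, hK, pb_apply, cl_cmp N ha h5 (θ x).2,
      cl_eq N h5 h7, ← map_smul, hj r hr, map_zero]
  obtain ⟨z, hz, hzP⟩ := exists_not_mem hP'
  obtain ⟨z', hz', hzE⟩ := S.maxi z hz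
  have hDfin := (S.claim d N).1
  obtain ⟨v, hv, hvw⟩ := krull_loc P' (s ^ d • K) (by
    intro t
    obtain ⟨j, hj⟩ := key t
    refine ⟨z ^ j, fun h => hzP (P'.2.mem_of_pow_mem _ h), ?_⟩
    have h1 : ∀ (n : ℕ) (e : E), z ^ n • e = z' ^ n • e := by
      intro n e
      induction n with
      | zero => simp
      | succ n ih => rw [pow_succ', mul_smul, ih, hzE, ← mul_smul, ← pow_succ']
    have h2 := S.mem_smul_of_kill (a ^ t) (IsNoetherian.noetherian _) (z ^ j • s ^ d • K) (by
      intro h hh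
      rw [LinearMap.smul_apply, h1]
      refine map_kill (m ^ j) _ (hj h hh) _ ?_
      rw [Ideal.map_pow]
      exact Ideal.pow_mem_pow hz' j)
    refine Submodule.smul_mono_left ?_ h2
    rw [Ideal.map_pow]
    exact Ideal.pow_right_mono haP t)
  refine ⟨v * s ^ d, fun h => ?_, by rw [mul_smul, hvw]⟩
  rcases P.2.mem_or_mem h with h | h
  · exact hv (hPP h)
  · exact hs (P.2.mem_of_pow_mem _ h)
end case1
end LCx
end part_L10

section part_L11
open CategoryTheory Pointwise IsLocalRing


namespace LCx
set_option linter.unusedSectionVars false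

section fin
lemma exists_pow_mul {C : Type u} [CommRing C] [IsNoetherianRing C] (A P : Ideal C) [P.IsPrime]
    (h : ∀ Q : Ideal C, Q.IsPrime → A ≤ Q → Q ≤ P → Q = P) :
    ∃ n : ℕ, ∃ s ∉ P, ∀ p ∈ P ^ n, p * s ∈ A := by
  classical
  by_cases hA : A ≤ P
  · have hI : P ∈ A.minimalPrimes := ⟨⟨inferInstance, hA⟩, fun Q hQ hQP => (h Q hQ.1 hQ.2 hQP).ge⟩
    obtain ⟨n, hn⟩ := A.exists_radical_pow_le_of_fg A.radical.fg_of_isNoetherianRing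
    have hn0 : n ≠ 0 := by
      rintro rfl
      have h1 : (1 : C) ∈ P := hA (hn (by simp))
      exact P.one_notMem h1
    have hf := A.finite_minimalPrimes_of_isNoetherianRing C
    rw [← A.sInf_minimalPrimes, ← hf.coe_toFinset, ← hf.toFinset.inf_id_eq_sInf,
      ← Finset.insert_erase (hf.mem_toFinset.mpr hI), Finset.inf_insert, id_eq] at hn
    grw [← Ideal.mul_le_inf, mul_pow] at hn
    have hJ : ¬ ((hf.toFinset.erase P).inf id) ^ n ≤ P := by
      have (K : Ideal C) (hKI : K ≤ P) (hK : K ∈ A.minimalPrimes) : K = P :=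
        le_antisymm hKI (hI.2 hK.1 hKI)
      simp only [hI.isPrime.pow_le_iff hn0, hI.isPrime.inf_le', id_eq]
      rintro ⟨K, hK, hKP⟩
      obtain ⟨hK1, hK2⟩ := Finset.mem_erase.mp hK
      exact hK1 (this K hKP (hf.mem_toFinset.mp hK2))
    obtain ⟨s, hs, hsP⟩ := Set.not_subset.mp hJ
    exact ⟨n, s, hsP, fun p hp => hn (Ideal.mul_mem_mul hp hs)⟩
  · obtain ⟨s, hs, hsP⟩ := Set.not_subset.mp hA
    exact ⟨0, s, hsP, fun p _ => A.mul_mem_left _ hs⟩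

variable {R C E : Type u} [CommRing R] [IsLocalRing R] [CommRing C] [IsLocalRing C]
    [Algebra R C] [AddCommGroup E] [Module R E] [Module C E] [IsScalarTower R C E]
    [IsNoetherianRing R] [IsNoetherianRing C]

theorem Setup.case2 (S : Setup R C E) (M : Type u) [AddCommGroup M] [Module R M]
    [Module.Finite R M] (d : ℕ) (hM : Module.supportDim R M ≤ (d : WithBot ℕ∞)) (a : Ideal R)
    (ha : a ≤ maximalIdeal R) (N : Submodule R M)
    (hi : ∀ h : HH N a d, hmap a d N.subtype h = 0)
    (P : PrimeSpectrum C) (hP : coh d P)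
    (hPa : ∀ P' : PrimeSpectrum C, P ≤ P' → Ideal.map (algebraMap R C) a ≤ P'.asIdeal →
      P' = closedPoint C) (K : HH N (maximalIdeal R) d →ₗ[R] E) :
    ∃ s ∉ P.asIdeal, s • K = 0 := by
  have := P.2
  obtain ⟨s, hs, g, hg⟩ : ∃ s ∉ P.asIdeal, ∃ g : HH M (maximalIdeal R) d →ₗ[R] E,
      s • K = pb C E (hmap (maximalIdeal R) d N.subtype) g := by
    cases d with
    | zero =>
      refine ⟨1, P.1.one_notMem, ?_⟩
      have hinj := hmap_zero_inj (f := N.subtype) N.subtype_injective (maximalIdeal R)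
      obtain ⟨g, hg⟩ := S.ext_of_ker (hmap (maximalIdeal R) 0 N.subtype) K (fun h hh => by
        rw [(map_eq_zero_iff _ hinj).mp hh, map_zero])
      exact ⟨g, by ext h; rw [one_smul, pb_apply, hg]⟩
    | succ d =>
      obtain ⟨δ, -, h2⟩ := exists_delta N.subtype_injective N.mkQ_surjective
        (LinearMap.exact_subtype_mkQ N) (maximalIdeal R) d
      obtain ⟨s, hs, h⟩ := (S.claim d (M ⧸ N)).2 P hP (pb C E δ K)
      rw [← map_smul] at h
      obtain ⟨g, hg⟩ := (S.pb_exact _ _ h2 (s • K)).mp h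
      exact ⟨s, hs, g, hg.symm⟩
  have hDfin := (S.claim d M).1
  obtain ⟨n, s', hs', hn⟩ := exists_pow_mul
    (Module.annihilator C (HH M (maximalIdeal R) d →ₗ[R] E)) P.asIdeal (by
      intro Q hQ hAQ hQP
      by_contra hne
      let Q1 : PrimeSpectrum C := ⟨Q, hQ⟩
      have hlt : Q1 < P := lt_of_le_of_ne hQP (fun h => hne (congrArg PrimeSpectrum.asIdeal h))
      obtain ⟨c, hc, hcw⟩ := unif Q1 ((S.claim d M).2 Q1 ⟨P, hlt, hP⟩)
      exact hc (hAQ (Module.mem_annihilator.mpr hcw)))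
  obtain ⟨g', hg'⟩ := S.descend M d hM a ha (s' • g) (by
    intro z hz l
    have hrad : algebraMap R C z ∈ (Ideal.map (algebraMap R C) (a ^ l) ⊔ P.asIdeal ^ n).radical := by
      rw [Ideal.radical_eq_sInf, Submodule.mem_sInf]
      rintro Q ⟨hQA, hQ⟩
      rw [sup_le_iff, Ideal.map_pow] at hQA
      have h1 := hPa ⟨Q, hQ⟩ (hQ.le_of_pow_le hQA.2) (hQ.le_of_pow_le hQA.1)
      have h2 : Q = maximalIdeal C := congrArg PrimeSpectrum.asIdeal h1
      rw [h2]
      exact S.loc z hz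
    obtain ⟨j, hj⟩ := hrad
    obtain ⟨α, hα, p, hp, h⟩ := Submodule.mem_sup.mp hj
    refine ⟨j, α, hα, p, ?_, by rw [map_pow, h]⟩
    rw [← mul_smul]
    exact Module.mem_annihilator.mp (hn p hp) g)
  refine ⟨s' * s, fun h => (P.2.mem_or_mem h).elim hs' hs, ?_⟩
  rw [mul_smul, hg, ← map_smul]
  ext h
  rw [pb_apply, ← hg', hcmp_hmap, hi, map_zero]
  rfl

theorem main_HH (a : Ideal R) (M : Type u) [AddCommGroup M] [Module R M]
    [Module.Finite R M] (d : ℕ) (hM : Module.supportDim R M ≤ (d : WithBot ℕ∞)) (x : R) :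
    (∀ h : HH (LinearMap.range (LinearMap.lsmul R M x)) a d, h = 0) ↔
      ∀ y : HH M a d, x • y = 0 := by
  set N := LinearMap.range (LinearMap.lsmul R M x) with hNdef
  let π : M →ₗ[R] N := (LinearMap.lsmul R M x).rangeRestrict
  have hπ : Function.Surjective π := LinearMap.surjective_rangeRestrict _
  have hcomp : ∀ y : HH M a d, hmap a d N.subtype (hmap a d π y) = x • y := by
    intro y
    rw [hmap_hmap, ← hmap_smul_id M a d x y]
    rfl
  constructor
  · intro h y
    rw [← hcomp, h (hmap a d π y), map_zero]
  · intro hx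
    by_cases hat : a = ⊤
    · intro h
      obtain ⟨t, ht⟩ := HH_torsion N a d h
      have := ht 1 (by rw [hat, Ideal.top_pow]; trivial)
      rwa [one_smul] at this
    have ha : a ≤ maximalIdeal R := IsLocalRing.le_maximalIdeal hat
    have hNd : Module.supportDim R N ≤ (d : WithBot ℕ∞) :=
      (Module.supportDim_le_of_injective N.subtype N.subtype_injective).trans hM
    have hi : ∀ h : HH N a d, hmap a d N.subtype h = 0 := by
      intro h
      obtain ⟨δ, hδ, -⟩ := exists_delta (LinearMap.ker π).subtype_injective hπ
        (LinearMap.exact_subtype_ker_map π) a d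
      obtain ⟨y, rfl⟩ := (hδ h).mp ((groth a d (LinearMap.ker π)
        ((Module.supportDim_le_of_injective _ (LinearMap.ker π).subtype_injective).trans hM)).1
          (d + 1) (Nat.lt_succ_self d) _)
      rw [hcomp, hx]
    obtain ⟨C, E, _, _, _, _, _, _, _, _, S⟩ := exists_setup R
    intro h
    apply S.cogen
    intro f
    have hsmall : pb C E (hcmp N ha d) f ∈
        small (C := C) d (HH N (maximalIdeal R) d →ₗ[R] E) := by
      intro P hP
      by_cases hc : ∃ P' : PrimeSpectrum C, P ≤ P' ∧
          Ideal.map (algebraMap R C) a ≤ P'.asIdeal ∧ P' ≠ closedPoint C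
      · obtain ⟨P', h1, h2, h3⟩ := hc
        exact S.hlvt N d hNd a ha P P' h1 h2 h3 hP f
      · push Not at hc
        exact S.case2 M d hM a ha N hi P hP hc _
    have h0 := S.lemU d N hNd _ hsmall
    obtain ⟨h', rfl⟩ := cmp_surj N d hNd a ha h
    exact LinearMap.congr_fun h0 h'
end fin

theorem main_lc {R : Type u} [CommRing R] [IsNoetherianRing R] [IsLocalRing R] (a : Ideal R)
    (M : Type u) [AddCommGroup M] [Module R M] [Module.Finite R M]
    (d : ℕ) (hd : ringKrullDim (R ⧸ Module.annihilator R M) ≤ (d : WithBot ℕ∞)) (x : R) :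
    Subsingleton ((localCohomology a d).obj
        (ModuleCat.of R ↥(LinearMap.range (LinearMap.lsmul R M x)))) ↔
      ∀ y : (localCohomology a d).obj (ModuleCat.of R M), x • y = 0 := by
  rw [← Module.supportDim_eq_ringKrullDim_quotient_annihilator] at hd
  have key := main_HH a M d hd x
  obtain ⟨e1⟩ := exists_lc_equiv a d (LinearMap.range (LinearMap.lsmul R M x))
  obtain ⟨e2⟩ := exists_lc_equiv a d M
  constructor
  · intro hs y
    apply e2.injective
    rw [map_smul, map_zero]
    refine key.mp (fun h => ?_) _
    obtain ⟨w, rfl⟩ := e1.surjective h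
    rw [Subsingleton.elim w 0, map_zero]
  · intro hx
    have h1 := key.mpr (fun y => by
      obtain ⟨w, rfl⟩ := e2.surjective y
      rw [← map_smul, hx, map_zero])
    exact ⟨fun u v => e1.injective (by rw [h1 (e1 u), h1 (e1 v)])⟩
end LCx
end part_L11

/-- Over a local ring, with `dim M = d`, `H^d_𝔞(M) ≠ 0` and `x ∈ R`,
`H^d_𝔞(xM) = 0` iff `x • H^d_𝔞(M) = 0`. -/
theorem stmt_16 {R : Type u} [CommRing R] [IsNoetherianRing R] [IsLocalRing R] (𝔞 : Ideal R)
    (M : Type u) [AddCommGroup M] [Module R M] [Module.Finite R M] [Nontrivial M]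
    (d : ℕ) (hd : modDim R M = (d : ℕ∞)) (htop : LCNonzero 𝔞 d M) (x : R) :
    Subsingleton ((localCohomology 𝔞 d).obj
        (ModuleCat.of R ↥(LinearMap.range (LinearMap.lsmul R M x)))) ↔
      ∀ y : (localCohomology 𝔞 d).obj (ModuleCat.of R M), x • y = 0 := by
  refine LCx.main_lc 𝔞 M d ?_ x
  exact le_of_eq hd
end

section
/- Let (R, 𝔪) be a local Noetherian domain of dimension d and 𝔞 an ideal of R such that H^d_𝔞(R) ≠ 0. Then Ann_R(H^d_𝔞(R)) = 0. -/
open CategoryTheory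

universe u

namespace LCAux
open CategoryTheory.Abelian

variable {R : Type u} [CommRing R]

lemma step {F N : Type u} [AddCommGroup F] [Module R F] [AddCommGroup N] [Module R N]
    [Module.Projective R F] (π : F →ₗ[R] N) (hπ : Function.Surjective π) {T : ModuleCat.{u} R}
    {i : ℕ} (e : Abelian.Ext (ModuleCat.of R N) T (i + 1)) :
    ∃ e' : Abelian.Ext (ModuleCat.of R (LinearMap.ker π)) T i,
      ∀ L : Submodule R (LinearMap.ker π),
        (Ext.mk₀ (ModuleCat.ofHom L.subtype)).comp e' (zero_add i) = 0 →
        ∀ (F' N' : Type u) [AddCommGroup F'] [Module R F'] [AddCommGroup N'] [Module R N']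
          (π' : F' →ₗ[R] N') (_ : Function.Surjective π') (p : F' →ₗ[R] F) (q : N' →ₗ[R] N)
          (_ : ∀ y, q (π' y) = π (p y))
          (_ : ∀ y, π' y = 0 → ∃ z : LinearMap.ker π, z.1 = p y ∧ z ∈ L),
          (Ext.mk₀ (ModuleCat.ofHom q)).comp e (zero_add (i + 1)) = 0 := by
  have hS := LinearMap.shortExact_shortComplexKer hπ
  have : Projective (LinearMap.shortComplexKer π).X₂ :=
    (IsProjective.iff_projective (R := R) F).mp inferInstance
  obtain ⟨e', he'⟩ := Ext.contravariant_sequence_exact₃ hS T e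
    (Ext.eq_zero_of_projective _) (n₀ := i) (add_comm _ _)
  refine ⟨e', fun L hL F' N' _ _ _ _ π' hπ' p q hpq hp ↦ ?_⟩
  have hS' := LinearMap.shortExact_shortComplexKer hπ'
  have hw : ∀ y : LinearMap.ker π', π (p y.1) = 0 := fun y ↦ by
    rw [← hpq, y.2, map_zero]
  let w : LinearMap.ker π' →ₗ[R] LinearMap.ker π :=
    (p.comp (LinearMap.ker π').subtype).codRestrict _ (fun y ↦ hw y)
  have hwL : ∀ y, w y ∈ L := fun y ↦ by
    obtain ⟨z, hz, hzL⟩ := hp y.1 y.2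
    have : w y = z := Subtype.ext hz.symm
    rwa [this]
  let φ : LinearMap.shortComplexKer π' ⟶ LinearMap.shortComplexKer π :=
    { τ₁ := ModuleCat.ofHom w
      τ₂ := ModuleCat.ofHom p
      τ₃ := ModuleCat.ofHom q
      comm₁₂ := by ext y; rfl
      comm₂₃ := by ext y; exact (hpq y).symm }
  have nat := hS'.extClass_naturality hS φ
  have h1 : (Ext.mk₀ (ModuleCat.ofHom w)).comp e' (zero_add i) = 0 := by
    have : ModuleCat.ofHom w = ModuleCat.ofHom (w.codRestrict L hwL) ≫ ModuleCat.ofHom L.subtype := by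
      ext y; rfl
    rw [this, ← Ext.mk₀_comp_mk₀, Ext.comp_assoc_of_second_deg_zero, hL, Ext.comp_zero]
  rw [← he']
  change (Ext.mk₀ φ.τ₃).comp (hS.extClass.comp e' _) _ = 0
  rw [← Ext.comp_assoc (a₁₂ := 1) _ _ _ (by lia) (by lia) (by lia), ← nat,
    Ext.comp_assoc_of_second_deg_zero]
  change hS'.extClass.comp ((Ext.mk₀ (ModuleCat.ofHom w)).comp e' _) _ = 0
  rw [h1, Ext.comp_zero]

lemma kill_ext [IsNoetherianRing R] (𝔞 : Ideal R) (T : ModuleCat.{u} R) (k : ℕ)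
    (hT : ∀ r ∈ 𝔞 ^ k, ∀ m : T, r • m = 0) (i : ℕ) :
    ∀ (N : Type u) [AddCommGroup N] [Module R N] [Module.Finite R N]
      (e : Abelian.Ext (ModuleCat.of R N) T i),
      ∃ s : ℕ, (Ext.mk₀ (ModuleCat.ofHom (𝔞 ^ s • (⊤ : Submodule R N)).subtype)).comp e
        (zero_add i) = 0 := by
  induction i with
  | zero =>
    intro N _ _ _ e
    obtain ⟨f, rfl⟩ := Ext.homEquiv₀.symm.surjective e
    refine ⟨k, ?_⟩
    simp only [Ext.homEquiv₀_symm_apply, Ext.mk₀_comp_mk₀]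
    have : ModuleCat.ofHom (𝔞 ^ k • (⊤ : Submodule R N)).subtype ≫ f = 0 := by
      ext ⟨y, hy⟩
      change f.hom y = 0
      refine Submodule.smul_induction_on hy (fun r hr n _ ↦ ?_) (fun a b ha hb ↦ ?_)
      · rw [map_smul]; exact hT r hr _
      · rw [map_add, ha, hb, add_zero]
    rw [this, Ext.mk₀_zero]
  | succ i ih =>
    intro N _ _ _ e
    obtain ⟨n, π, hπ⟩ := Module.Finite.exists_fin' R N
    obtain ⟨e', he'⟩ := step π hπ e
    obtain ⟨s, hs⟩ := ih (LinearMap.ker π) e'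
    obtain ⟨c, hc⟩ := Ideal.exists_pow_inf_eq_pow_smul 𝔞 (LinearMap.ker π)
    have hmap : ∀ y ∈ 𝔞 ^ (s + c) • (⊤ : Submodule R (Fin n → R)),
        π y ∈ 𝔞 ^ (s + c) • (⊤ : Submodule R N) := by
      intro y hy
      have := Submodule.mem_map_of_mem (f := π) hy
      rw [Submodule.map_smul''] at this
      exact Submodule.smul_mono le_rfl le_top this
    refine ⟨s + c, he' _ hs (𝔞 ^ (s + c) • (⊤ : Submodule R (Fin n → R)) : Submodule R _) _
      (π.restrict hmap) ?_ (Submodule.subtype _) _ (fun y ↦ rfl) ?_⟩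
    · rintro ⟨y, hy⟩
      have : y ∈ Submodule.map π (𝔞 ^ (s + c) • (⊤ : Submodule R (Fin n → R))) := by
        rw [Submodule.map_smul'', Submodule.map_top, LinearMap.range_eq_top.mpr hπ]
        exact hy
      obtain ⟨z, hz, rfl⟩ := this
      exact ⟨⟨z, hz⟩, rfl⟩
    · rintro ⟨y, hy⟩ h0
      have hy0 : π y = 0 := congrArg Subtype.val h0
      refine ⟨⟨y, hy0⟩, rfl, ?_⟩
      have h1 : y ∈ 𝔞 ^ (s + c) • ⊤ ⊓ LinearMap.ker π := ⟨hy, hy0⟩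
      rw [hc _ (Nat.le_add_left _ _), Nat.add_sub_cancel] at h1
      have h2 : y ∈ 𝔞 ^ s • (LinearMap.ker π) := Submodule.smul_mono le_rfl inf_le_right h1
      have h3 : y ∈ Submodule.map (LinearMap.ker π).subtype
          (𝔞 ^ s • (⊤ : Submodule R (LinearMap.ker π))) := by
        rw [Submodule.map_smul'', Submodule.map_top, Submodule.range_subtype]
        exact h2
      obtain ⟨z, hz, hzy⟩ := h3
      have : z = ⟨y, hy0⟩ := Subtype.ext hzy
      rwa [← this]

/-- transition map -/
abbrev trans (𝔞 : Ideal R) {t s : ℕ} (h : t ≤ s) : (R ⧸ 𝔞 ^ s) →ₗ[R] (R ⧸ 𝔞 ^ t) :=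
  Submodule.mapQ _ _ LinearMap.id (Ideal.pow_le_pow_right h)

lemma trans_comp (𝔞 : Ideal R) {t s r : ℕ} (h : t ≤ s) (h' : s ≤ r) :
    ModuleCat.ofHom (trans 𝔞 h') ≫ ModuleCat.ofHom (trans 𝔞 h) =
      ModuleCat.ofHom (trans 𝔞 (h.trans h')) := by
  ext
  rfl

lemma kill_torsion [IsNoetherianRing R] (𝔞 : Ideal R) (T : ModuleCat.{u} R) (k : ℕ)
    (hT : ∀ r ∈ 𝔞 ^ k, ∀ m : T, r • m = 0) (i t : ℕ)
    (e : Abelian.Ext (ModuleCat.of R (R ⧸ 𝔞 ^ t)) T (i + 1)) :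
    ∃ (s : ℕ) (h : t ≤ s), (Ext.mk₀ (ModuleCat.ofHom (trans 𝔞 h))).comp e
        (zero_add _) = 0 := by
  obtain ⟨e', he'⟩ := step (Submodule.mkQ (𝔞 ^ t)) (Submodule.mkQ_surjective _) e
  obtain ⟨s, hs⟩ := kill_ext 𝔞 T k hT i _ e'
  refine ⟨s + t, Nat.le_add_left _ _, he' _ hs R _ (Submodule.mkQ (𝔞 ^ (s + t)))
    (Submodule.mkQ_surjective _) LinearMap.id _ (fun y ↦ rfl) ?_⟩
  intro y hy
  have hy : y ∈ 𝔞 ^ (s + t) := (Submodule.Quotient.mk_eq_zero _).mp hy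
  have hk : LinearMap.ker (Submodule.mkQ (𝔞 ^ t)) = 𝔞 ^ t := Submodule.ker_mkQ _
  have h3 : y ∈ Submodule.map (LinearMap.ker (Submodule.mkQ (𝔞 ^ t))).subtype
          (𝔞 ^ s • (⊤ : Submodule R (LinearMap.ker (Submodule.mkQ (𝔞 ^ t))))) := by
    rw [Submodule.map_smul'', Submodule.map_top, Submodule.range_subtype, hk, smul_eq_mul, ← pow_add]
    exact hy
  obtain ⟨z, hz, hzy⟩ := h3
  exact ⟨z, hzy, hz⟩

lemma absA {C : Type*} [Category C] [Abelian C] [HasExt C] {S : ShortComplex C} (hS : S.ShortExact)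
    {X X' : C} (g : X' ⟶ X) {n : ℕ} (f : Abelian.Ext X S.X₃ n)
    (h : (Ext.mk₀ g).comp f (zero_add n) = 0) :
    (Ext.mk₀ g).comp (f.comp hS.extClass rfl) (zero_add (n + 1)) = 0 := by
  rw [← Ext.comp_assoc (a₁₂ := n) _ _ _ (by lia) (by lia) (by lia), h, Ext.zero_comp]

lemma absB {C : Type*} [Category C] [Abelian C] [HasExt C]
    {X X' Y Z : C} (g : X' ⟶ X) (p : Y ⟶ Z) {n : ℕ} (f : Abelian.Ext X Y n)
    (h : (Ext.mk₀ g).comp f (zero_add n) = 0) :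
    (Ext.mk₀ g).comp (f.comp (Ext.mk₀ p) (add_zero n)) (zero_add n) = 0 := by
  rw [← Ext.comp_assoc_of_third_deg_zero, h, Ext.zero_comp]

lemma exists_regular [IsNoetherianRing R] (𝔞 : Ideal R) (M : Type u) [AddCommGroup M] [Module R M]
    [Module.Finite R M] : ∃ (T : Submodule R M) (k : ℕ),
      (∀ r ∈ 𝔞 ^ k, ∀ m ∈ T, r • m = 0) ∧ ∃ r ∈ 𝔞, IsSMulRegular (M ⧸ T) r := by
  have hne : ({T : Submodule R M | ∃ k : ℕ, ∀ r ∈ 𝔞 ^ k, ∀ m ∈ T, r • m = 0}).Nonempty :=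
    ⟨⊥, 0, fun r _ m hm ↦ by rw [(Submodule.mem_bot R).mp hm, smul_zero]⟩
  obtain ⟨T, ⟨k, hk⟩, hmax⟩ := set_has_maximal_iff_noetherian.mpr
    (inferInstance : IsNoetherian R M) _ hne
  refine ⟨T, k, hk, ?_⟩
  have hsub : Subsingleton ((R ⧸ 𝔞) →ₗ[R] (M ⧸ T)) := by
    refine subsingleton_of_forall_eq 0 fun f ↦ ?_
    obtain ⟨m, hm⟩ := Submodule.mkQ_surjective T (f (Submodule.Quotient.mk 1))
    have ham : ∀ r ∈ 𝔞, r • m ∈ T := by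
      intro r hr
      have : T.mkQ (r • m) = 0 := by
        rw [map_smul, hm, ← map_smul, ← Submodule.Quotient.mk_smul,
          (Submodule.Quotient.mk_eq_zero 𝔞).mpr (by simpa using hr), map_zero]
      exact (Submodule.Quotient.mk_eq_zero T).mp this
    have hmT : m ∈ T := by
      by_contra hmT
      refine hmax (T ⊔ Submodule.span R {m}) ⟨k + 1, ?_⟩ ?_
      · intro r hr y hy
        obtain ⟨a, ha, b, hb, rfl⟩ := Submodule.mem_sup.mp hy
        obtain ⟨c, rfl⟩ := Submodule.mem_span_singleton.mp hb
        have h1 : r • a = 0 := hk r (Ideal.pow_le_pow_right (Nat.le_succ k) hr) a ha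
        have h2 : r • m = 0 := by
          rw [pow_succ] at hr
          refine Submodule.mul_induction_on hr (fun x hx z hz ↦ ?_) (fun x z hx hz ↦ ?_)
          · rw [mul_smul]; exact hk x hx _ (ham z hz)
          · rw [add_smul, hx, hz, add_zero]
        rw [smul_add, h1, smul_comm, h2, smul_zero, add_zero]
      · refine lt_of_le_of_ne le_sup_left fun h ↦ hmT ?_
        rw [h]
        exact Submodule.mem_sup_right (Submodule.mem_span_singleton_self m)
    have h0 : f (Submodule.Quotient.mk 1) = 0 := by
      rw [← hm]; simpa using hmT
    ext
    exact h0
  obtain ⟨r, hr, hreg⟩ := IsSMulRegular.subsingleton_linearMap_iff.mp hsub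
  rw [Ideal.annihilator_quotient] at hr
  exact ⟨r, hr, hreg⟩

lemma supportDim_lt {M : Type u} [AddCommGroup M] [Module R M] [IsNoetherianRing R]
    [Module.Finite R M] {r : R} (hr : IsSMulRegular M r) {n : ℕ}
    (h : Module.supportDim R M < ((n + 1 : ℕ) : WithBot ℕ∞)) :
    Module.supportDim R (QuotSMulTop r M) < (n : WithBot ℕ∞) := by
  have h1 := Module.supportDim_quotSMulTop_succ_le_of_notMem_minimalPrimes (R := R) (M := M) (x := r)
    (fun _ ↦ hr.notMem_of_mem_minimalPrimes)
  have h2 := h1.trans_lt h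
  by_contra! hc
  refine absurd h2 (not_lt.mpr ?_)
  push_cast
  gcongr

lemma vanish [IsNoetherianRing R] (𝔞 : Ideal R) (n : ℕ) :
    ∀ (M : Type u) [AddCommGroup M] [Module R M] [Module.Finite R M]
      (_ : Module.supportDim R M < (n : WithBot ℕ∞)) (t : ℕ)
      (e : Abelian.Ext (ModuleCat.of R (R ⧸ 𝔞 ^ t)) (ModuleCat.of R M) n),
      ∃ (s : ℕ) (h : t ≤ s), (Ext.mk₀ (ModuleCat.ofHom (trans 𝔞 h))).comp e
        (zero_add _) = 0 := by
  induction n with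
  | zero =>
    intro M _ _ _ hM t e
    have : Subsingleton M := by
      by_contra hc
      rw [not_subsingleton_iff_nontrivial] at hc
      have : Nonempty (Module.support R M) := Module.nonempty_support_of_nontrivial.to_subtype
      exact absurd hM (not_lt.mpr (Order.krullDim_nonneg (α := Module.support R M)))
    refine ⟨t, le_rfl, ?_⟩
    obtain ⟨f, rfl⟩ := Ext.homEquiv₀.symm.surjective e
    have : f = 0 := by ext; exact Subsingleton.elim (α := M) _ _
    rw [this]
    simp
  | succ n ih =>
    intro M _ _ _ hM t e
    obtain ⟨T, k, hk, r, hr, hreg⟩ := exists_regular 𝔞 M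
    have hM' : Module.supportDim R (M ⧸ T) < ((n + 1 : ℕ) : WithBot ℕ∞) :=
      (Module.supportDim_le_of_surjective T.mkQ T.mkQ_surjective).trans_lt hM
    -- the image in `M / T`
    have hreg' : IsSMulRegular (M ⧸ T) (r ^ t) := hreg.pow t
    have hS := IsSMulRegular.smulShortComplex_shortExact (M := ModuleCat.of R (M ⧸ T)) hreg'
    have hS0 := LinearMap.shortExact_shortComplexKer T.mkQ_surjective
    let e1 : Abelian.Ext (ModuleCat.of R (R ⧸ 𝔞 ^ t)) (ModuleCat.of R (M ⧸ T)) (n + 1) :=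
      e.comp (Ext.mk₀ (ModuleCat.ofHom T.mkQ)) (add_zero _)
    have hsm : r ^ t • e1 = 0 := by
      have h1 : r ^ t • e1 = (Ext.mk₀ (r ^ t • 𝟙 (ModuleCat.of R (R ⧸ 𝔞 ^ t)))).comp e1
          (zero_add _) := by
        rw [Ext.mk₀_smul, Ext.smul_comp, Ext.mk₀_id_comp]
      have h2 : r ^ t • 𝟙 (ModuleCat.of R (R ⧸ 𝔞 ^ t)) = 0 := by
        ext
        change r ^ t • (Submodule.Quotient.mk 1 : R ⧸ 𝔞 ^ t) = 0
        rw [← Submodule.Quotient.mk_smul, Submodule.Quotient.mk_eq_zero]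
        simpa using Ideal.pow_mem_pow hr t
      rw [h1, h2, Ext.mk₀_zero, Ext.zero_comp]
    obtain ⟨f, hf⟩ := Ext.covariant_sequence_exact₁ _ hS (n₁ := n + 1) e1 (by
      rw [ModuleCat.smulShortComplex_f_eq_smul_id]
      exact (Ext.smul_eq_comp_mk₀ e1 (r ^ t)).symm.trans hsm) rfl
    obtain ⟨s, hs, hfs⟩ := ih (QuotSMulTop (r ^ t) (M ⧸ T)) (supportDim_lt hreg' hM') t f
    have he1 : (Ext.mk₀ (ModuleCat.ofHom (trans 𝔞 hs))).comp e1 (zero_add _) = 0 := by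
      rw [← hf]
      exact absA hS _ f hfs
    obtain ⟨g, hg⟩ := Ext.covariant_sequence_exact₂ _ hS0 (n := n + 1)
      ((Ext.mk₀ (ModuleCat.ofHom (trans 𝔞 hs))).comp e (zero_add _)) (by
        rw [Ext.comp_assoc_of_third_deg_zero]; exact he1)
    obtain ⟨s', hs', hgs⟩ := kill_torsion 𝔞 (ModuleCat.of R (LinearMap.ker T.mkQ)) k (by
      rintro r hr ⟨m, hm⟩
      apply Subtype.ext
      exact hk r hr m (by simpa using hm)) n s g
    refine ⟨s', hs.trans hs', ?_⟩
    rw [← trans_comp 𝔞 hs hs', ← Ext.mk₀_comp_mk₀, Ext.comp_assoc_of_second_deg_zero, ← hg]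
    exact absB _ _ g hgs

lemma main_ext [IsNoetherianRing R] [IsDomain R] (𝔞 : Ideal R) (d : ℕ)
    (hd : ringKrullDim R = (d : WithBot ℕ∞)) (x : R) (hx : x ≠ 0) (t : ℕ)
    (e : Abelian.Ext (ModuleCat.of R (R ⧸ 𝔞 ^ t)) (ModuleCat.of R R) d) :
    ∃ (s : ℕ) (h : t ≤ s) (e' : Abelian.Ext (ModuleCat.of R (R ⧸ 𝔞 ^ s)) (ModuleCat.of R R) d),
      (Ext.mk₀ (ModuleCat.ofHom (trans 𝔞 h))).comp e (zero_add _) = x • e' := by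
  have hreg : IsSMulRegular R x := fun a b h ↦ mul_left_cancel₀ hx h
  have hS := IsSMulRegular.smulShortComplex_shortExact (M := ModuleCat.of R R) hreg
  have hdim : Module.supportDim R (QuotSMulTop x R) < (d : WithBot ℕ∞) := by
    refine supportDim_lt hreg ?_
    rw [Module.supportDim_self_eq_ringKrullDim, hd]
    exact_mod_cast Nat.lt_succ_self d
  obtain ⟨s, hs, h0⟩ := vanish 𝔞 d (QuotSMulTop x R) hdim t
    (e.comp (Ext.mk₀ (ModuleCat.smulShortComplex (ModuleCat.of R R) x).g) (add_zero _))
  obtain ⟨e', he'⟩ := Ext.covariant_sequence_exact₂ _ hS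
    ((Ext.mk₀ (ModuleCat.ofHom (trans 𝔞 hs))).comp e (zero_add _)) (by
      exact (Ext.comp_assoc_of_third_deg_zero _ _ _ _).trans h0)
  refine ⟨s, hs, e', ?_⟩
  rw [← he', ModuleCat.smulShortComplex_f_eq_smul_id]
  exact (Ext.smul_eq_comp_mk₀ (R := R) _ x).symm

/-- functoriality of `linearYonedaObj` -/
noncomputable def yon {P Q : ChainComplex (ModuleCat.{u} R) ℕ} (φ : P ⟶ Q) (Y : ModuleCat.{u} R) :
    Q.linearYonedaObj R Y ⟶ P.linearYonedaObj R Y :=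
  (HomologicalComplex.unopFunctor (ModuleCat.{u} R) _).map
    ((((linearYoneda R (ModuleCat.{u} R)).obj Y).rightOp.mapHomologicalComplex _).map φ).op

lemma yon_f {P Q : ChainComplex (ModuleCat.{u} R) ℕ} (φ : P ⟶ Q) (Y : ModuleCat.{u} R) (n : ℕ)
    (f : Q.X n ⟶ Y) : ((yon φ Y).f n).hom f = φ.f n ≫ f := rfl

lemma paste {C : Type*} [Category C] {A B D A' B' D' : C} {β : A ⟶ B} {α : B ⟶ D} {L : D ⟶ D'}
    {H2 : A ⟶ A'} {H : B ⟶ B'} {β' : A' ⟶ B'} {α' : B' ⟶ D'}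
    (h1 : α ≫ L = H ≫ α') (h2 : β ≫ H = H2 ≫ β') :
    (β ≫ α) ≫ L = H2 ≫ β' ≫ α' := by
  rw [Category.assoc, h1, reassoc_of% h2]

lemma isoExt_nat {X X' : ModuleCat.{u} R} (P : ProjectiveResolution X) (P' : ProjectiveResolution X')
    (g : X' ⟶ X) (φ : P'.complex ⟶ P.complex) (comm : φ.f 0 ≫ P.π.f 0 = P'.π.f 0 ≫ g)
    (n : ℕ) (Y : ModuleCat.{u} R) :
    (P.isoExt (R := R) n Y).inv ≫ ((_root_.Ext R (ModuleCat.{u} R) n).map g.op).app Y =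
      HomologicalComplex.homologyMap (yon φ Y) n ≫ (P'.isoExt (R := R) n Y).inv := by
  have h1 := ProjectiveResolution.isoLeftDerivedObj_hom_naturality g P' P φ comm
    ((linearYoneda R (ModuleCat.{u} R)).obj Y).rightOp n
  have h2 := HomologicalComplex.homologyOp_hom_naturality (yon φ Y) n
  have h1' := congrArg Quiver.Hom.unop h1
  have h2' := congrArg Quiver.Hom.unop h2
  exact paste h1' h2'

variable {X : ModuleCat.{u} R} (P : ProjectiveResolution X) (Y : ModuleCat.{u} R) (n : ℕ)

/-- The cocycle `f` represents the class `e`. -/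
def Rel (f : P.complex.X n ⟶ Y) (e : ((_root_.Ext R (ModuleCat.{u} R) n).obj (Opposite.op X)).obj Y) :
    Prop :=
  ∃ z : ((P.complex.linearYonedaObj R Y).cycles n : ModuleCat.{u} R),
    ((P.complex.linearYonedaObj R Y).iCycles n).hom z = f ∧
    e = (P.isoExt (R := R) n Y).inv.hom (((P.complex.linearYonedaObj R Y).homologyπ n).hom z)

lemma rel_of_ext (e : ((_root_.Ext R (ModuleCat.{u} R) n).obj (Opposite.op X)).obj Y) :
    ∃ f, Rel P Y n f e ∧ P.complex.d (n + 1) n ≫ f = 0 := by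
  obtain ⟨z, hz⟩ := (ModuleCat.epi_iff_surjective _).mp
    (inferInstance : Epi ((P.complex.linearYonedaObj R Y).homologyπ n))
      ((P.isoExt (R := R) n Y).hom.hom e)
  refine ⟨_, ⟨z, rfl, ?_⟩, ?_⟩
  · change _ = (P.isoExt (R := R) n Y).inv.hom _
    erw [hz]
    exact (ConcreteCategory.congr_hom (P.isoExt (R := R) n Y).hom_inv_id e).symm
  · have := (P.complex.linearYonedaObj R Y).iCycles_d n (n + 1)
    exact ConcreteCategory.congr_hom this z

lemma rel_of_cocycle (f : P.complex.X n ⟶ Y) (hf : P.complex.d (n + 1) n ≫ f = 0) :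
    ∃ e, Rel P Y n f e := by
  let K := P.complex.linearYonedaObj R Y
  let k : ModuleCat.of R R ⟶ K.X n := ModuleCat.ofHom (LinearMap.toSpanSingleton R (K.X n) f)
  have hk : k ≫ K.d n (n + 1) = 0 := by
    ext
    change (K.d n (n + 1)).hom ((1 : R) • f) = 0
    rw [one_smul]
    exact hf
  let l := K.liftCycles k (n + 1) (by simp) hk
  refine ⟨_, l.hom 1, ?_, rfl⟩
  have := ConcreteCategory.congr_hom (K.liftCycles_i k (n + 1) (by simp) hk) 1
  exact this.trans (one_smul R f)

variable {Y n}

lemma Rel.sub {f f' e e'} (h : Rel P Y n f e) (h' : Rel P Y n f' e') (x : R) :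
    Rel P Y n (f - x • f') (e - x • e') := by
  obtain ⟨z, rfl, rfl⟩ := h
  obtain ⟨z', rfl, rfl⟩ := h'
  refine ⟨z - x • z', ?_, ?_⟩
  · rw [map_sub, map_smul]; rfl
  · rw [map_sub, map_smul, map_sub, map_smul]

lemma Rel.zero {f : P.complex.X (n + 1) ⟶ Y} {e} (h : Rel P Y (n + 1) f e) (g : P.complex.X n ⟶ Y)
    (hg : P.complex.d (n + 1) n ≫ g = f) : e = 0 := by
  obtain ⟨z, hz, rfl⟩ := h
  let K := P.complex.linearYonedaObj R Y
  have h1 : (K.toCycles n (n + 1)).hom g = z := by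
    apply (ModuleCat.mono_iff_injective _).mp (inferInstance : Mono (K.iCycles (n + 1)))
    refine (ConcreteCategory.congr_hom (K.toCycles_i n (n + 1)) g).trans ?_
    exact hg.trans hz.symm
  have h2 : (K.homologyπ (n + 1)).hom z = 0 := by
    rw [← h1]
    exact ConcreteCategory.congr_hom (K.toCycles_comp_homologyπ n (n + 1)) g
  exact (congrArg _ h2).trans (map_zero _)

lemma Rel.nat {X' : ModuleCat.{u} R} (P' : ProjectiveResolution X')
    (g : X' ⟶ X) (φ : P'.complex ⟶ P.complex) (comm : φ.f 0 ≫ P.π.f 0 = P'.π.f 0 ≫ g)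
    {f e} (h : Rel P Y n f e) :
    Rel P' Y n (φ.f n ≫ f) ((((_root_.Ext R (ModuleCat.{u} R) n).map g.op).app Y).hom e) := by
  obtain ⟨z, rfl, rfl⟩ := h
  refine ⟨(HomologicalComplex.cyclesMap (yon φ Y) n).hom z, ?_, ?_⟩
  · exact ConcreteCategory.congr_hom (HomologicalComplex.cyclesMap_i (yon φ Y) n) z
  · refine (ConcreteCategory.congr_hom (isoExt_nat P P' g φ comm n Y) _).trans ?_
    exact congrArg (P'.isoExt (R := R) n Y).inv.hom
      (ConcreteCategory.congr_hom (HomologicalComplex.homologyπ_naturality (yon φ Y) n) z)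

lemma old_main [IsNoetherianRing R] [IsDomain R] (𝔞 : Ideal R) (n : ℕ)
    (hd : ringKrullDim R = ((n + 1 : ℕ) : WithBot ℕ∞)) (x : R) (hx : x ≠ 0) (t : ℕ)
    (e : ((_root_.Ext R (ModuleCat.{u} R) (n + 1)).obj (Opposite.op
      (ModuleCat.of R (R ⧸ 𝔞 ^ t)))).obj (ModuleCat.of R R)) :
    ∃ (s : ℕ) (h : t ≤ s) (e' : ((_root_.Ext R (ModuleCat.{u} R) (n + 1)).obj (Opposite.op
      (ModuleCat.of R (R ⧸ 𝔞 ^ s)))).obj (ModuleCat.of R R)),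
      (((_root_.Ext R (ModuleCat.{u} R) (n + 1)).map (ModuleCat.ofHom (trans 𝔞 h)).op).app
        (ModuleCat.of R R)).hom e = x • e' := by
  let P := projectiveResolution (ModuleCat.of R (R ⧸ 𝔞 ^ t))
  obtain ⟨f, hfe, hf⟩ := rel_of_ext P _ _ e
  obtain ⟨s, h, ε, hε⟩ := main_ext 𝔞 (n + 1) hd x hx t (P.extMk f _ rfl hf)
  let P' := projectiveResolution (ModuleCat.of R (R ⧸ 𝔞 ^ s))
  obtain ⟨f', hf', rfl⟩ := P'.extMk_surjective ε _ rfl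
  obtain ⟨e', he'⟩ := rel_of_cocycle P' _ _ f' hf'
  have comm := ProjectiveResolution.lift_commutes_zero (ModuleCat.ofHom (trans 𝔞 h)) P' P
  let φ : ProjectiveResolution.Hom P' P (ModuleCat.ofHom (trans 𝔞 h)) :=
    { hom := ProjectiveResolution.lift _ P' P
      hom_f_zero_comp_π_f_zero := by
        rw [comm]; rfl }
  refine ⟨s, h, e', ?_⟩
  have hrel := (hfe.nat P P' _ φ.hom comm).sub P' he' x
  rw [ProjectiveResolution.mk₀_comp_extMk f _ rfl hf φ, Ext.smul_eq_comp_mk₀,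
    ProjectiveResolution.extMk_comp_mk₀, ← sub_eq_zero, ProjectiveResolution.sub_extMk,
    ProjectiveResolution.extMk_eq_zero_iff _ _ _ _ _ n rfl] at hε
  obtain ⟨g, hg⟩ := hε
  rw [← sub_eq_zero]
  refine hrel.zero P' g (hg.trans ?_)
  simp

lemma colim_rep (𝔞 : Ideal R) (d : ℕ) (Y : ModuleCat.{u} R) :
    ∃ ι : ∀ t : ℕ, ((_root_.Ext R (ModuleCat.{u} R) d).obj (Opposite.op
      (ModuleCat.of R (R ⧸ 𝔞 ^ t)))).obj Y →ₗ[R] (localCohomology 𝔞 d).obj Y,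
      (∀ m, ∃ t e, ι t e = m) ∧
      ∀ (t s : ℕ) (h : t ≤ s) e, ι s ((((_root_.Ext R (ModuleCat.{u} R) d).map
        (ModuleCat.ofHom (trans 𝔞 h)).op).app Y).hom e) = ι t e := by
  let D := localCohomology.diagram (localCohomology.idealPowersDiagram 𝔞) d
  let c := Limits.colimit.cocone D
  let ev := (evaluation (ModuleCat.{u} R) (ModuleCat.{u} R)).obj Y
  have hc : Limits.IsColimit (ev.mapCocone c) :=
    Limits.isColimitOfPreserves ev (Limits.colimit.isColimit D)
  have : Limits.PreservesFilteredColimitsOfSize.{0, 0} (forget (ModuleCat.{u} R)) :=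
    Limits.preservesFilteredColimitsOfSize_shrink.{0, u, 0, u} _
  have : IsFiltered (ℕᵒᵖᵒᵖ) := IsFiltered.of_equivalence (opOpEquivalence ℕ).symm
  have : Limits.PreservesColimit (D ⋙ ev) (forget (ModuleCat.{u} R)) := inferInstance
  refine ⟨fun t ↦ ((c.ι.app (Opposite.op (Opposite.op t))).app Y).hom, fun m ↦ ?_, ?_⟩
  · obtain ⟨j, y, hy⟩ := Limits.Concrete.isColimit_exists_rep _ hc m
    exact ⟨j.unop.unop, y, hy⟩
  · intro t s h e
    exact ConcreteCategory.congr_hom ((ev.mapCocone c).w (homOfLE h).op.op) e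

end LCAux

/-- If `(R, 𝔪)` is a local domain of dimension `d` with `H^d_𝔞(R) ≠ 0`, then
`Ann_R(H^d_𝔞(R)) = 0`. -/
theorem stmt_17 {R : Type u} [CommRing R] [IsDomain R] [IsNoetherianRing R] [IsLocalRing R]
    (𝔞 : Ideal R) (d : ℕ) (hd : ringKrullDim R = (d : WithBot ℕ∞)) (htop : LCNonzero 𝔞 d R) :
    Module.annihilator R ((localCohomology 𝔞 d).obj (ModuleCat.of R R)) = ⊥ := by
  rw [eq_bot_iff]
  intro x hxm
  rw [Module.mem_annihilator] at hxm
  by_contra hx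
  have hx : x ≠ 0 := hx
  apply not_subsingleton_iff_nontrivial.mpr htop
  refine subsingleton_of_forall_eq 0 fun m ↦ ?_
  cases d with
  | zero =>
    have : Ring.KrullDimLE 0 R := (Ring.krullDimLE_iff).mpr (by rw [hd])
    have hfield : IsField R := Ring.KrullDimLE.isField_of_isDomain
    obtain ⟨y, hy⟩ := hfield.mul_inv_cancel hx
    rw [← one_smul R m, ← hy, mul_comm, mul_smul, hxm, smul_zero]
  | succ n =>
    obtain ⟨ι, h1, h2⟩ := LCAux.colim_rep 𝔞 (n + 1) (ModuleCat.of R R)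
    obtain ⟨t, e, rfl⟩ := h1 m
    obtain ⟨s, h, e', he'⟩ := LCAux.old_main 𝔞 n hd x hx t e
    rw [← h2 t s h e, he', map_smul, hxm]
end
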